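/- arXiv:1901.05934 — 2 statements merged into one kernel-verified Lean document; each statement's English description precedes it below -/
import Mathlib

section
/- There is a universal constant C > 0 with the following property. Let ε > 0 and let u₀ : ℝ → ℝ be a Schwartz function with ‖u₀‖_{H¹} + ‖x²u₀‖_{L²} ≤ ε. Let u(t) be the Airy evolution of u₀. Then for all t > 0 and all x ∈ ℝ one has t^{1/4}⟨x⟩^{1/4}|u(t,x)| + t^{3/4}⟨x⟩^{-1/4}|∂ₓu(t,x)| ≤ Cε, and moreover for all x ≥ 2t^{1/3} one has ⟨x⟩|u(t,x)| + t^{1/2}⟨x⟩^{1/2}|∂ₓu(t,x)| ≤ Cε·ln(t^{-1/3}⟨x⟩). -/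
open MeasureTheory Real SchwartzMap Set
open scoped FourierTransform

noncomputable section

/-- Fourier transform of a real-valued function on `ℝ`. -/
def FT (u : ℝ → ℝ) : ℝ → ℂ := 𝓕 (fun x => (u x : ℂ))

/-- Homogeneous Sobolev norm `‖u‖_{Ḣˢ}`. -/
def HsNorm (s : ℝ) (u : ℝ → ℝ) : ℝ :=
  (∫ ξ : ℝ, |ξ| ^ (2 * s) * ‖FT u ξ‖ ^ 2) ^ (1/2 : ℝ)

/-- Homogeneous Besov norm `‖u‖_{Ḃ^{-1/2}_{2,∞}}`. -/
def BesovNorm (u : ℝ → ℝ) : ℝ :=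
  ⨆ j : ℤ, (2:ℝ) ^ (-(j:ℝ)/2) *
    (∫ ξ in {ξ : ℝ | (2:ℝ)^j ≤ |ξ| ∧ |ξ| < (2:ℝ)^(j+1)}, ‖FT u ξ‖^2) ^ (1/2:ℝ)

/-- `L²` norm. -/
def L2Norm (u : ℝ → ℝ) : ℝ := (∫ x : ℝ, u x ^ 2) ^ (1/2:ℝ)

/-- `L²` norm restricted to a set. -/
def L2NormOn (A : Set ℝ) (u : ℝ → ℝ) : ℝ := (∫ x in A, u x ^ 2) ^ (1/2:ℝ)

/-- The time-dependent japanese bracket `⟨x⟩ = (x² + t^{2/3})^{1/2}`. -/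
def jb (t x : ℝ) : ℝ := (x^2 + t ^ ((2:ℝ)/3)) ^ (1/2:ℝ)

/-- The Airy evolution `u(t) = 𝓕⁻¹(e^{itξ³} 𝓕u₀)`, solving `∂ₜu + ∂ₓ³u = 0`. -/
def airy (u₀ : ℝ → ℝ) (t : ℝ) : ℝ → ℂ :=
  𝓕⁻ (fun ξ : ℝ => Complex.exp (Complex.I * (t:ℂ) * (ξ:ℂ)^3) * FT u₀ ξ)

/-- The inhomogeneous Sobolev norm `‖u‖_{H¹}`. -/
def H1Norm (u : ℝ → ℝ) : ℝ := (∫ ξ : ℝ, (1 + ξ^2) * ‖FT u ξ‖^2) ^ (1/2:ℝ)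

/-- The oscillating factor `exp(i(Xξ + ξ³))` of the Airy oscillatory integral. -/
def airyPhase (X ξ : ℝ) : ℂ := Complex.exp (((X * ξ + ξ ^ 3 : ℝ) : ℂ) * Complex.I)

lemma norm_airyPhase (X ξ : ℝ) : ‖airyPhase X ξ‖ = 1 := Complex.norm_exp_ofReal_mul_I _

lemma hasDerivAt_airyPhase (X ξ : ℝ) :
    HasDerivAt (airyPhase X) (airyPhase X ξ * (((X + 3 * ξ ^ 2 : ℝ) : ℂ) * Complex.I)) ξ := by
  have h1 : HasDerivAt (fun ξ : ℝ => X * ξ + ξ ^ 3) (X + 3 * ξ ^ 2) ξ := by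
    simpa using ((hasDerivAt_id ξ).const_mul X).fun_add (hasDerivAt_pow 3 ξ)
  exact (h1.ofReal_comp.mul_const Complex.I).cexp

lemma continuous_airyPhase (X : ℝ) : Continuous (airyPhase X) := by
  unfold airyPhase
  fun_prop

/-- First-derivative test: one integration by parts against the Airy phase. -/
lemma norm_integral_airyPhase_mul_le {h h' : ℝ → ℂ} (hh : ∀ ξ, HasDerivAt h (h' ξ) ξ)
    (hh' : Continuous h') (X : ℝ) {a b : ℝ} (hab : a ≤ b)
    (hP : ∀ ξ ∈ Icc a b, X + 3 * ξ ^ 2 ≠ 0) :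
    ‖∫ ξ in a..b, airyPhase X ξ * h ξ‖ ≤
      ‖h b‖ / |X + 3 * b ^ 2| + ‖h a‖ / |X + 3 * a ^ 2| +
        ∫ ξ in a..b, (‖h' ξ‖ / |X + 3 * ξ ^ 2| + ‖h ξ‖ * |6 * ξ| / (X + 3 * ξ ^ 2) ^ 2) := by
  have hc : Continuous h := continuous_iff_continuousAt.2 fun ξ => (hh ξ).continuousAt
  have hPc : ∀ ξ ∈ Icc a b, ((X + 3 * ξ ^ 2 : ℝ) : ℂ) * Complex.I ≠ 0 := fun ξ hξ =>
    mul_ne_zero (Complex.ofReal_ne_zero.2 (hP ξ hξ)) Complex.I_ne_zero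
  set F : ℝ → ℂ := fun ξ => airyPhase X ξ * (h ξ / (((X + 3 * ξ ^ 2 : ℝ) : ℂ) * Complex.I)) with hF
  set R : ℝ → ℂ := fun ξ => airyPhase X ξ *
    ((h' ξ * (((X + 3 * ξ ^ 2 : ℝ) : ℂ) * Complex.I) - h ξ * (((6 * ξ : ℝ) : ℂ) * Complex.I)) /
      (((X + 3 * ξ ^ 2 : ℝ) : ℂ) * Complex.I) ^ 2) with hR
  have hd : ∀ ξ ∈ Icc a b, HasDerivAt F (airyPhase X ξ * h ξ + R ξ) ξ := by
    intro ξ hξ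
    have h1 : HasDerivAt (fun ξ : ℝ => X + 3 * ξ ^ 2) (6 * ξ) ξ := by
      refine (((hasDerivAt_pow 2 ξ).const_mul 3).const_add X).congr_deriv ?_
      norm_num
      ring
    have h2 := (hasDerivAt_airyPhase X ξ).fun_mul
      ((hh ξ).fun_div (h1.ofReal_comp.mul_const Complex.I) (hPc ξ hξ))
    refine h2.congr_deriv ?_
    simp only [hR]
    have hz := hPc ξ hξ
    generalize ((X + 3 * ξ ^ 2 : ℝ) : ℂ) * Complex.I = z at hz ⊢
    field_simp
  have hcont1 : Continuous fun ξ => airyPhase X ξ * h ξ := (continuous_airyPhase X).mul hc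
  have hcontR : ContinuousOn R (Icc a b) := by
    refine (continuous_airyPhase X).continuousOn.mul (ContinuousOn.div ?_ ?_ ?_)
    · fun_prop
    · fun_prop
    · exact fun ξ hξ => pow_ne_zero 2 (hPc ξ hξ)
  have hi1 : IntervalIntegrable (fun ξ => airyPhase X ξ * h ξ) volume a b :=
    hcont1.intervalIntegrable _ _
  have hiR : IntervalIntegrable R volume a b :=
    ContinuousOn.intervalIntegrable (by rwa [uIcc_of_le hab])
  have hFTC := intervalIntegral.integral_eq_sub_of_hasDerivAt (f := F)
    (f' := fun ξ => airyPhase X ξ * h ξ + R ξ) (a := a) (b := b)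
    (fun ξ hξ => hd ξ (by rwa [uIcc_of_le hab] at hξ)) (hi1.add hiR)
  rw [intervalIntegral.integral_add hi1 hiR] at hFTC
  have key : ∫ ξ in a..b, airyPhase X ξ * h ξ = F b - F a - ∫ ξ in a..b, R ξ :=
    eq_sub_of_add_eq hFTC
  have hFn : ∀ ξ, ‖F ξ‖ = ‖h ξ‖ / |X + 3 * ξ ^ 2| := by
    intro ξ
    simp only [hF, norm_mul, norm_div, norm_airyPhase, Complex.norm_I, Complex.norm_real,
      Real.norm_eq_abs, one_mul, mul_one]
  have hRn : ‖∫ ξ in a..b, R ξ‖ ≤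
      ∫ ξ in a..b, (‖h' ξ‖ / |X + 3 * ξ ^ 2| + ‖h ξ‖ * |6 * ξ| / (X + 3 * ξ ^ 2) ^ 2) := by
    refine intervalIntegral.norm_integral_le_of_norm_le hab ?_ ?_
    · refine ae_of_all _ fun ξ hξ => ?_
      have hne := hP ξ ⟨hξ.1.le, hξ.2⟩
      have hpos : 0 < |X + 3 * ξ ^ 2| := abs_pos.2 hne
      simp only [hR, norm_mul, norm_div, norm_airyPhase, one_mul, norm_pow, Complex.norm_I,
        Complex.norm_real, Real.norm_eq_abs, mul_one, sq_abs]
      have : ‖h' ξ‖ / |X + 3 * ξ ^ 2| = ‖h' ξ‖ * |X + 3 * ξ ^ 2| / (X + 3 * ξ ^ 2) ^ 2 := by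
        rw [← sq_abs (X + 3 * ξ ^ 2)]
        field_simp
      rw [this, ← add_div]
      gcongr
      refine (norm_sub_le _ _).trans (le_of_eq ?_)
      simp only [norm_mul, Complex.norm_I, Complex.norm_real, Real.norm_eq_abs, mul_one, abs_mul]
    · refine ContinuousOn.intervalIntegrable ?_
      rw [uIcc_of_le hab]
      refine ContinuousOn.add (ContinuousOn.div ?_ ?_ ?_) (ContinuousOn.div ?_ ?_ ?_)
      · fun_prop
      · fun_prop
      · exact fun ξ hξ => (abs_pos.2 (hP ξ hξ)).ne'
      · fun_prop
      · fun_prop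
      · exact fun ξ hξ => pow_ne_zero 2 (hP ξ hξ)
  rw [key]
  refine (norm_sub_le _ _).trans (add_le_add ((norm_sub_le _ _).trans (le_of_eq ?_)) hRn)
  rw [hFn, hFn]

/-- `g` is `C¹` with derivative `g'`, is bounded by `A`, and `√ξ g'` has `L²(0,∞)` norm at
most `A`. -/
structure IsAiryAmplitude (A : ℝ) (g g' : ℝ → ℂ) : Prop where
  hasDerivAt : ∀ ξ, HasDerivAt g (g' ξ) ξ
  continuous_deriv : Continuous g'
  norm_le : ∀ ξ, ‖g ξ‖ ≤ A
  energy_le : ∀ a b, 0 ≤ a → a ≤ b → ∫ ξ in a..b, ξ * ‖g' ξ‖ ^ 2 ≤ A ^ 2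

lemma IsAiryAmplitude.continuous {A : ℝ} {g g' : ℝ → ℂ} (hg : IsAiryAmplitude A g g') :
    Continuous g :=
  continuous_iff_continuousAt.2 fun ξ => (hg.hasDerivAt ξ).continuousAt

/-- First-derivative test for amplitudes `ξᵏ g`, with the part carrying `g'` estimated by
Cauchy-Schwarz. -/
lemma IsAiryAmplitude.norm_integral_le {A : ℝ} {g g' : ℝ → ℂ} (hg : IsAiryAmplitude A g g')
    (hA : 0 < A) (k : ℕ) (X : ℝ) {a b M N : ℝ} (ha : 0 < a) (hab : a ≤ b)
    (hP : ∀ ξ ∈ Icc a b, X + 3 * ξ ^ 2 ≠ 0) (hM : 0 < M)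
    (hMi : ∫ ξ in a..b, ξ ^ (2 * k) / (ξ * (X + 3 * ξ ^ 2) ^ 2) ≤ M ^ 2)
    (hNi : ∫ ξ in a..b, (k * ξ ^ (k - 1) / |X + 3 * ξ ^ 2| +
      6 * ξ ^ (k + 1) / (X + 3 * ξ ^ 2) ^ 2) ≤ N)
    (hNa : a ^ k / |X + 3 * a ^ 2| ≤ N) (hNb : b ^ k / |X + 3 * b ^ 2| ≤ N) :
    ‖∫ ξ in a..b, airyPhase X ξ * ((ξ : ℂ) ^ k * g ξ)‖ ≤ A * (3 * N + M) := by
  have hgc := hg.continuous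
  have hgc' := hg.continuous_deriv
  set h' : ℝ → ℂ := fun ξ => (k * (ξ : ℂ) ^ (k - 1)) * g ξ + (ξ : ℂ) ^ k * g' ξ with hh'
  have hd : ∀ ξ : ℝ, HasDerivAt (fun ξ : ℝ => (ξ : ℂ) ^ k * g ξ) (h' ξ) ξ := fun ξ =>
    ((hasDerivAt_pow k (ξ : ℂ)).comp_ofReal).fun_mul (hg.hasDerivAt ξ)
  have hc' : Continuous h' := by fun_prop
  have main := norm_integral_airyPhase_mul_le hd hc' X hab hP
  have hnorm : ∀ ξ : ℝ, 0 < ξ → ‖(ξ : ℂ) ^ k * g ξ‖ ≤ A * ξ ^ k := by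
    intro ξ hξ
    rw [norm_mul, norm_pow, Complex.norm_real, Real.norm_eq_abs, abs_of_pos hξ, mul_comm]
    exact mul_le_mul_of_nonneg_right (hg.norm_le ξ) (by positivity)
  have hnorm' : ∀ ξ : ℝ, 0 < ξ → ‖h' ξ‖ ≤ A * (k * ξ ^ (k - 1)) + ξ ^ k * ‖g' ξ‖ := by
    intro ξ hξ
    refine (norm_add_le _ _).trans ?_
    simp only [norm_mul, norm_pow, Complex.norm_real, Real.norm_eq_abs, abs_of_pos hξ,
      Complex.norm_natCast]
    rw [mul_comm A]
    gcongr
    exact hg.norm_le ξ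
  have hpos : ∀ ξ ∈ Icc a b, 0 < ξ := fun ξ hξ => ha.trans_le hξ.1
  have hi0 : IntervalIntegrable (fun ξ => ‖h' ξ‖ / |X + 3 * ξ ^ 2| +
      ‖(ξ : ℂ) ^ k * g ξ‖ * |6 * ξ| / (X + 3 * ξ ^ 2) ^ 2) volume a b := by
    refine ContinuousOn.intervalIntegrable ?_
    rw [uIcc_of_le hab]
    refine ContinuousOn.add (ContinuousOn.div (by fun_prop) (by fun_prop) ?_)
      (ContinuousOn.div (by fun_prop) (by fun_prop) ?_)
    · exact fun ξ hξ => (abs_pos.2 (hP ξ hξ)).ne'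
    · exact fun ξ hξ => pow_ne_zero 2 (hP ξ hξ)
  have hi1 : IntervalIntegrable (fun ξ => k * ξ ^ (k - 1) / |X + 3 * ξ ^ 2| +
      6 * ξ ^ (k + 1) / (X + 3 * ξ ^ 2) ^ 2) volume a b := by
    refine ContinuousOn.intervalIntegrable ?_
    rw [uIcc_of_le hab]
    refine ContinuousOn.add (ContinuousOn.div (by fun_prop) (by fun_prop) ?_)
      (ContinuousOn.div (by fun_prop) (by fun_prop) ?_)
    · exact fun ξ hξ => (abs_pos.2 (hP ξ hξ)).ne'
    · exact fun ξ hξ => pow_ne_zero 2 (hP ξ hξ)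
  have hi2 : IntervalIntegrable (fun ξ => ξ * ‖g' ξ‖ ^ 2) volume a b :=
    Continuous.intervalIntegrable (by fun_prop) _ _
  have hi3 : IntervalIntegrable (fun ξ => ξ ^ (2 * k) / (ξ * (X + 3 * ξ ^ 2) ^ 2))
      volume a b := by
    refine ContinuousOn.intervalIntegrable ?_
    rw [uIcc_of_le hab]
    refine ContinuousOn.div (by fun_prop) (by fun_prop) fun ξ hξ => ?_
    exact mul_ne_zero (hpos ξ hξ).ne' (pow_ne_zero 2 (hP ξ hξ))
  have hmono : ∫ ξ in a..b, (‖h' ξ‖ / |X + 3 * ξ ^ 2| +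
      ‖(ξ : ℂ) ^ k * g ξ‖ * |6 * ξ| / (X + 3 * ξ ^ 2) ^ 2) ≤
      ∫ ξ in a..b, (A * (k * ξ ^ (k - 1) / |X + 3 * ξ ^ 2| +
        6 * ξ ^ (k + 1) / (X + 3 * ξ ^ 2) ^ 2) + (M / (2 * A) * (ξ * ‖g' ξ‖ ^ 2) +
        A / (2 * M) * (ξ ^ (2 * k) / (ξ * (X + 3 * ξ ^ 2) ^ 2)))) := by
    refine intervalIntegral.integral_mono_on hab hi0
      ((hi1.const_mul A).add ((hi2.const_mul _).add (hi3.const_mul _))) fun ξ hξ => ?_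
    have hξ0 := hpos ξ hξ
    have hne : 0 < |X + 3 * ξ ^ 2| := abs_pos.2 (hP ξ hξ)
    rw [← sq_abs (X + 3 * ξ ^ 2)]
    generalize |X + 3 * ξ ^ 2| = p at hne
    have e1 : ‖h' ξ‖ / p ≤ (A * (k * ξ ^ (k - 1)) + ξ ^ k * ‖g' ξ‖) / p :=
      div_le_div_of_nonneg_right (hnorm' ξ hξ0) hne.le
    have e2 : ‖(ξ : ℂ) ^ k * g ξ‖ * |6 * ξ| / p ^ 2 ≤ A * ξ ^ k * (6 * ξ) / p ^ 2 := by
      rw [abs_of_pos (by positivity : 0 < 6 * ξ)]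
      gcongr
      exact hnorm ξ hξ0
    have e3 : ξ ^ k * ‖g' ξ‖ / p ≤ M / (2 * A) * (ξ * ‖g' ξ‖ ^ 2) +
        A / (2 * M) * (ξ ^ (2 * k) / (ξ * p ^ 2)) := by
      have : M / (2 * A) * (ξ * ‖g' ξ‖ ^ 2) + A / (2 * M) * (ξ ^ (2 * k) / (ξ * p ^ 2)) -
          ξ ^ k * ‖g' ξ‖ / p = (M * ξ * ‖g' ξ‖ * p - A * ξ ^ k) ^ 2 / (2 * A * M * ξ * p ^ 2) := by
        rw [pow_mul' ξ 2 k]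
        field_simp
        ring
      have h0 : 0 ≤ (M * ξ * ‖g' ξ‖ * p - A * ξ ^ k) ^ 2 / (2 * A * M * ξ * p ^ 2) := by
        positivity
      linarith
    rw [add_div] at e1
    calc _ ≤ _ := add_le_add e1 e2
      _ = A * (k * ξ ^ (k - 1) / p + 6 * ξ ^ (k + 1) / p ^ 2) + ξ ^ k * ‖g' ξ‖ / p := by ring
      _ ≤ _ := by gcongr
  rw [intervalIntegral.integral_add (hi1.const_mul A) ((hi2.const_mul _).add (hi3.const_mul _)),
    intervalIntegral.integral_add (hi2.const_mul _) (hi3.const_mul _),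
    intervalIntegral.integral_const_mul, intervalIntegral.integral_const_mul,
    intervalIntegral.integral_const_mul] at hmono
  have hE := hg.energy_le a b ha.le hab
  have f1 : ‖(b : ℂ) ^ k * g b‖ / |X + 3 * b ^ 2| ≤ A * N := by
    refine (div_le_div_of_nonneg_right (hnorm b (ha.trans_le hab)) (abs_nonneg _)).trans ?_
    rw [mul_div_assoc]
    gcongr
  have f2 : ‖(a : ℂ) ^ k * g a‖ / |X + 3 * a ^ 2| ≤ A * N := by
    refine (div_le_div_of_nonneg_right (hnorm a ha) (abs_nonneg _)).trans ?_
    rw [mul_div_assoc]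
    gcongr
  have f3 := mul_le_mul_of_nonneg_left hNi hA.le
  have f4 := mul_le_mul_of_nonneg_left hE (by positivity : 0 ≤ M / (2 * A))
  have f5 := mul_le_mul_of_nonneg_left hMi (by positivity : 0 ≤ A / (2 * M))
  have f6 : M / (2 * A) * A ^ 2 + A / (2 * M) * M ^ 2 = A * M := by
    field_simp
    ring
  linarith

/-- A majorant with a known primitive bounds an interval integral. -/
lemma integral_le_of_le_hasDerivAt {f W w : ℝ → ℝ} {a b S : ℝ} (hab : a ≤ b)
    (hf : ContinuousOn f (Icc a b)) (hW : ∀ ξ ∈ Icc a b, HasDerivAt W (w ξ) ξ)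
    (hfw : ∀ ξ ∈ Icc a b, f ξ ≤ w ξ) (hS : W b - W a ≤ S) : ∫ ξ in a..b, f ξ ≤ S :=
  (intervalIntegral.integral_le_sub_of_hasDeriv_right_of_le hab
    (fun ξ hξ => (hW ξ hξ).continuousAt.continuousWithinAt)
    (fun ξ hξ => (hW ξ (Ioo_subset_Icc_self hξ)).hasDerivWithinAt)
    hf.integrableOn_Icc fun ξ hξ => hfw ξ (Ioo_subset_Icc_self hξ)).trans hS

lemma IsAiryAmplitude.norm_integral_le_of_trivial {A : ℝ} {g g' : ℝ → ℂ}
    (hg : IsAiryAmplitude A g g') (hA : 0 < A) (k : ℕ) (X : ℝ) {a b : ℝ} (ha : 0 ≤ a)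
    (hab : a ≤ b) :
    ‖∫ ξ in a..b, airyPhase X ξ * ((ξ : ℂ) ^ k * g ξ)‖ ≤ A * (b ^ k * (b - a)) := by
  have := intervalIntegral.norm_integral_le_of_norm_le_const (a := a) (b := b) (C := A * b ^ k)
    (f := fun ξ : ℝ => airyPhase X ξ * ((ξ : ℂ) ^ k * g ξ)) fun ξ hξ => by
      rw [uIoc_of_le hab] at hξ
      have h0 : 0 ≤ ξ := ha.trans hξ.1.le
      rw [norm_mul, norm_airyPhase, one_mul, norm_mul, norm_pow, Complex.norm_real,
        Real.norm_eq_abs, abs_of_nonneg h0, mul_comm]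
      exact mul_le_mul (hg.norm_le ξ) (pow_le_pow_left₀ h0 hξ.2 k) (by positivity) hA.le
  rwa [abs_of_nonneg (sub_nonneg.2 hab), mul_assoc] at this

lemma integral_le_of_le_div_sq {f : ℝ → ℝ} {a b c r δ : ℝ} (hab : a ≤ b) (hc : 0 ≤ c)
    (hδ : 0 < δ) (hf : ContinuousOn f (Icc a b)) (hr : r + δ ≤ a ∨ b ≤ r - δ)
    (hfc : ∀ ξ ∈ Icc a b, f ξ ≤ c / (ξ - r) ^ 2) : ∫ ξ in a..b, f ξ ≤ c / δ := by
  have hne : ∀ ξ ∈ Icc a b, ξ - r ≠ 0 := by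
    intro ξ hξ
    rcases hr with h | h
    · have := hξ.1
      exact (by linarith : 0 < ξ - r).ne'
    · have := hξ.2
      exact (by linarith : ξ - r < 0).ne
  refine integral_le_of_le_hasDerivAt (W := fun ξ => -c / (ξ - r))
    (w := fun ξ => c / (ξ - r) ^ 2) hab hf (fun ξ hξ => ?_) hfc ?_
  · refine ((hasDerivAt_const ξ (-c)).fun_div ((hasDerivAt_id ξ).sub_const r)
      (hne ξ hξ)).congr_deriv ?_
    simp
  · have e : ∀ ξ, -c / (ξ - r) = c / (r - ξ) := fun ξ => by
      rw [← neg_sub r ξ, div_neg, neg_div, neg_neg]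
    rcases hr with h | h
    · have h1 : -c / (b - r) ≤ 0 :=
        div_nonpos_of_nonpos_of_nonneg (by linarith) (by linarith)
      have h2 : c / (a - r) ≤ c / δ := div_le_div_of_nonneg_left hc hδ (by linarith)
      have h3 : -c / (a - r) = -(c / (a - r)) := neg_div _ _
      simp only [h3]
      linarith
    · have h1 : 0 ≤ c / (r - a) := div_nonneg hc (by linarith)
      have h2 : c / (r - b) ≤ c / δ := div_le_div_of_nonneg_left hc hδ (by linarith)
      simp only [e]
      linarith

section NonStationary

variable {A : ℝ} {g g' : ℝ → ℂ} {X q a b : ℝ}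

/-- Lower bounds for the phase derivative away from the stationary point `q²`. -/
lemma phase_deriv_bounds (hq : 1 ≤ q) (ha : 1 / (2 * q) ≤ a)
    (hr : q ^ 2 + 1 / (2 * q) ≤ a ∨ b ≤ q ^ 2 - 1 / (2 * q))
    (hP : ∀ ξ ∈ Icc a b, 3 * |ξ - q ^ 2| * (ξ + q ^ 2) ≤ |X + 3 * ξ ^ 2|) :
    (∀ ξ ∈ Icc a b, 1 / (2 * q) ≤ |ξ - q ^ 2|) ∧ (∀ ξ ∈ Icc a b, X + 3 * ξ ^ 2 ≠ 0) ∧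
      ∀ ξ ∈ Icc a b, ∀ c d : ℝ, 0 ≤ c → c ≤ d * (9 * (ξ + q ^ 2) ^ 2) →
        c / (X + 3 * ξ ^ 2) ^ 2 ≤ d / (ξ - q ^ 2) ^ 2 := by
  have hq0 : 0 < q := by linarith
  have hδ : 0 < 1 / (2 * q) := by positivity
  have hξ0 : ∀ ξ ∈ Icc a b, 1 / (2 * q) ≤ ξ := fun ξ hξ => ha.trans hξ.1
  have hdist : ∀ ξ ∈ Icc a b, 1 / (2 * q) ≤ |ξ - q ^ 2| := by
    intro ξ hξ
    rcases hr with h | h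
    · exact (by linarith [hξ.1] : _ ≤ ξ - q ^ 2).trans (le_abs_self _)
    · exact (by linarith [hξ.2] : _ ≤ -(ξ - q ^ 2)).trans (neg_le_abs _)
  have hPpos : ∀ ξ ∈ Icc a b, 0 < 3 * |ξ - q ^ 2| * (ξ + q ^ 2) := fun ξ hξ => by
    have h1 := hδ.trans_le (hξ0 ξ hξ)
    have h2 := hδ.trans_le (hdist ξ hξ)
    positivity
  have hne : ∀ ξ ∈ Icc a b, X + 3 * ξ ^ 2 ≠ 0 := fun ξ hξ =>
    abs_pos.1 ((hPpos ξ hξ).trans_le (hP ξ hξ))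
  refine ⟨hdist, hne, ?_⟩
  intro ξ hξ c d hc hcd
  have h1 := hPpos ξ hξ
  have h2 : 0 < |ξ - q ^ 2| := hδ.trans_le (hdist ξ hξ)
  have h3 : 0 < ξ + q ^ 2 := by have := hδ.trans_le (hξ0 ξ hξ); positivity
  calc c / (X + 3 * ξ ^ 2) ^ 2 = c / |X + 3 * ξ ^ 2| ^ 2 := by rw [sq_abs]
    _ ≤ c / (3 * |ξ - q ^ 2| * (ξ + q ^ 2)) ^ 2 := by
        gcongr
        exact hP ξ hξ
    _ = c / (9 * (ξ + q ^ 2) ^ 2) / |ξ - q ^ 2| ^ 2 := by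
        field_simp
        norm_num
    _ ≤ d / |ξ - q ^ 2| ^ 2 := by
        gcongr
        rwa [div_le_iff₀ (by positivity)]
    _ = _ := by rw [sq_abs]

/-- Contribution away from the stationary point `q²`, without weight. -/
lemma IsAiryAmplitude.norm_integral_le_zero (hg : IsAiryAmplitude A g g') (hA : 0 < A)
    (hq : 1 ≤ q) (ha : 1 / (2 * q) ≤ a) (hab : a ≤ b)
    (hr : q ^ 2 + 1 / (2 * q) ≤ a ∨ b ≤ q ^ 2 - 1 / (2 * q))
    (hP : ∀ ξ ∈ Icc a b, 3 * |ξ - q ^ 2| * (ξ + q ^ 2) ≤ |X + 3 * ξ ^ 2|) :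
    ‖∫ ξ in a..b, airyPhase X ξ * ((ξ : ℂ) ^ 0 * g ξ)‖ ≤ A * (7 / q) := by
  have hq0 : 0 < q := by linarith
  have hδ : 0 < 1 / (2 * q) := by positivity
  have hξ0 : ∀ ξ ∈ Icc a b, 1 / (2 * q) ≤ ξ := fun ξ hξ => ha.trans hξ.1
  obtain ⟨hdist, hne, hsq⟩ := phase_deriv_bounds hq ha hr hP
  have hbd : ∀ ξ ∈ Icc a b, ξ ^ 0 / |X + 3 * ξ ^ 2| ≤ 2 / q := by
    intro ξ hξ
    have h1 : 3 * (1 / (2 * q)) * q ^ 2 ≤ |X + 3 * ξ ^ 2| := by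
      refine le_trans ?_ (hP ξ hξ)
      have := hdist ξ hξ
      have := hξ0 ξ hξ
      gcongr
      linarith
    rw [pow_zero, div_le_div_iff₀ (abs_pos.2 (hne ξ hξ)) hq0]
    have h2 : 3 * (1 / (2 * q)) * q ^ 2 = 3 / 2 * q := by field_simp
    linarith
  have key := hg.norm_integral_le hA 0 X (M := 1 / q) (N := 2 / q) (hδ.trans_le ha) hab hne
    (by positivity) ?_ ?_ (hbd a ⟨le_rfl, hab⟩) (hbd b ⟨hab, le_rfl⟩)
  · refine key.trans (le_of_eq ?_)
    ring
  · have := integral_le_of_le_div_sq (f := fun ξ => ξ ^ (2 * 0) / (ξ * (X + 3 * ξ ^ 2) ^ 2))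
      (c := 2 * q / (9 * q ^ 4)) hab (by positivity) hδ ?_ hr fun ξ hξ => ?_
    · refine this.trans ?_
      have h1 : 2 * q / (9 * q ^ 4) / (1 / (2 * q)) = 4 / 9 * (1 / q) ^ 2 := by
        field_simp
        norm_num
      linarith [sq_nonneg (1 / q)]
    · refine ContinuousOn.div (by fun_prop) (by fun_prop) fun ξ hξ => ?_
      exact mul_ne_zero (hδ.trans_le (hξ0 ξ hξ)).ne' (pow_ne_zero 2 (hne ξ hξ))
    · have h0 := hδ.trans_le (hξ0 ξ hξ)
      have h4 := hξ0 ξ hξ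
      rw [← div_div]
      refine hsq ξ hξ _ _ (by positivity) ?_
      have h1 : ξ ^ (2 * 0) / ξ ≤ 2 * q := by
        rw [mul_zero, pow_zero, div_le_iff₀ h0]
        rw [div_le_iff₀ (by positivity)] at h4
        linarith
      refine h1.trans ?_
      rw [div_mul_eq_mul_div, le_div_iff₀ (by positivity)]
      have : q ^ 4 ≤ (ξ + q ^ 2) ^ 2 := by nlinarith [mul_pos h0 (pow_pos hq0 2)]
      nlinarith
  · have := integral_le_of_le_div_sq (f := fun ξ => ((0 : ℕ) : ℝ) * ξ ^ (0 - 1) /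
        |X + 3 * ξ ^ 2| + 6 * ξ ^ (0 + 1) / (X + 3 * ξ ^ 2) ^ 2)
      (c := 1 / q ^ 2) hab (by positivity) hδ ?_ hr fun ξ hξ => ?_
    · refine this.trans (le_of_eq ?_)
      field_simp
    · refine ContinuousOn.add (ContinuousOn.div (by fun_prop) (by fun_prop) ?_)
        (ContinuousOn.div (by fun_prop) (by fun_prop) ?_)
      · exact fun ξ hξ => (abs_pos.2 (hne ξ hξ)).ne'
      · exact fun ξ hξ => pow_ne_zero 2 (hne ξ hξ)
    · have h0 := hδ.trans_le (hξ0 ξ hξ)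
      simp only [Nat.cast_zero, zero_mul, zero_div, zero_add, pow_one]
      refine hsq ξ hξ _ _ (by positivity) ?_
      rw [div_mul_eq_mul_div, le_div_iff₀ (by positivity)]
      nlinarith [mul_pos h0 (pow_pos hq0 2)]

/-- Contribution away from the stationary point `q²`, with weight `ξ`. -/
lemma IsAiryAmplitude.norm_integral_le_one (hg : IsAiryAmplitude A g g') (hA : 0 < A)
    (hq : 1 ≤ q) (ha : 1 / (2 * q) ≤ a) (hab : a ≤ b)
    (hr : q ^ 2 + 1 / (2 * q) ≤ a ∨ b ≤ q ^ 2 - 1 / (2 * q))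
    (hP : ∀ ξ ∈ Icc a b, 3 * |ξ - q ^ 2| * (ξ + q ^ 2) ≤ |X + 3 * ξ ^ 2|) :
    ‖∫ ξ in a..b, airyPhase X ξ * ((ξ : ℂ) ^ 1 * g ξ)‖ ≤ A * (14 * q) := by
  have hq0 : 0 < q := by linarith
  have hδ : 0 < 1 / (2 * q) := by positivity
  have hξ0 : ∀ ξ ∈ Icc a b, 1 / (2 * q) ≤ ξ := fun ξ hξ => ha.trans hξ.1
  obtain ⟨hdist, hne, hsq⟩ := phase_deriv_bounds hq ha hr hP
  have hbd : ∀ ξ ∈ Icc a b, ξ ^ 1 / |X + 3 * ξ ^ 2| ≤ 4 * q := by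
    intro ξ hξ
    have h0 := hδ.trans_le (hξ0 ξ hξ)
    have h1 : 3 * (1 / (2 * q)) * ξ ≤ |X + 3 * ξ ^ 2| := by
      refine le_trans ?_ (hP ξ hξ)
      have := hdist ξ hξ
      gcongr
      linarith [sq_nonneg q]
    rw [pow_one, div_le_iff₀ (abs_pos.2 (hne ξ hξ))]
    have h2 : ξ = 3 * (1 / (2 * q)) * ξ * (2 / 3 * q) := by field_simp
    have h3 := mul_le_mul_of_nonneg_right h1 (by positivity : 0 ≤ 2 / 3 * q)
    nlinarith [abs_nonneg (X + 3 * ξ ^ 2)]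
  have key := hg.norm_integral_le hA 1 X (M := 2 * q) (N := 4 * q) (hδ.trans_le ha) hab hne
    (by positivity) ?_ ?_ (hbd a ⟨le_rfl, hab⟩) (hbd b ⟨hab, le_rfl⟩)
  · refine key.trans (le_of_eq ?_)
    ring
  · have := integral_le_of_le_div_sq (f := fun ξ => ξ ^ (2 * 1) / (ξ * (X + 3 * ξ ^ 2) ^ 2))
      (c := 1 / q ^ 2) hab (by positivity) hδ ?_ hr fun ξ hξ => ?_
    · refine this.trans ?_
      rw [div_div_div_eq, div_le_iff₀ (by positivity)]
      have : 1 ≤ q ^ 3 := one_le_pow₀ hq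
      nlinarith [mul_pos hq0 hq0]
    · refine ContinuousOn.div (by fun_prop) (by fun_prop) fun ξ hξ => ?_
      exact mul_ne_zero (hδ.trans_le (hξ0 ξ hξ)).ne' (pow_ne_zero 2 (hne ξ hξ))
    · have h0 := hδ.trans_le (hξ0 ξ hξ)
      rw [← div_div]
      refine hsq ξ hξ _ _ (by positivity) ?_
      have h1 : ξ ^ (2 * 1) / ξ = ξ := by
        field_simp
      rw [h1, div_mul_eq_mul_div, le_div_iff₀ (by positivity)]
      nlinarith [mul_pos h0 (pow_pos hq0 2)]
  · have := integral_le_of_le_div_sq (f := fun ξ => ((1 : ℕ) : ℝ) * ξ ^ (1 - 1) /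
        |X + 3 * ξ ^ 2| + 6 * ξ ^ (1 + 1) / (X + 3 * ξ ^ 2) ^ 2)
      (c := 2) hab (by positivity) hδ ?_ hr fun ξ hξ => ?_
    · refine this.trans (le_of_eq ?_)
      field_simp
      norm_num
    · refine ContinuousOn.add (ContinuousOn.div (by fun_prop) (by fun_prop) ?_)
        (ContinuousOn.div (by fun_prop) (by fun_prop) ?_)
      · exact fun ξ hξ => (abs_pos.2 (hne ξ hξ)).ne'
      · exact fun ξ hξ => pow_ne_zero 2 (hne ξ hξ)
    · have h0 := hδ.trans_le (hξ0 ξ hξ)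
      have h1 : 6 * ξ ^ (1 + 1) / (X + 3 * ξ ^ 2) ^ 2 ≤ 1 / (ξ - q ^ 2) ^ 2 := by
        refine hsq ξ hξ _ _ (by positivity) ?_
        have h3 : ξ ^ (1 + 1) = ξ ^ 2 := rfl
        nlinarith [mul_pos h0 (pow_pos hq0 2), sq_nonneg ξ, sq_nonneg (q ^ 2)]
      have h2 : ((1 : ℕ) : ℝ) * ξ ^ (1 - 1) / |X + 3 * ξ ^ 2| ≤ 1 / (ξ - q ^ 2) ^ 2 := by
        simp only [Nat.cast_one, tsub_self, pow_zero, one_mul]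
        refine one_div_le_one_div_of_le ?_ ?_
        · rw [← sq_abs]
          exact pow_pos (hδ.trans_le (hdist ξ hξ)) 2
        · refine le_trans ?_ (hP ξ hξ)
          have h3 : |ξ - q ^ 2| ≤ ξ + q ^ 2 := abs_sub_le_iff.2
            ⟨by linarith [sq_nonneg q], by linarith [sq_nonneg q]⟩
          rw [← sq_abs]
          nlinarith [abs_nonneg (ξ - q ^ 2)]
      calc _ ≤ _ := add_le_add h2 h1
        _ = _ := by ring

end NonStationary

section Elliptic

variable {A : ℝ} {g g' : ℝ → ℂ} {X a b : ℝ}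

/-- Elliptic region, without weight. -/
lemma IsAiryAmplitude.norm_integral_le_zero_of_pos (hg : IsAiryAmplitude A g g') (hA : 0 < A)
    (hX : 3 ≤ X) (hX' : 1 ≤ Real.log X) (hb : 1 / X ≤ b) :
    ‖∫ ξ in (1 / X)..b, airyPhase X ξ * ((ξ : ℂ) ^ 0 * g ξ)‖ ≤
      A * (5 * (Real.log X / X)) := by
  have hX0 : 0 < X := by linarith
  have hξ0 : ∀ ξ ∈ Icc (1 / X) b, 0 < ξ := fun ξ hξ =>
    (by positivity : 0 < 1 / X).trans_le hξ.1
  have hP : ∀ ξ : ℝ, X ≤ X + 3 * ξ ^ 2 := fun ξ => by linarith [sq_nonneg ξ]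
  have hPp : ∀ ξ : ℝ, 0 < X + 3 * ξ ^ 2 := fun ξ => hX0.trans_le (hP ξ)
  have hne : ∀ ξ : ℝ, X + 3 * ξ ^ 2 ≠ 0 := fun ξ => (hPp ξ).ne'
  have hd : ∀ ξ : ℝ, HasDerivAt (fun ξ : ℝ => X + 3 * ξ ^ 2) (6 * ξ) ξ := fun ξ => by
    refine (((hasDerivAt_pow 2 ξ).const_mul 3).const_add X).congr_deriv ?_
    norm_num
    ring
  have hbd : ∀ ξ : ℝ, ξ ^ 0 / |X + 3 * ξ ^ 2| ≤ 1 / X := fun ξ => by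
    rw [pow_zero, abs_of_pos (hPp ξ)]
    exact one_div_le_one_div_of_le hX0 (hP ξ)
  have key := hg.norm_integral_le hA 0 X (M := 2 * (Real.log X / X)) (N := 1 / X)
    (by positivity) hb (fun ξ _ => hne ξ) (by positivity) ?_ ?_ (hbd _) (hbd _)
  · refine key.trans ?_
    have : 1 / X ≤ Real.log X / X := by gcongr
    gcongr
    linarith
  · refine integral_le_of_le_hasDerivAt
      (W := fun ξ => 1 / (2 * X ^ 2) * (2 * Real.log ξ - Real.log (X + 3 * ξ ^ 2)))
      (w := fun ξ => 1 / (2 * X ^ 2) * (2 * ξ⁻¹ - 6 * ξ / (X + 3 * ξ ^ 2))) hb ?_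
      (fun ξ hξ => ?_) (fun ξ hξ => ?_) ?_
    · refine ContinuousOn.div (by fun_prop) (by fun_prop) fun ξ hξ => ?_
      exact mul_ne_zero (hξ0 ξ hξ).ne' (pow_ne_zero 2 (hne ξ))
    · exact (((Real.hasDerivAt_log (hξ0 ξ hξ).ne').const_mul 2).fun_sub
        ((hd ξ).log (hne ξ))).const_mul _
    · have h0 := hξ0 ξ hξ
      have hp := hPp ξ
      have e : 1 / (2 * X ^ 2) * (2 * ξ⁻¹ - 6 * ξ / (X + 3 * ξ ^ 2)) =
          1 / (ξ * (X + 3 * ξ ^ 2) * X) := by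
        field_simp
        ring
      rw [e, mul_zero, pow_zero, sq, ← mul_assoc]
      gcongr
      exact hP ξ
    · have hb0 : 0 < b := hξ0 b ⟨hb, le_rfl⟩
      have h1 : 2 * Real.log b ≤ Real.log (X + 3 * b ^ 2) := by
        have : 2 * Real.log b = Real.log (b ^ 2) := by rw [Real.log_pow]; norm_num
        rw [this]
        exact Real.log_le_log (by positivity) (by linarith [sq_nonneg b])
      have h2 : Real.log (1 / X) = -Real.log X := by rw [one_div, Real.log_inv]
      have h3 : Real.log (X + 3 * (1 / X) ^ 2) ≤ 2 * Real.log X := by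
        have : 2 * Real.log X = Real.log (X ^ 2) := by rw [Real.log_pow]; norm_num
        rw [this]
        refine Real.log_le_log (hPp _) ?_
        have : 1 / X ≤ 1 := by rw [div_le_one hX0]; linarith
        have : (1 / X) ^ 2 ≤ 1 := pow_le_one₀ (by positivity) this
        nlinarith
      have h4 : (2 * (Real.log X / X)) ^ 2 = 1 / (2 * X ^ 2) * (8 * Real.log X ^ 2) := by
        field_simp
        norm_num
      rw [h4, ← mul_sub]
      refine mul_le_mul_of_nonneg_left ?_ (by positivity)
      rw [h2]
      nlinarith
  · refine integral_le_of_le_hasDerivAt (W := fun ξ => -(X + 3 * ξ ^ 2)⁻¹)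
      (w := fun ξ => 6 * ξ / (X + 3 * ξ ^ 2) ^ 2) hb ?_
      (fun ξ hξ => ?_) (fun ξ hξ => ?_) ?_
    · refine ContinuousOn.add (ContinuousOn.div (by fun_prop) (by fun_prop) ?_)
        (ContinuousOn.div (by fun_prop) (by fun_prop) ?_)
      · exact fun ξ _ => (abs_pos.2 (hne ξ)).ne'
      · exact fun ξ _ => pow_ne_zero 2 (hne ξ)
    · refine ((hd ξ).fun_inv (hne ξ)).fun_neg.congr_deriv ?_
      rw [neg_div, neg_neg]
    · simp
    · have h1 : 0 ≤ (X + 3 * b ^ 2)⁻¹ := inv_nonneg.2 (hPp b).le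
      have h2 := hbd (1 / X)
      rw [pow_zero, abs_of_pos (hPp _), one_div (X + _)] at h2
      linarith

/-- Elliptic region, with weight `ξ`. -/
lemma IsAiryAmplitude.norm_integral_le_one_of_pos {p : ℝ} (hg : IsAiryAmplitude A g g')
    (hA : 0 < A) (hp : 0 < p) (ha : 0 < a) (hab : a ≤ b) :
    ‖∫ ξ in a..b, airyPhase (p ^ 2) ξ * ((ξ : ℂ) ^ 1 * g ξ)‖ ≤ A * (20 / p) := by
  have hξ0 : ∀ ξ ∈ Icc a b, 0 < ξ := fun ξ hξ => ha.trans_le hξ.1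
  have hPp : ∀ ξ : ℝ, 0 < p ^ 2 + 3 * ξ ^ 2 := fun ξ => by positivity
  have hne : ∀ ξ : ℝ, p ^ 2 + 3 * ξ ^ 2 ≠ 0 := fun ξ => (hPp ξ).ne'
  have hlow : ∀ ξ ∈ Icc a b, 1 / (p ^ 2 + 3 * ξ ^ 2) ≤ 2 / (ξ - -p) ^ 2 := fun ξ hξ => by
    have h0 := hξ0 ξ hξ
    rw [sub_neg_eq_add, div_le_div_iff₀ (hPp ξ) (by positivity)]
    nlinarith [sq_nonneg (ξ - p), sq_nonneg ξ]
  have hbd : ∀ ξ ∈ Icc a b, ξ ^ 1 / |p ^ 2 + 3 * ξ ^ 2| ≤ 6 / p := fun ξ hξ => by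
    rw [pow_one, abs_of_pos (hPp ξ), div_le_div_iff₀ (hPp ξ) hp]
    nlinarith [sq_nonneg (ξ - p), sq_nonneg ξ, sq_nonneg p]
  have hr : -p + p ≤ a ∨ b ≤ -p - p := Or.inl (by linarith)
  have key := hg.norm_integral_le hA 1 (p ^ 2) (M := 2 / p) (N := 6 / p) ha hab
    (fun ξ _ => hne ξ) (by positivity) ?_ ?_ (hbd _ ⟨le_rfl, hab⟩) (hbd _ ⟨hab, le_rfl⟩)
  · refine key.trans (le_of_eq ?_)
    ring
  · refine (integral_le_of_le_div_sq (c := 2 / p) hab (by positivity) hp ?_ hr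
      fun ξ hξ => ?_).trans ?_
    · refine ContinuousOn.div (by fun_prop) (by fun_prop) fun ξ hξ => ?_
      exact mul_ne_zero (hξ0 ξ hξ).ne' (pow_ne_zero 2 (hne ξ))
    · have h0 := hξ0 ξ hξ
      have h1 := hPp ξ
      calc ξ ^ (2 * 1) / (ξ * (p ^ 2 + 3 * ξ ^ 2) ^ 2)
          = ξ / (p ^ 2 + 3 * ξ ^ 2) * (1 / (p ^ 2 + 3 * ξ ^ 2)) := by field_simp
        _ ≤ 1 / p * (2 / (ξ - -p) ^ 2) := by
          refine mul_le_mul ?_ (hlow ξ hξ) (by positivity) (by positivity)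
          rw [div_le_div_iff₀ h1 hp]
          nlinarith [sq_nonneg (ξ - p), sq_nonneg ξ, sq_nonneg p]
        _ = _ := by ring
    · rw [div_div, div_pow]
      gcongr
      · norm_num
      · exact le_of_eq (sq p)
  · refine (integral_le_of_le_div_sq (c := 6) hab (by positivity) hp ?_ hr
      fun ξ hξ => ?_)
    · refine ContinuousOn.add (ContinuousOn.div (by fun_prop) (by fun_prop) ?_)
        (ContinuousOn.div (by fun_prop) (by fun_prop) ?_)
      · exact fun ξ _ => (abs_pos.2 (hne ξ)).ne'
      · exact fun ξ _ => pow_ne_zero 2 (hne ξ)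
    · have h1 := hPp ξ
      have h2 := hlow ξ hξ
      have h3 : 6 * ξ ^ (1 + 1) / (p ^ 2 + 3 * ξ ^ 2) ^ 2 ≤ 2 * (1 / (p ^ 2 + 3 * ξ ^ 2)) := by
        rw [mul_one_div, div_le_div_iff₀ (by positivity) h1]
        have h3 : ξ ^ (1 + 1) = ξ ^ 2 := rfl
        rw [h3]
        have := mul_pos h1 (pow_pos hp 2)
        nlinarith
      have h4 : 6 / (ξ - -p) ^ 2 = 3 * (2 / (ξ - -p) ^ 2) := by ring
      rw [h4]
      simp only [Nat.cast_one, tsub_self, pow_zero, one_mul]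
      rw [abs_of_pos h1]
      linarith

end Elliptic

section HalfLine

variable {A : ℝ} {g g' : ℝ → ℂ} {X q : ℝ}

lemma norm_integral_Ioi_le_of_forall {f : ℝ → ℂ} (hf : IntegrableOn f (Ioi 0)) {B b₀ : ℝ}
    (h : ∀ b, b₀ ≤ b → ‖∫ ξ in (0 : ℝ)..b, f ξ‖ ≤ B) : ‖∫ ξ in Ioi (0 : ℝ), f ξ‖ ≤ B :=
  le_of_tendsto (intervalIntegral_tendsto_integral_Ioi 0 hf Filter.tendsto_id).norm
    (Filter.eventually_atTop.2 ⟨b₀, h⟩)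

lemma norm_integral_le_add {f : ℝ → ℂ} (hf : Continuous f) {a b c B₁ B₂ : ℝ}
    (h₁ : ‖∫ ξ in a..b, f ξ‖ ≤ B₁) (h₂ : ‖∫ ξ in b..c, f ξ‖ ≤ B₂) :
    ‖∫ ξ in a..c, f ξ‖ ≤ B₁ + B₂ := by
  rw [← intervalIntegral.integral_add_adjacent_intervals (hf.intervalIntegrable a b)
    (hf.intervalIntegrable b c)]
  exact norm_add_le_of_le h₁ h₂

lemma IsAiryAmplitude.continuous_integrand (hg : IsAiryAmplitude A g g') (X : ℝ) (k : ℕ) :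
    Continuous fun ξ : ℝ => airyPhase X ξ * ((ξ : ℂ) ^ k * g ξ) := by
  have := hg.continuous
  have := continuous_airyPhase X
  fun_prop

lemma le_abs_phase_deriv_of_eq {ξ : ℝ} (hX : X = -3 * q ^ 4) (hξ : 0 ≤ ξ) :
    3 * |ξ - q ^ 2| * (ξ + q ^ 2) ≤ |X + 3 * ξ ^ 2| := by
  have h1 : X + 3 * ξ ^ 2 = 3 * (ξ - q ^ 2) * (ξ + q ^ 2) := by rw [hX]; ring
  rw [h1, abs_mul, abs_mul, abs_of_pos (by norm_num : (0 : ℝ) < 3),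
    abs_of_nonneg (by positivity : 0 ≤ ξ + q ^ 2)]

lemma le_abs_phase_deriv_of_le {ξ : ℝ} (hX : -3 * q ^ 4 ≤ X) (hξ : q ^ 2 ≤ ξ) :
    3 * |ξ - q ^ 2| * (ξ + q ^ 2) ≤ |X + 3 * ξ ^ 2| := by
  rw [abs_of_nonneg (by linarith : 0 ≤ ξ - q ^ 2)]
  refine le_trans ?_ (le_abs_self _)
  nlinarith

/-- Stationary phase estimate without weight. -/
lemma IsAiryAmplitude.norm_halfLine_zero_le (hg : IsAiryAmplitude A g g') (hA : 0 < A)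
    (hq : 1 ≤ q) (hX : X = -3 * q ^ 4 ∨ q = 1 ∧ -3 ≤ X)
    (hi : IntegrableOn (fun ξ : ℝ => airyPhase X ξ * ((ξ : ℂ) ^ 0 * g ξ)) (Ioi 0)) :
    ‖∫ ξ in Ioi (0 : ℝ), airyPhase X ξ * ((ξ : ℂ) ^ 0 * g ξ)‖ ≤ A * (16 / q) := by
  have hq0 : 0 < q := by linarith
  set δ := 1 / (2 * q) with hδdef
  have hδ : 0 < δ := by positivity
  have hδ2 : δ ≤ 1 / 2 := by
    rw [hδdef]
    exact one_div_le_one_div_of_le (by norm_num) (by linarith)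
  have hδq : 1 / q = 2 * δ := by rw [hδdef]; field_simp
  have hqq : 1 ≤ q ^ 2 := one_le_pow₀ hq
  have hXle : -3 * q ^ 4 ≤ X := by
    rcases hX with h | ⟨h, h'⟩
    · exact h.ge
    · rw [h]; linarith
  have hc := hg.continuous_integrand X 0
  refine norm_integral_Ioi_le_of_forall (b₀ := q ^ 2 + δ) hi fun b hb => ?_
  have htail := hg.norm_integral_le_zero (X := X) hA hq (by linarith) hb (Or.inl le_rfl)
    fun ξ hξ => le_abs_phase_deriv_of_le hXle (by linarith [hξ.1])
  have e1 : (16 : ℝ) / q = 32 * δ := by rw [div_eq_mul_one_div, hδq]; ring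
  have e2 : (7 : ℝ) / q = 14 * δ := by rw [div_eq_mul_one_div, hδq]; ring
  rw [e2] at htail
  rw [e1]
  have hAδ : 0 < A * δ := by positivity
  rcases hX with h | ⟨h, h'⟩
  · have h1 := hg.norm_integral_le_of_trivial hA 0 X le_rfl hδ.le
    have h2 := hg.norm_integral_le_zero (X := X) (a := δ) (b := q ^ 2 - δ) hA hq le_rfl
      (by linarith) (Or.inr le_rfl) fun ξ hξ => le_abs_phase_deriv_of_eq h (by linarith [hξ.1])
    have h3 := hg.norm_integral_le_of_trivial hA 0 X (a := q ^ 2 - δ) (b := q ^ 2 + δ)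
      (by linarith) (by linarith)
    rw [e2] at h2
    refine (norm_integral_le_add hc (norm_integral_le_add hc (norm_integral_le_add hc h1 h2) h3)
      htail).trans ?_
    simp only [pow_zero]
    linarith
  · have h1 := hg.norm_integral_le_of_trivial hA 0 X (a := 0) (b := q ^ 2 + δ) le_rfl
      (by linarith)
    refine (norm_integral_le_add hc h1 htail).trans ?_
    have : δ = 1 / 2 := by rw [hδdef, h]; norm_num
    rw [this, h]
    linarith

/-- Stationary phase estimate with weight `ξ`. -/
lemma IsAiryAmplitude.norm_halfLine_one_le (hg : IsAiryAmplitude A g g') (hA : 0 < A)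
    (hq : 1 ≤ q) (hX : X = -3 * q ^ 4 ∨ q = 1 ∧ -3 ≤ X)
    (hi : IntegrableOn (fun ξ : ℝ => airyPhase X ξ * ((ξ : ℂ) ^ 1 * g ξ)) (Ioi 0)) :
    ‖∫ ξ in Ioi (0 : ℝ), airyPhase X ξ * ((ξ : ℂ) ^ 1 * g ξ)‖ ≤ A * (32 * q) := by
  have hq0 : 0 < q := by linarith
  set δ := 1 / (2 * q) with hδdef
  have hδ : 0 < δ := by positivity
  have hδ2 : δ ≤ 1 / 2 := by
    rw [hδdef]
    exact one_div_le_one_div_of_le (by norm_num) (by linarith)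
  have hδq : δ * q = 1 / 2 := by rw [hδdef]; field_simp
  have hqq : 1 ≤ q ^ 2 := one_le_pow₀ hq
  have hXle : -3 * q ^ 4 ≤ X := by
    rcases hX with h | ⟨h, h'⟩
    · exact h.ge
    · rw [h]; linarith
  have hc := hg.continuous_integrand X 1
  refine norm_integral_Ioi_le_of_forall (b₀ := q ^ 2 + δ) hi fun b hb => ?_
  have htail := hg.norm_integral_le_one (X := X) hA hq (by linarith) hb (Or.inl le_rfl)
    fun ξ hξ => le_abs_phase_deriv_of_le hXle (by linarith [hξ.1])
  rcases hX with h | ⟨h, h'⟩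
  · have h1 := hg.norm_integral_le_of_trivial hA 1 X le_rfl hδ.le
    have h2 := hg.norm_integral_le_one (X := X) (a := δ) (b := q ^ 2 - δ) hA hq le_rfl
      (by linarith) (Or.inr le_rfl) fun ξ hξ => le_abs_phase_deriv_of_eq h (by linarith [hξ.1])
    have h3 := hg.norm_integral_le_of_trivial hA 1 X (a := q ^ 2 - δ) (b := q ^ 2 + δ)
      (by linarith) (by linarith)
    refine (norm_integral_le_add hc (norm_integral_le_add hc (norm_integral_le_add hc h1 h2) h3)
      htail).trans ?_
    rw [← mul_add, ← mul_add, ← mul_add]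
    refine mul_le_mul_of_nonneg_left ?_ hA.le
    have : q ^ 2 * δ = q / 2 := by linear_combination q * hδq
    nlinarith
  · have h1 := hg.norm_integral_le_of_trivial hA 1 X (a := 0) (b := q ^ 2 + δ) le_rfl
      (by linarith)
    refine (norm_integral_le_add hc h1 htail).trans ?_
    have : δ = 1 / 2 := by rw [hδdef, h]; norm_num
    rw [this, h]
    linarith

/-- Elliptic estimate without weight. -/
lemma IsAiryAmplitude.norm_halfLine_zero_le_of_pos (hg : IsAiryAmplitude A g g') (hA : 0 < A)
    (hX : 3 ≤ X) (hX' : 1 ≤ Real.log X)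
    (hi : IntegrableOn (fun ξ : ℝ => airyPhase X ξ * ((ξ : ℂ) ^ 0 * g ξ)) (Ioi 0)) :
    ‖∫ ξ in Ioi (0 : ℝ), airyPhase X ξ * ((ξ : ℂ) ^ 0 * g ξ)‖ ≤
      A * (6 * (Real.log X / X)) := by
  have hX0 : 0 < X := by linarith
  refine norm_integral_Ioi_le_of_forall (b₀ := 1 / X) hi fun b hb => ?_
  have h1 := hg.norm_integral_le_of_trivial hA 0 X (a := 0) (b := 1 / X) le_rfl (by positivity)
  have h2 := hg.norm_integral_le_zero_of_pos hA hX hX' hb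
  refine (norm_integral_le_add (hg.continuous_integrand X 0) h1 h2).trans ?_
  rw [← mul_add]
  refine mul_le_mul_of_nonneg_left ?_ hA.le
  have : 1 / X ≤ Real.log X / X := by gcongr
  simp only [pow_zero, one_mul, sub_zero]
  linarith

/-- Elliptic estimate with weight `ξ`. -/
lemma IsAiryAmplitude.norm_halfLine_one_le_of_pos {p : ℝ} (hg : IsAiryAmplitude A g g')
    (hA : 0 < A) (hp : 1 ≤ p)
    (hi : IntegrableOn (fun ξ : ℝ => airyPhase (p ^ 2) ξ * ((ξ : ℂ) ^ 1 * g ξ)) (Ioi 0)) :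
    ‖∫ ξ in Ioi (0 : ℝ), airyPhase (p ^ 2) ξ * ((ξ : ℂ) ^ 1 * g ξ)‖ ≤ A * (21 / p) := by
  have hp0 : 0 < p := by linarith
  refine norm_integral_Ioi_le_of_forall (b₀ := 1 / p) hi fun b hb => ?_
  have h1 := hg.norm_integral_le_of_trivial hA 1 (p ^ 2) (a := 0) (b := 1 / p) le_rfl
    (by positivity)
  have h2 := hg.norm_integral_le_one_of_pos hA hp0 (by positivity) hb
  refine (norm_integral_le_add (hg.continuous_integrand _ 1) h1 h2).trans ?_
  rw [← mul_add]
  refine mul_le_mul_of_nonneg_left ?_ hA.le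
  have h3 : 1 / p ≤ 1 := by rw [div_le_one hp0]; exact hp
  have h4 : 0 < 1 / p := by positivity
  have h5 : 21 / p = 1 / p + 20 / p := by ring
  rw [h5, pow_one, sub_zero]
  nlinarith

end HalfLine

section Japanese

variable {A : ℝ} {g g' : ℝ → ℂ} {s z : ℝ}

/-- Elliptic decay of the half-line integrals in terms of `z = (1 + s²)^{1/2}`. -/
lemma IsAiryAmplitude.halfLine_elliptic (hg : IsAiryAmplitude A g g') (hA : 0 < A)
    (hz0 : 0 < z) (hz : z ^ 2 = 1 + s ^ 2) (hs : 2 ≤ s)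
    (hi0 : IntegrableOn (fun ξ : ℝ => airyPhase (2 * π * s) ξ * ((ξ : ℂ) ^ 0 * g ξ)) (Ioi 0))
    (hi1 : IntegrableOn (fun ξ : ℝ => airyPhase (2 * π * s) ξ * ((ξ : ℂ) ^ 1 * g ξ)) (Ioi 0)) :
    z * ‖∫ ξ in Ioi (0 : ℝ), airyPhase (2 * π * s) ξ * ((ξ : ℂ) ^ 0 * g ξ)‖ ≤
        24 * A * Real.log z ∧
      z ^ ((1 : ℝ) / 2) * ‖∫ ξ in Ioi (0 : ℝ), airyPhase (2 * π * s) ξ * ((ξ : ℂ) ^ 1 * g ξ)‖ ≤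
        21 * A ∧ 1 / 2 ≤ Real.log z := by
  have hpi := Real.pi_gt_three
  have hpi' := Real.pi_lt_d2
  have hz5 : 5 ≤ z ^ 2 := by nlinarith
  have hz2 : 2 ≤ z := by nlinarith
  have hsz : s ≤ z := by nlinarith
  set X := 2 * π * s with hXdef
  have hX12 : 12 ≤ X := by nlinarith
  have hX0 : 0 < X := by linarith
  have hzX : z ≤ X := by
    have h1 : 6 * s ≤ X := by rw [hXdef]; gcongr; linarith
    nlinarith
  have hX7 : X ≤ 7 * z := by
    have h1 : X ≤ 7 * s := by rw [hXdef]; gcongr; linarith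
    linarith
  have hXz4 : X ≤ z ^ 4 := by nlinarith [mul_nonneg hz0.le (sq_nonneg z)]
  have hlogX : Real.log X ≤ 4 * Real.log z := by
    have : 4 * Real.log z = Real.log (z ^ 4) := by rw [Real.log_pow]; norm_num
    rw [this]
    exact Real.log_le_log hX0 hXz4
  have he := Real.exp_one_lt_d9
  have hlog1 : 1 ≤ Real.log X := by
    rw [Real.le_log_iff_exp_le hX0]
    linarith
  have hlogz : 1 / 2 ≤ Real.log z := by
    have h1 : 1 ≤ Real.log (z ^ 2) := by
      rw [Real.le_log_iff_exp_le (by positivity)]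
      linarith
    rw [Real.log_pow] at h1
    push_cast at h1
    linarith
  refine ⟨?_, ?_, hlogz⟩
  · have h := hg.norm_halfLine_zero_le_of_pos hA (by linarith) hlog1 hi0
    calc _ ≤ X * (A * (6 * (Real.log X / X))) :=
          mul_le_mul hzX h (norm_nonneg _) hX0.le
      _ = 6 * A * Real.log X := by field_simp
      _ ≤ 6 * A * (4 * Real.log z) := by gcongr
      _ = _ := by ring
  · have hp2 : √X ^ 2 = X := Real.sq_sqrt hX0.le
    have hp1 : 1 ≤ √X := Real.one_le_sqrt.2 (by linarith)
    have h := hg.norm_halfLine_one_le_of_pos (p := √X) hA hp1 (by rwa [hp2])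
    rw [hp2] at h
    have hzs : z ^ ((1 : ℝ) / 2) ≤ √X := by
      rw [← Real.sqrt_eq_rpow]
      exact Real.sqrt_le_sqrt hzX
    have hp0 : 0 < √X := by linarith
    calc _ ≤ √X * (A * (21 / √X)) := mul_le_mul hzs h (norm_nonneg _) hp0.le
      _ = _ := by field_simp

/-- Dispersive decay of the half-line integrals in terms of `z = (1 + s²)^{1/2}`. -/
lemma IsAiryAmplitude.halfLine_dispersive (hg : IsAiryAmplitude A g g') (hA : 0 < A)
    (hz0 : 0 < z) (hz : z ^ 2 = 1 + s ^ 2)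
    (hi0 : IntegrableOn (fun ξ : ℝ => airyPhase (2 * π * s) ξ * ((ξ : ℂ) ^ 0 * g ξ)) (Ioi 0))
    (hi1 : IntegrableOn (fun ξ : ℝ => airyPhase (2 * π * s) ξ * ((ξ : ℂ) ^ 1 * g ξ)) (Ioi 0)) :
    z ^ ((1 : ℝ) / 4) * ‖∫ ξ in Ioi (0 : ℝ), airyPhase (2 * π * s) ξ * ((ξ : ℂ) ^ 0 * g ξ)‖ ≤
        64 * A ∧
      z ^ (-(1 : ℝ) / 4) *
        ‖∫ ξ in Ioi (0 : ℝ), airyPhase (2 * π * s) ξ * ((ξ : ℂ) ^ 1 * g ξ)‖ ≤ 64 * A := by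
  have hz1 : 1 ≤ z := by nlinarith [sq_nonneg s]
  rcases le_or_gt 2 s with hs | hs
  · obtain ⟨h0, h1, -⟩ := hg.halfLine_elliptic hA hz0 hz hs hi0 hi1
    constructor
    · have hlog := Real.log_le_rpow_div hz0.le (by norm_num : (0 : ℝ) < 3 / 4)
      have e : z ^ ((1 : ℝ) / 4) = z ^ (-(3 : ℝ) / 4) * z := by
        rw [← Real.rpow_add_one hz0.ne']
        norm_num
      rw [e, mul_assoc]
      calc _ ≤ z ^ (-(3 : ℝ) / 4) * (24 * A * (z ^ ((3 : ℝ) / 4) / (3 / 4))) :=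
            mul_le_mul_of_nonneg_left (h0.trans (by gcongr)) (Real.rpow_nonneg hz0.le _)
        _ = z ^ (-(3 : ℝ) / 4) * z ^ ((3 : ℝ) / 4) * (32 * A) := by ring
        _ = 32 * A := by
            rw [← Real.rpow_add hz0]
            norm_num
        _ ≤ _ := by linarith
    · calc _ ≤ z ^ ((1 : ℝ) / 2) *
            ‖∫ ξ in Ioi (0 : ℝ), airyPhase (2 * π * s) ξ * ((ξ : ℂ) ^ 1 * g ξ)‖ :=
            mul_le_mul_of_nonneg_right
              (Real.rpow_le_rpow_of_exponent_le hz1 (by norm_num)) (norm_nonneg _)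
        _ ≤ 21 * A := h1
        _ ≤ _ := by linarith
  · have hpi := Real.pi_gt_three
    have hpi' := Real.pi_lt_d2
    obtain ⟨q, hq, hX, hzq, hqz⟩ : ∃ q : ℝ, 1 ≤ q ∧
        (2 * π * s = -3 * q ^ 4 ∨ q = 1 ∧ -3 ≤ 2 * π * s) ∧ z ≤ 16 * q ^ 4 ∧
        q ^ 4 ≤ 16 * z := by
      rcases le_or_gt (2 * π * s) (-3) with h | h
      · have h1 : 1 ≤ -(2 * π * s) / 3 := by linarith
        have hq4 : ((-(2 * π * s) / 3) ^ ((1 : ℝ) / 4)) ^ 4 = -(2 * π * s) / 3 := by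
          rw [← Real.rpow_natCast, ← Real.rpow_mul (by linarith)]
          norm_num
        have hs0 : s < 0 := by nlinarith
        refine ⟨(-(2 * π * s) / 3) ^ ((1 : ℝ) / 4), Real.one_le_rpow h1 (by norm_num),
          Or.inl (by rw [hq4]; ring), ?_, ?_⟩
        · rw [hq4]
          have h2 : -(2 * s) ≤ -(2 * π * s) / 3 := by nlinarith
          have h3 : z ≤ 1 - s := by nlinarith
          linarith
        · rw [hq4]
          have h2 : -(2 * π * s) / 3 ≤ -(4 * s) := by nlinarith
          have h3 : -s ≤ z := by nlinarith
          linarith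
      · have hs1 : -1 ≤ s := by nlinarith
        have hz4 : z ≤ 3 := by nlinarith
        exact ⟨1, le_rfl, Or.inr ⟨rfl, h.le⟩, by linarith, by linarith⟩
    have hq0 : 0 < q := by linarith
    set w := z ^ ((1 : ℝ) / 4) with hw
    have hw0 : 0 < w := Real.rpow_pos_of_pos hz0 _
    have hw4 : w ^ 4 = z := by
      rw [hw, ← Real.rpow_natCast, ← Real.rpow_mul hz0.le]
      norm_num
    have hwinv : z ^ (-(1 : ℝ) / 4) = w⁻¹ := by
      rw [hw, ← Real.rpow_neg hz0.le]
      norm_num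
    have h1 : w ≤ 2 * q := by
      refine le_of_pow_le_pow_left₀ (n := 4) (by norm_num) (by positivity) ?_
      rw [hw4, mul_pow]
      linarith
    have h2 : q ≤ 2 * w := by
      refine le_of_pow_le_pow_left₀ (n := 4) (by norm_num) (by positivity) ?_
      rw [mul_pow, hw4]
      linarith
    constructor
    · calc _ ≤ 2 * q * (A * (16 / q)) :=
            mul_le_mul h1 (hg.norm_halfLine_zero_le hA hq hX hi0) (norm_nonneg _) (by positivity)
        _ = 32 * A := by field_simp; norm_num
        _ ≤ _ := by linarith
    · rw [hwinv]
      calc _ ≤ w⁻¹ * (A * (32 * (2 * w))) := by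
            gcongr
            exact (hg.norm_halfLine_one_le hA hq hX hi1).trans (by gcongr)
        _ = 64 * A := by field_simp; norm_num

end Japanese

section Schwartz

lemma SchwartzMap.integrable_norm_sq (f : 𝓢(ℝ, ℂ)) : Integrable fun x => ‖f x‖ ^ 2 :=
  (f.memLp 2 volume).integrable_norm_pow (by norm_num)

lemma hasTemperateGrowth_ofReal : Function.HasTemperateGrowth fun x : ℝ => (x : ℂ) := by fun_prop

lemma SchwartzMap.integrable_sq_mul_norm_sq (f : 𝓢(ℝ, ℂ)) :
    Integrable fun x => x ^ 2 * ‖f x‖ ^ 2 := by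
  simpa [smulLeftCLM_apply_apply hasTemperateGrowth_ofReal, mul_pow]
    using (smulLeftCLM ℂ (fun x : ℝ => (x : ℂ)) f).integrable_norm_sq

/-- Weighted energy estimate, obtained by integrating `ξ‖f'‖²` by parts on the half-line. -/
lemma SchwartzMap.integral_Ioi_mul_norm_deriv_sq_le (f : 𝓢(ℝ, ℂ)) :
    IntegrableOn (fun ξ => ξ * ‖deriv f ξ‖ ^ 2) (Ioi 0) ∧
      ∫ ξ in Ioi (0 : ℝ), ξ * ‖deriv f ξ‖ ^ 2 ≤
        (‖f 0‖ ^ 2 + ∫ ξ, ‖deriv (deriv f) ξ‖ ^ 2 + ξ ^ 2 * ‖f ξ‖ ^ 2) / 2 := by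
  let f₁ := derivCLM ℂ ℂ f
  let f₂ := derivCLM ℂ ℂ f₁
  let h := smulLeftCLM ℂ (fun x : ℝ => (x : ℂ)) f
  have hh (x : ℝ) : h x = (x : ℂ) * f x := smulLeftCLM_apply_apply hasTemperateGrowth_ofReal f x
  have hf₁ : ⇑f₁ = deriv f := rfl
  have hf₂ : ⇑f₂ = deriv (deriv f) := rfl
  have hd₁ (x : ℝ) : HasDerivAt f (f₁ x) x := f.hasDerivAt x
  have hd₂ (x : ℝ) : HasDerivAt f₁ (f₂ x) x := f₁.hasDerivAt x
  have hdh (x : ℝ) : HasDerivAt h (f x + x * f₁ x) x := by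
    have := ((hasDerivAt_id x).ofReal_comp).fun_mul (hd₁ x)
    simp only [id, Complex.ofReal_one, one_mul] at this
    exact this.congr_of_eventuallyEq (.of_forall hh)
  have hinner (x : ℝ) : inner ℝ (f₁ x) (f x + x * f₁ x) + inner ℝ (f₂ x) (h x) -
      2 * inner ℝ (f x) (f₁ x) / 2 = x * ‖f₁ x‖ ^ 2 + inner ℝ (f₂ x) (h x) := by
    rw [← Complex.real_smul, inner_add_right, real_inner_smul_right, real_inner_self_eq_norm_sq,
      real_inner_comm (f x)]
    ring
  have hd (x : ℝ) : HasDerivAt (fun ξ => inner ℝ (f₁ ξ) (h ξ) - ‖f ξ‖ ^ 2 / 2)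
      (x * ‖f₁ x‖ ^ 2 + inner ℝ (f₂ x) (h x)) x := by
    rw [← hinner]
    exact ((hd₂ x).inner ℝ (hdh x)).fun_sub ((hd₁ x).norm_sq.div_const 2)
  have hint₁ : Integrable fun ξ => ξ * ‖f₁ ξ‖ ^ 2 := by
    refine (f₁.integrable_norm_sq.add f₁.integrable_sq_mul_norm_sq).mono'
      (by have := f₁.continuous; fun_prop) (.of_forall fun ξ => ?_)
    rw [norm_mul, norm_pow, norm_norm, Real.norm_eq_abs, Pi.add_apply, ← one_add_mul]
    have : |ξ| ≤ 1 + ξ ^ 2 := by nlinarith [sq_nonneg (|ξ| - 1), sq_abs ξ]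
    gcongr
  have hint₃ : Integrable fun ξ => ‖f₂ ξ‖ ^ 2 + ξ ^ 2 * ‖f ξ‖ ^ 2 :=
    f₂.integrable_norm_sq.add f.integrable_sq_mul_norm_sq
  have hle (ξ : ℝ) : ‖inner ℝ (f₂ ξ) (h ξ)‖ ≤ (‖f₂ ξ‖ ^ 2 + ξ ^ 2 * ‖f ξ‖ ^ 2) / 2 := by
    have h1 : ‖h ξ‖ ^ 2 = ξ ^ 2 * ‖f ξ‖ ^ 2 := by rw [hh, norm_mul, mul_pow]; simp
    have h2 := norm_inner_le_norm (𝕜 := ℝ) (f₂ ξ) (h ξ)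
    nlinarith [sq_nonneg (‖f₂ ξ‖ - ‖h ξ‖)]
  have hint₂ : Integrable fun ξ => inner ℝ (f₂ ξ) (h ξ) :=
    (hint₃.div_const 2).mono' (f₂.continuous.inner h.continuous).aestronglyMeasurable
      (.of_forall hle)
  have ht : Filter.Tendsto (fun ξ => inner ℝ (f₁ ξ) (h ξ) - ‖f ξ‖ ^ 2 / 2) Filter.atTop
      (nhds 0) := by
    have ht (p : 𝓢(ℝ, ℂ)) : Filter.Tendsto p Filter.atTop (nhds 0) :=
      (zero_at_infty p).mono_left atTop_le_cocompact
    simpa using ((ht f₁).inner (ht h)).sub (((ht f).norm.pow 2).div_const 2)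
  have key := integral_Ioi_of_hasDerivAt_of_tendsto (hd 0).continuousAt.continuousWithinAt
    (fun x _ => hd x) (hint₁.add hint₂).integrableOn ht
  rw [integral_add hint₁.integrableOn hint₂.integrableOn] at key
  refine ⟨hint₁.integrableOn, ?_⟩
  have h0 : h 0 = 0 := by simp [hh]
  have h1 : -∫ ξ in Ioi (0 : ℝ), inner ℝ (f₂ ξ) (h ξ) ≤
      (∫ ξ, ‖f₂ ξ‖ ^ 2 + ξ ^ 2 * ‖f ξ‖ ^ 2) / 2 := by
    rw [← integral_neg, ← integral_div]
    refine (setIntegral_mono hint₂.neg.integrableOn (hint₃.div_const 2).integrableOn fun ξ =>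
      (neg_le_abs _).trans (hle ξ)).trans ?_
    exact setIntegral_le_integral (hint₃.div_const 2) (.of_forall fun ξ => by positivity)
  rw [h0, inner_zero_right] at key
  simp only [hf₁, hf₂] at key h1
  linarith

end Schwartz

section Amplitude

lemma SchwartzMap.isAiryAmplitude_comp_mul (f : 𝓢(ℝ, ℂ)) {A c : ℝ} (hc : 0 < c)
    (hsup : ∀ ξ, ‖f ξ‖ ≤ A)
    (hA : (‖f 0‖ ^ 2 + ∫ ξ, ‖deriv (deriv f) ξ‖ ^ 2 + ξ ^ 2 * ‖f ξ‖ ^ 2) / 2 ≤ A ^ 2) :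
    IsAiryAmplitude A (fun ξ => f (c * ξ)) fun ξ => c * deriv f (c * ξ) where
  hasDerivAt ξ := by
    have := (f.hasDerivAt (c * ξ)).scomp ξ ((hasDerivAt_id ξ).const_mul c)
    rwa [mul_one, Complex.real_smul] at this
  continuous_deriv := by
    have : Continuous (deriv f) := (derivCLM ℂ ℂ f).continuous
    fun_prop
  norm_le ξ := hsup _
  energy_le a b ha hab := by
    obtain ⟨hi, hle⟩ := f.integral_Ioi_mul_norm_deriv_sq_le
    have h1 (ξ : ℝ) : ξ * ‖(c : ℂ) * deriv f (c * ξ)‖ ^ 2 =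
        c * ((c * ξ) * ‖deriv f (c * ξ)‖ ^ 2) := by
      rw [norm_mul, Complex.norm_real, Real.norm_of_nonneg hc.le]
      ring
    simp only [h1]
    rw [intervalIntegral.integral_const_mul,
      intervalIntegral.integral_comp_mul_left (fun η => η * ‖deriv f η‖ ^ 2) hc.ne', smul_eq_mul,
      mul_inv_cancel_left₀ hc.ne', intervalIntegral.integral_of_le (by gcongr)]
    refine (setIntegral_mono_set hi ?_ ?_).trans (hle.trans hA)
    · filter_upwards [ae_restrict_mem measurableSet_Ioi] with ξ hξ
      exact mul_nonneg (le_of_lt hξ) (sq_nonneg _)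
    · exact LE.le.eventuallyLE fun ξ hξ => (mul_nonneg hc.le ha).trans_lt hξ.1

lemma hasTemperateGrowth_fourierMultiplier :
    Function.HasTemperateGrowth fun x : ℝ => -2 * π * Complex.I * x := by fun_prop

lemma SchwartzMap.deriv_fourier (v : 𝓢(ℝ, ℂ)) :
    deriv (𝓕 v : 𝓢(ℝ, ℂ)) =
      (𝓕 (smulLeftCLM ℂ (fun x : ℝ => -2 * π * Complex.I * x) v) : 𝓢(ℝ, ℂ)) := by
  ext ξ
  have hi : Integrable fun x : ℝ => x • v x := by
    refine (smulLeftCLM ℂ (fun x : ℝ => (x : ℂ)) v).integrable.congr (.of_forall fun x => ?_)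
    simp [smulLeftCLM_apply_apply hasTemperateGrowth_ofReal]
  rw [fourier_coe, (Real.hasDerivAt_fourier v.integrable hi ξ).deriv, fourier_coe]
  refine congrArg (fun g : ℝ → ℂ => 𝓕 g ξ) (funext fun x => ?_)
  rw [smulLeftCLM_apply_apply hasTemperateGrowth_fourierMultiplier]

lemma SchwartzMap.integral_norm_deriv_deriv_fourier_sq (v : 𝓢(ℝ, ℂ)) :
    ∫ ξ, ‖deriv (deriv (𝓕 v : 𝓢(ℝ, ℂ))) ξ‖ ^ 2 = 16 * π ^ 4 * ∫ x, (x ^ 2 * ‖v x‖) ^ 2 := by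
  rw [v.deriv_fourier, deriv_fourier, integral_norm_sq_fourier, ← integral_const_mul]
  congr 1
  ext x
  simp only [smulLeftCLM_apply_apply hasTemperateGrowth_fourierMultiplier, smul_eq_mul, norm_mul,
    norm_neg, Complex.norm_I, Complex.norm_real, Complex.norm_ofNat, Real.norm_eq_abs,
    abs_of_pos Real.pi_pos]
  rw [← sq_abs x]
  ring

/-- Complexification of a real Schwartz function. -/
def SchwartzMap.toComplex (u : 𝓢(ℝ, ℝ)) : 𝓢(ℝ, ℂ) := u.postcompCLM Complex.ofRealCLM

lemma SchwartzMap.toComplex_apply (u : 𝓢(ℝ, ℝ)) (x : ℝ) : u.toComplex x = u x := rfl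

lemma SchwartzMap.coe_fourier_toComplex (u : 𝓢(ℝ, ℝ)) : ⇑(𝓕 u.toComplex : 𝓢(ℝ, ℂ)) = FT u := by
  rw [fourier_coe]
  rfl

lemma SchwartzMap.integral_abs_le (u : 𝓢(ℝ, ℝ)) {ε : ℝ} (hε : 0 < ε)
    (h0 : ∫ x, u x ^ 2 ≤ ε ^ 2) (h2 : ∫ x, (x ^ 2 * u x) ^ 2 ≤ ε ^ 2) : ∫ x, |u x| ≤ 5 * ε := by
  have i0 : Integrable fun x => u x ^ 2 := by
    simpa [toComplex_apply] using u.toComplex.integrable_norm_sq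
  have i2 : Integrable fun x => (x ^ 2 * u x) ^ 2 := by
    let h := smulLeftCLM ℂ (fun x : ℝ => (x : ℂ))
    simpa [h, smulLeftCLM_apply_apply hasTemperateGrowth_ofReal, mul_pow, toComplex_apply,
      ← mul_assoc, ← pow_mul, ← pow_add] using (h (h u.toComplex)).integrable_norm_sq
  have i1 : Integrable fun x : ℝ => ε⁻¹ / 2 * (u x ^ 2 + (x ^ 2 * u x) ^ 2) + ε * (1 + x ^ 2)⁻¹ :=
    ((i0.add i2).const_mul _).add (integrable_inv_one_add_sq.const_mul _)
  have hle (x : ℝ) :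
      |u x| ≤ ε⁻¹ / 2 * (u x ^ 2 + (x ^ 2 * u x) ^ 2) + ε * (1 + x ^ 2)⁻¹ := by
    have hq : 0 < 1 + x ^ 2 := by positivity
    have h1 : |u x| ≤ ε⁻¹ / 4 * (1 + x ^ 2) * u x ^ 2 + ε * (1 + x ^ 2)⁻¹ := by
      rw [← sub_nonneg, ← sq_abs (u x)]
      have e : ε⁻¹ / 4 * (1 + x ^ 2) * |u x| ^ 2 + ε * (1 + x ^ 2)⁻¹ - |u x| =
          ((1 + x ^ 2) * |u x| / 2 - ε) ^ 2 / (ε * (1 + x ^ 2)) := by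
        field_simp
        ring
      rw [e]
      positivity
    have h2 : ε⁻¹ / 4 * (1 + x ^ 2) * u x ^ 2 ≤ ε⁻¹ / 2 * (u x ^ 2 + (x ^ 2 * u x) ^ 2) := by
      have h3 : (1 + x ^ 2) / 2 * u x ^ 2 ≤ (1 + x ^ 4) * u x ^ 2 := by
        gcongr
        nlinarith [sq_nonneg (x ^ 2 - 1)]
      have := mul_le_mul_of_nonneg_left h3 (by positivity : 0 ≤ ε⁻¹ / 2)
      linarith
    linarith
  refine (integral_mono u.integrable.abs i1 hle).trans ?_
  rw [integral_add (f := fun x => ε⁻¹ / 2 * (u x ^ 2 + (x ^ 2 * u x) ^ 2))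
      ((i0.add i2).const_mul _) (integrable_inv_one_add_sq.const_mul _),
    integral_const_mul, integral_const_mul, integral_univ_inv_one_add_sq,
    integral_add i0 i2]
  have hpi := Real.pi_lt_four
  have : ε⁻¹ / 2 * ((∫ x, u x ^ 2) + ∫ x, (x ^ 2 * u x) ^ 2) ≤ ε⁻¹ / 2 * (ε ^ 2 + ε ^ 2) := by
    gcongr
  have e : ε⁻¹ / 2 * (ε ^ 2 + ε ^ 2) = ε := by field_simp; ring
  nlinarith

end Amplitude

section Bounds

lemma SchwartzMap.conj_fourier_toComplex_neg (u : 𝓢(ℝ, ℝ)) (ξ : ℝ) :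
    (starRingEnd ℂ) ((𝓕 u.toComplex : 𝓢(ℝ, ℂ)) (-ξ)) = (𝓕 u.toComplex : 𝓢(ℝ, ℂ)) ξ := by
  simp only [fourier_coe, Real.fourier_eq', ← integral_conj]
  congr 1
  ext x
  simp [toComplex_apply, ← Complex.exp_conj, map_ofNat]

lemma SchwartzMap.isAiryAmplitude_fourier_toComplex (u : 𝓢(ℝ, ℝ)) {ε c : ℝ} (hε : 0 < ε)
    (hc : 0 < c) (hu : H1Norm u + L2Norm (fun x => x ^ 2 * u x) ≤ ε) :
    IsAiryAmplitude (30 * ε) (fun ξ => (𝓕 u.toComplex : 𝓢(ℝ, ℂ)) (c * ξ))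
      fun ξ => c * deriv (𝓕 u.toComplex : 𝓢(ℝ, ℂ)) (c * ξ) := by
  set f := (𝓕 u.toComplex : 𝓢(ℝ, ℂ)) with hf
  have hL0 : 0 ≤ L2Norm fun x => x ^ 2 * u x := by unfold L2Norm; positivity
  have hH0 : 0 ≤ H1Norm u := by unfold H1Norm; positivity
  have hL : ∫ x, (x ^ 2 * u x) ^ 2 ≤ ε ^ 2 := by
    have h : L2Norm (fun x => x ^ 2 * u x) ≤ ε := by linarith
    rw [L2Norm, ← Real.sqrt_eq_rpow] at h
    exact (Real.sqrt_le_iff.1 h).2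
  have hH : (∫ ξ, ‖f ξ‖ ^ 2) + ∫ ξ, ξ ^ 2 * ‖f ξ‖ ^ 2 ≤ ε ^ 2 := by
    have h : H1Norm u ≤ ε := by linarith
    rw [H1Norm, ← Real.sqrt_eq_rpow, ← coe_fourier_toComplex] at h
    rw [← integral_add f.integrable_norm_sq f.integrable_sq_mul_norm_sq]
    simpa only [one_add_mul] using (Real.sqrt_le_iff.1 h).2
  have hf0 : 0 ≤ ∫ ξ, ‖f ξ‖ ^ 2 := by positivity
  have hf1 : 0 ≤ ∫ ξ, ξ ^ 2 * ‖f ξ‖ ^ 2 := by positivity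
  have hu0 : ∫ x, u x ^ 2 ≤ ε ^ 2 := by
    have h : ∫ ξ, ‖f ξ‖ ^ 2 = ∫ x, u x ^ 2 := by
      rw [hf, integral_norm_sq_fourier]
      simp [toComplex_apply]
    linarith
  have hsup (ξ : ℝ) : ‖f ξ‖ ≤ 5 * ε := by
    refine le_trans ?_ (u.integral_abs_le hε hu0 hL)
    rw [hf, fourier_coe]
    refine (VectorFourier.norm_fourierIntegral_le_integral_norm _ _ _ _ _).trans_eq ?_
    simp [toComplex_apply]
  refine f.isAiryAmplitude_comp_mul hc (fun ξ => (hsup ξ).trans (by linarith)) ?_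
  have h2 : ∫ ξ, ‖deriv (deriv f) ξ‖ ^ 2 = 16 * π ^ 4 * ∫ x, (x ^ 2 * u x) ^ 2 := by
    rw [hf, integral_norm_deriv_deriv_fourier_sq]
    simp [toComplex_apply, mul_pow]
  have hi2 : Integrable fun ξ => ‖deriv (deriv f) ξ‖ ^ 2 :=
    (derivCLM ℂ ℂ (derivCLM ℂ ℂ f)).integrable_norm_sq
  rw [integral_add hi2 f.integrable_sq_mul_norm_sq, h2]
  have h0 : ‖f 0‖ ^ 2 ≤ (5 * ε) ^ 2 := by gcongr; exact hsup 0
  have hpi : π ^ 4 ≤ 3.15 ^ 4 := by gcongr; exact Real.pi_lt_d2.le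
  have h3 : 16 * π ^ 4 * ∫ x, (x ^ 2 * u x) ^ 2 ≤ 16 * 3.15 ^ 4 * ε ^ 2 := by gcongr
  nlinarith [sq_nonneg ε]

lemma SchwartzMap.integrable_airyPhase_mul (f : 𝓢(ℝ, ℂ)) {c : ℝ} (hc : 0 < c) (X : ℝ) (k : ℕ) :
    Integrable fun ξ : ℝ => airyPhase X ξ * ((ξ : ℂ) ^ k * f (c * ξ)) := by
  refine (((f.integrable_pow_mul volume k).comp_mul_left' hc.ne').const_mul (c⁻¹ ^ k)).mono'
    (by have := f.continuous; have := continuous_airyPhase X; fun_prop) (.of_forall fun ξ => ?_)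
  rw [norm_mul, norm_airyPhase, norm_mul, norm_mul, norm_pow, mul_pow, Real.norm_of_nonneg hc.le,
    Complex.norm_real]
  refine le_of_eq ?_
  rw [inv_pow]
  field_simp

lemma conj_airyPhase (X ξ : ℝ) : (starRingEnd ℂ) (airyPhase X ξ) = airyPhase X (-ξ) := by
  rw [airyPhase, airyPhase, ← Complex.exp_conj]
  congr 1
  simp
  ring

/-- Reality of the data reduces the oscillatory integral to the positive half-line. -/
lemma SchwartzMap.norm_integral_airyPhase_mul_le_two_mul (u : 𝓢(ℝ, ℝ)) {c : ℝ} (hc : 0 < c)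
    (X : ℝ) (k : ℕ) :
    ‖∫ ξ : ℝ, airyPhase X ξ * ((ξ : ℂ) ^ k * (𝓕 u.toComplex : 𝓢(ℝ, ℂ)) (c * ξ))‖ ≤
      2 * ‖∫ ξ in Ioi (0 : ℝ),
        airyPhase X ξ * ((ξ : ℂ) ^ k * (𝓕 u.toComplex : 𝓢(ℝ, ℂ)) (c * ξ))‖ := by
  have hi := (𝓕 u.toComplex : 𝓢(ℝ, ℂ)).integrable_airyPhase_mul hc X k
  set f := (𝓕 u.toComplex : 𝓢(ℝ, ℂ)) with hf
  have h : ∫ ξ in Iic (0 : ℝ), airyPhase X ξ * ((ξ : ℂ) ^ k * f (c * ξ)) =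
      (-1) ^ k * (starRingEnd ℂ)
        (∫ ξ in Ioi (0 : ℝ), airyPhase X ξ * ((ξ : ℂ) ^ k * f (c * ξ))) := by
    rw [← neg_zero, ← integral_comp_neg_Ioi, neg_zero, ← integral_conj, ← integral_const_mul]
    congr 1
    ext ξ
    have hconj : f (c * -ξ) = (starRingEnd ℂ) (f (c * ξ)) := by
      rw [mul_neg, hf, ← u.conj_fourier_toComplex_neg, neg_neg]
    rw [hconj, RingHom.map_mul, RingHom.map_mul, conj_airyPhase, map_pow, Complex.conj_ofReal,
      Complex.ofReal_neg, neg_pow]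
    ring
  rw [← intervalIntegral.integral_Iic_add_Ioi hi.integrableOn hi.integrableOn, h]
  refine (norm_add_le _ _).trans_eq ?_
  rw [norm_mul, norm_pow, norm_neg, norm_one, one_pow, RCLike.norm_conj]
  ring

end Bounds

section Evolution

lemma SchwartzMap.norm_fourierInv_exp_mul (f : 𝓢(ℝ, ℂ)) {c t : ℝ} (hc : 0 < c)
    (htc : t * c ^ 3 = 1) (x : ℝ) (k : ℕ) :
    ‖𝓕⁻ (fun ξ : ℝ => Complex.exp (Complex.I * (t : ℂ) * (ξ : ℂ) ^ 3) * ((ξ : ℂ) ^ k * f ξ)) x‖ =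
      c ^ (k + 1) * ‖∫ ξ : ℝ, airyPhase (2 * π * (x * c)) ξ * ((ξ : ℂ) ^ k * f (c * ξ))‖ := by
  have h (ξ : ℝ) : Complex.exp (((2 * π * inner ℝ (c * ξ) x : ℝ) : ℂ) * Complex.I) •
      (Complex.exp (Complex.I * (t : ℂ) * ((c * ξ : ℝ) : ℂ) ^ 3) *
        (((c * ξ : ℝ) : ℂ) ^ k * f (c * ξ))) =
      (c : ℂ) ^ k * (airyPhase (2 * π * (x * c)) ξ * ((ξ : ℂ) ^ k * f (c * ξ))) := by
    have htc' : (t : ℂ) * (c : ℂ) ^ 3 = 1 := by exact_mod_cast htc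
    have e : ((2 * π * inner ℝ (c * ξ) x : ℝ) : ℂ) * Complex.I +
        Complex.I * (t : ℂ) * ((c * ξ : ℝ) : ℂ) ^ 3 =
        ((2 * π * (x * c) * ξ + ξ ^ 3 : ℝ) : ℂ) * Complex.I := by
      simp only [RCLike.inner_apply, conj_trivial]
      push_cast
      linear_combination (ξ : ℂ) ^ 3 * Complex.I * htc'
    rw [smul_eq_mul, ← mul_assoc, ← Complex.exp_add, e, airyPhase]
    push_cast
    ring
  rw [Real.fourierInv_eq']
  have key := Measure.integral_comp_mul_left (fun ξ : ℝ =>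
    Complex.exp (((2 * π * inner ℝ ξ x : ℝ) : ℂ) * Complex.I) •
      (Complex.exp (Complex.I * (t : ℂ) * (ξ : ℂ) ^ 3) * ((ξ : ℂ) ^ k * f ξ))) c
  simp only [h] at key
  rw [integral_const_mul] at key
  have key' := congrArg norm key
  rw [norm_mul, norm_pow, norm_smul, Complex.norm_real, Real.norm_of_nonneg hc.le, norm_abs_eq_norm,
    norm_inv, Real.norm_of_nonneg hc.le, eq_inv_mul_iff_mul_eq₀ hc.ne'] at key'
  rw [← key']
  ring

lemma norm_airy_eq (u : 𝓢(ℝ, ℝ)) {c t : ℝ} (hc : 0 < c) (htc : t * c ^ 3 = 1) (x : ℝ) :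
    ‖airy u t x‖ = c * ‖∫ ξ : ℝ, airyPhase (2 * π * (x * c)) ξ *
      ((ξ : ℂ) ^ 0 * (𝓕 u.toComplex : 𝓢(ℝ, ℂ)) (c * ξ))‖ := by
  have h := (𝓕 u.toComplex : 𝓢(ℝ, ℂ)).norm_fourierInv_exp_mul hc htc x 0
  rw [zero_add, pow_one] at h
  rw [← h, airy, ← u.coe_fourier_toComplex]
  simp only [pow_zero, one_mul]

lemma norm_deriv_airy_eq (u : 𝓢(ℝ, ℝ)) {c t : ℝ} (hc : 0 < c) (htc : t * c ^ 3 = 1) (x : ℝ) :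
    ‖deriv (airy u t) x‖ = 2 * π * (c ^ 2 * ‖∫ ξ : ℝ, airyPhase (2 * π * (x * c)) ξ *
      ((ξ : ℂ) ^ 1 * (𝓕 u.toComplex : 𝓢(ℝ, ℂ)) (c * ξ))‖) := by
  set f := (𝓕 u.toComplex : 𝓢(ℝ, ℂ)) with hf
  let E : ℝ → ℂ := fun ξ => Complex.exp (Complex.I * (t : ℂ) * (ξ : ℂ) ^ 3)
  have hE : Continuous E := by fun_prop
  have hE1 (ξ : ℝ) : ‖E ξ‖ = 1 := by
    have : Complex.I * (t : ℂ) * (ξ : ℂ) ^ 3 = ((t * ξ ^ 3 : ℝ) : ℂ) * Complex.I := by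
      push_cast
      ring
    simp only [E, this, Complex.norm_exp_ofReal_mul_I]
  have hi0 : Integrable fun ξ => E ξ * f ξ :=
    f.integrable.bdd_mul hE.aestronglyMeasurable (.of_forall fun ξ => (hE1 ξ).le)
  have hi1 : Integrable fun ξ : ℝ => E ξ * (ξ * f ξ) := by
    have h : Integrable (smulLeftCLM ℂ (fun x : ℝ => (x : ℂ)) f) := SchwartzMap.integrable _
    refine Integrable.bdd_mul (c := 1) (h.congr (.of_forall fun ξ => ?_)) hE.aestronglyMeasurable
      (.of_forall fun ξ => (hE1 ξ).le)
    rw [smulLeftCLM_apply_apply hasTemperateGrowth_ofReal, smul_eq_mul]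
  have hi1' : Integrable fun ξ : ℝ => ξ • (E ξ * f ξ) := by
    refine hi1.congr (.of_forall fun ξ => ?_)
    simp only [Complex.real_smul]
    ring
  have hairy : airy u t = fun x => 𝓕 (fun ξ => E ξ * f ξ) (-x) := by
    ext x
    rw [airy, ← u.coe_fourier_toComplex, Real.fourierInv_eq_fourier_neg]
  have hd := (Real.hasDerivAt_fourier hi0 hi1' (-x)).scomp x (hasDerivAt_neg x)
  have h := f.norm_fourierInv_exp_mul hc htc x 1
  have hm : (fun ξ : ℝ => (-2 * π * Complex.I * ξ) • (E ξ * f ξ)) =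
      (-2 * π * Complex.I) • fun ξ : ℝ => E ξ * ((ξ : ℂ) ^ 1 * f ξ) := by
    ext ξ
    simp only [smul_eq_mul, Pi.smul_apply]
    ring
  have hd' : deriv (airy u t) x = (-1 : ℝ) •
      𝓕 (fun ξ : ℝ => (-2 * π * Complex.I * ξ) • (E ξ * f ξ)) (-x) := by
    rw [hairy]
    exact hd.deriv
  rw [← h, hd', hm, Real.fourierInv_eq_fourier_neg, Real.fourier_eq', Real.fourier_eq',
    norm_smul, norm_neg, norm_one, one_mul]
  simp only [Pi.smul_apply, smul_comm _ (-2 * π * Complex.I : ℂ)]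
  rw [integral_smul, norm_smul]
  simp [E, abs_of_pos Real.pi_pos]

end Evolution

/-- Self-similar variables: `c = t^{-1/3}` and `z = t^{-1/3}⟨x⟩`. -/
lemma exists_selfSimilar_variables {t : ℝ} (ht : 0 < t) (x : ℝ) :
    ∃ c z : ℝ, 0 < c ∧ 0 < z ∧ t = c ^ (-3 : ℝ) ∧ t * c ^ 3 = 1 ∧ c = t ^ (-(1 : ℝ) / 3) ∧
      jb t x = z * c ^ (-1 : ℝ) ∧ z ^ 2 = 1 + (x * c) ^ 2 := by
  have hj : 0 < x ^ 2 + t ^ ((2 : ℝ) / 3) := by positivity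
  have hc : 0 < t ^ (-(1 : ℝ) / 3) := by positivity
  have hjb : jb t x ^ 2 = x ^ 2 + t ^ ((2 : ℝ) / 3) := by
    rw [jb, ← Real.sqrt_eq_rpow, Real.sq_sqrt hj.le]
  have htc : t ^ ((2 : ℝ) / 3) * (t ^ (-(1 : ℝ) / 3)) ^ 2 = 1 := by
    rw [← Real.rpow_natCast, ← Real.rpow_mul ht.le, ← Real.rpow_add ht]
    norm_num
  refine ⟨t ^ (-(1 : ℝ) / 3), jb t x * t ^ (-(1 : ℝ) / 3), hc, mul_pos ?_ hc, ?_, ?_, rfl, ?_, ?_⟩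
  · exact Real.rpow_pos_of_pos hj _
  · rw [← Real.rpow_mul ht.le]
    norm_num
  · nth_rewrite 1 [← Real.rpow_one t]
    rw [← Real.rpow_natCast, ← Real.rpow_mul ht.le, ← Real.rpow_add ht]
    norm_num
  · rw [Real.rpow_neg_one, mul_inv_cancel_right₀ hc.ne']
  · rw [mul_pow, hjb, mul_pow]
    linear_combination htc

/-- Dispersive decay for the Airy (linear KdV) evolution with weighted `H¹` data. -/
theorem airy_dispersive_decay :
    ∃ C : ℝ, 0 < C ∧ ∀ (ε : ℝ), 0 < ε → ∀ u₀ : 𝓢(ℝ, ℝ),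
      H1Norm ⇑u₀ + L2Norm (fun x => x^2 * u₀ x) ≤ ε →
      ∀ t : ℝ, 0 < t →
        (∀ x : ℝ,
          t ^ ((1:ℝ)/4) * jb t x ^ ((1:ℝ)/4) * ‖airy (⇑u₀) t x‖
            + t ^ ((3:ℝ)/4) * jb t x ^ (-(1:ℝ)/4) * ‖deriv (airy (⇑u₀) t) x‖ ≤ C * ε) ∧
        (∀ x : ℝ, 2 * t ^ ((1:ℝ)/3) ≤ x →
          jb t x * ‖airy (⇑u₀) t x‖
            + t ^ ((1:ℝ)/2) * jb t x ^ ((1:ℝ)/2) * ‖deriv (airy (⇑u₀) t) x‖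
            ≤ C * ε * Real.log (t ^ (-(1:ℝ)/3) * jb t x)) := by
  refine ⟨30000, by norm_num, fun ε hε u hu t ht => ?_⟩
  have hpi := Real.pi_lt_d2
  have hA : 0 < 30 * ε := by positivity
  refine ⟨fun x => ?_, fun x hx => ?_⟩ <;>
  obtain ⟨c, z, hc, hz0, htc, htc1, hct, hj, hz⟩ := exists_selfSimilar_variables ht x <;>
  have hg := u.isAiryAmplitude_fourier_toComplex hε hc hu <;>
  have hi (k : ℕ) := (𝓕 u.toComplex : 𝓢(ℝ, ℂ)).integrable_airyPhase_mul hc (2 * π * (x * c)) k <;>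
  have hle (k : ℕ) := u.norm_integral_airyPhase_mul_le_two_mul hc (2 * π * (x * c)) k <;>
  rw [norm_airy_eq u hc htc1, norm_deriv_airy_eq u hc htc1, hj]
  · obtain ⟨h0, h1⟩ := hg.halfLine_dispersive hA hz0 hz (hi 0).integrableOn (hi 1).integrableOn
    have hle0 := hle 0
    have hle1 := hle 1
    set I₀ := ∫ ξ : ℝ, airyPhase (2 * π * (x * c)) ξ *
      ((ξ : ℂ) ^ 0 * (𝓕 u.toComplex : 𝓢(ℝ, ℂ)) (c * ξ))
    set I₁ := ∫ ξ : ℝ, airyPhase (2 * π * (x * c)) ξ *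
      ((ξ : ℂ) ^ 1 * (𝓕 u.toComplex : 𝓢(ℝ, ℂ)) (c * ξ))
    have e0 : t ^ ((1 : ℝ) / 4) * (z * c ^ (-1 : ℝ)) ^ ((1 : ℝ) / 4) * (c * ‖I₀‖) =
        z ^ ((1 : ℝ) / 4) * ‖I₀‖ := by
      have : c ^ (-3 * ((1 : ℝ) / 4)) * c ^ (-1 * ((1 : ℝ) / 4)) * c = 1 := by
        rw [← Real.rpow_add hc, ← Real.rpow_add_one hc.ne']
        norm_num
      rw [htc, Real.mul_rpow hz0.le (by positivity), ← Real.rpow_mul hc.le, ← Real.rpow_mul hc.le]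
      linear_combination z ^ ((1 : ℝ) / 4) * ‖I₀‖ * this
    have e1 : t ^ ((3 : ℝ) / 4) * (z * c ^ (-1 : ℝ)) ^ (-(1 : ℝ) / 4) *
        (2 * π * (c ^ 2 * ‖I₁‖)) = 2 * π * (z ^ (-(1 : ℝ) / 4) * ‖I₁‖) := by
      have : c ^ (-3 * ((3 : ℝ) / 4)) * c ^ (-1 * (-(1 : ℝ) / 4)) * c ^ 2 = 1 := by
        rw [← Real.rpow_add hc, ← Real.rpow_add_natCast hc.ne']
        norm_num
      rw [htc, Real.mul_rpow hz0.le (by positivity), ← Real.rpow_mul hc.le, ← Real.rpow_mul hc.le]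
      linear_combination 2 * π * z ^ (-(1 : ℝ) / 4) * ‖I₁‖ * this
    rw [e0, e1]
    have b0 := mul_le_mul_of_nonneg_left hle0 (Real.rpow_nonneg hz0.le ((1 : ℝ) / 4))
    have b1 := mul_le_mul_of_nonneg_left hle1 (Real.rpow_nonneg hz0.le (-(1 : ℝ) / 4))
    have b1' : z ^ (-(1 : ℝ) / 4) * ‖I₁‖ ≤ 3840 * ε := by linarith
    calc _ ≤ 3840 * ε + 2 * 3.15 * (3840 * ε) :=
          add_le_add (by linarith) (mul_le_mul (by linarith) b1' (by positivity) (by positivity))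
      _ ≤ _ := by linarith
  · have hs : 2 ≤ x * c := by
      have h1 : t ^ ((1 : ℝ) / 3) * c = 1 := by
        rw [hct, ← Real.rpow_add ht]
        norm_num
      have := mul_le_mul_of_nonneg_right hx hc.le
      linarith
    obtain ⟨h0, h1, hlog⟩ :=
      hg.halfLine_elliptic hA hz0 hz hs (hi 0).integrableOn (hi 1).integrableOn
    have hle0 := hle 0
    have hle1 := hle 1
    set I₀ := ∫ ξ : ℝ, airyPhase (2 * π * (x * c)) ξ *
      ((ξ : ℂ) ^ 0 * (𝓕 u.toComplex : 𝓢(ℝ, ℂ)) (c * ξ))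
    set I₁ := ∫ ξ : ℝ, airyPhase (2 * π * (x * c)) ξ *
      ((ξ : ℂ) ^ 1 * (𝓕 u.toComplex : 𝓢(ℝ, ℂ)) (c * ξ))
    have e0 : z * c ^ (-1 : ℝ) * (c * ‖I₀‖) = z * ‖I₀‖ := by
      rw [Real.rpow_neg_one]
      field_simp
    have e1 : t ^ ((1 : ℝ) / 2) * (z * c ^ (-1 : ℝ)) ^ ((1 : ℝ) / 2) *
        (2 * π * (c ^ 2 * ‖I₁‖)) = 2 * π * (z ^ ((1 : ℝ) / 2) * ‖I₁‖) := by
      have : c ^ (-3 * ((1 : ℝ) / 2)) * c ^ (-1 * ((1 : ℝ) / 2)) * c ^ 2 = 1 := by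
        rw [← Real.rpow_add hc, ← Real.rpow_add_natCast hc.ne']
        norm_num
      rw [htc, Real.mul_rpow hz0.le (by positivity), ← Real.rpow_mul hc.le, ← Real.rpow_mul hc.le]
      linear_combination 2 * π * z ^ ((1 : ℝ) / 2) * ‖I₁‖ * this
    have ez : t ^ (-(1 : ℝ) / 3) * (z * c ^ (-1 : ℝ)) = z := by
      rw [← hct, Real.rpow_neg_one]
      field_simp
    rw [e0, e1, ez]
    have b0 := mul_le_mul_of_nonneg_left hle0 hz0.le
    have b1 := mul_le_mul_of_nonneg_left hle1 (Real.rpow_nonneg hz0.le ((1 : ℝ) / 2))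
    have hε1 : ε ≤ 2 * (ε * Real.log z) := by nlinarith
    have b1' : z ^ ((1 : ℝ) / 2) * ‖I₁‖ ≤ 2520 * (ε * Real.log z) := by linarith
    have hL : 0 < ε * Real.log z := by linarith
    calc _ ≤ 1440 * (ε * Real.log z) + 2 * 3.15 * (2520 * (ε * Real.log z)) :=
          add_le_add (by linarith) (mul_le_mul (by linarith) b1' (by positivity) (by positivity))
      _ ≤ _ := by linarith
end
end

section
/- There is a universal constant C > 0 with the following property. Let u₀ : ℝ → ℝ be a Schwartz function with ‖u₀‖_{Ḃ^{-1/2}_{2,∞}} + ‖x·u₀‖_{Ḣ^{1/2}} ≤ 1, and let u(t) be the Airy evolution of u₀. Then for all t > 0 and all x ∈ ℝ one has t^{1/4}⟨x⟩^{1/4}|u(t,x)| + t^{3/4}⟨x⟩^{-1/4}|∂ₓu(t,x)| ≤ C, and moreover for all x ≥ 2t^{1/3} one has ⟨x⟩|u(t,x)| + t^{1/2}⟨x⟩^{1/2}|∂ₓu(t,x)| ≤ C·ln(t^{-1/3}⟨x⟩). -/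
open MeasureTheory Real SchwartzMap Set
open scoped FourierTransform

noncomputable section

/-- A first-order oscillatory integral estimate: integration by parts against the phase `θ`, with
amplitude `h * q` where `q = θ'` and `h` is monotone or antitone. -/
theorem norm_integral_osc_le {θ q h h' : ℝ → ℝ} {G G' : ℝ → ℂ} {a b K lam Q : ℝ}
    (ha : 0 < a) (hab : a ≤ b) (hlam : 0 < lam)
    (hθ : ∀ ξ ∈ Icc a b, HasDerivAt θ (q ξ) ξ) (hq : ContinuousOn q (Icc a b))
    (hh : ∀ ξ ∈ Icc a b, HasDerivAt h (h' ξ) ξ) (hh' : ContinuousOn h' (Icc a b))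
    (hmono : (∀ ξ ∈ Icc a b, 0 ≤ h' ξ) ∨ (∀ ξ ∈ Icc a b, h' ξ ≤ 0))
    (hG : ∀ ξ ∈ Icc a b, HasDerivAt G (G' ξ) ξ) (hG' : ContinuousOn G' (Icc a b))
    (hK : ∀ ξ ∈ Icc a b, ‖G ξ‖ ≤ K)
    (hE : ∫ ξ in a..b, ξ * ‖G' ξ‖ ^ 2 ≤ K) (hQ : ∫ ξ in a..b, h ξ ^ 2 / ξ ≤ Q) :
    ‖∫ ξ in a..b, Complex.exp (Complex.I * θ ξ) * ((h ξ * q ξ : ℝ) : ℂ) * G ξ‖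
      ≤ 2 * K * (|h a| + |h b|) + (lam * K + Q / lam) / 2 := by
  have hu : uIcc a b = Icc a b := uIcc_of_le hab
  have hhc : ContinuousOn h (Icc a b) := fun ξ hξ => (hh ξ hξ).continuousAt.continuousWithinAt
  have hGc : ContinuousOn G (Icc a b) := fun ξ hξ => (hG ξ hξ).continuousAt.continuousWithinAt
  have hθc : ContinuousOn θ (Icc a b) := fun ξ hξ => (hθ ξ hξ).continuousAt.continuousWithinAt
  set E : ℝ → ℂ := fun ξ => Complex.exp (Complex.I * θ ξ) with hEdef
  have hEn : ∀ ξ, ‖E ξ‖ = 1 := fun ξ => by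
    simp only [hEdef]; rw [mul_comm]; exact Complex.norm_exp_ofReal_mul_I _
  have hEc : ContinuousOn E (Icc a b) := by fun_prop
  have hEd : ∀ ξ ∈ Icc a b, HasDerivAt E (E ξ * (Complex.I * q ξ)) ξ := fun ξ hξ =>
    (((hθ ξ hξ).ofReal_comp).const_mul Complex.I).cexp
  have hK0 : 0 ≤ K := (norm_nonneg _).trans (hK a ⟨le_rfl, hab⟩)
  -- the total variation of `h`
  have hvar : ∫ ξ in a..b, |h' ξ| ≤ |h a| + |h b| := by
    have hval : ∫ ξ in a..b, h' ξ = h b - h a :=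
      intervalIntegral.integral_eq_sub_of_hasDerivAt (fun ξ hξ => hh ξ (hu ▸ hξ))
        (ContinuousOn.intervalIntegrable (hu ▸ hh'))
    rcases hmono with hm | hm
    · rw [intervalIntegral.integral_congr (g := h') fun ξ hξ => abs_of_nonneg (hm ξ (hu ▸ hξ)),
        hval]
      linarith [le_abs_self (h b), neg_abs_le (h a)]
    · rw [intervalIntegral.integral_congr (g := fun ξ => - h' ξ)
        fun ξ hξ => abs_of_nonpos (hm ξ (hu ▸ hξ)), intervalIntegral.integral_neg, hval]
      linarith [le_abs_self (h a), neg_abs_le (h b)]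
  have hV : ∀ ξ ∈ Icc a b, HasDerivAt (fun ξ => (h ξ : ℂ) * G ξ)
      ((h' ξ : ℂ) * G ξ + h ξ * G' ξ) ξ := fun ξ hξ => ((hh ξ hξ).ofReal_comp).mul (hG ξ hξ)
  have hFTC : ∫ ξ in a..b, (E ξ * (Complex.I * q ξ) * (h ξ * G ξ)
      + E ξ * ((h' ξ : ℂ) * G ξ + h ξ * G' ξ)) = E b * (h b * G b) - E a * (h a * G a) :=
    intervalIntegral.integral_eq_sub_of_hasDerivAt (fun ξ hξ => (hEd ξ (hu ▸ hξ)).mul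
      (hV ξ (hu ▸ hξ))) (ContinuousOn.intervalIntegrable (by rw [hu]; fun_prop))
  rw [intervalIntegral.integral_add
    (ContinuousOn.intervalIntegrable (by rw [hu]; fun_prop))
    (ContinuousOn.intervalIntegrable (by rw [hu]; fun_prop))] at hFTC
  have hmain : Complex.I * ∫ ξ in a..b, E ξ * ((h ξ * q ξ : ℝ) : ℂ) * G ξ
      = E b * (h b * G b) - E a * (h a * G a)
        - ∫ ξ in a..b, E ξ * ((h' ξ : ℂ) * G ξ + h ξ * G' ξ) := by
    rw [← hFTC, add_sub_cancel_right, ← intervalIntegral.integral_const_mul]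
    congr 1; ext ξ; push_cast; ring
  have hne : ∀ ξ ∈ Icc a b, ξ ≠ 0 := fun ξ hξ => (ha.trans_le hξ.1).ne'
  have hrest : ‖∫ ξ in a..b, E ξ * ((h' ξ : ℂ) * G ξ + h ξ * G' ξ)‖
      ≤ K * (|h a| + |h b|) + (lam * K + Q / lam) / 2 := by
    have h1 : ‖∫ ξ in a..b, E ξ * ((h' ξ : ℂ) * G ξ + h ξ * G' ξ)‖ ≤
        ∫ ξ in a..b, (K * |h' ξ| + ((lam / 2) * (ξ * ‖G' ξ‖ ^ 2)
          + (1 / (2 * lam)) * (h ξ ^ 2 / ξ))) := by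
      apply intervalIntegral.norm_integral_le_of_norm_le hab
      · refine Filter.Eventually.of_forall fun ξ hξ => ?_
        have hξ' : ξ ∈ Icc a b := Ioc_subset_Icc_self hξ
        have hξ0 : 0 < ξ := ha.trans hξ.1
        rw [norm_mul, hEn, one_mul]
        refine (norm_add_le _ _).trans (add_le_add ?_ ?_)
        · rw [norm_mul, Complex.norm_real, mul_comm, norm_eq_abs]
          exact mul_le_mul_of_nonneg_right (hK ξ hξ') (abs_nonneg _)
        · rw [norm_mul, Complex.norm_real, norm_eq_abs, ← sq_abs (h ξ)]
          have : (lam / 2) * (ξ * ‖G' ξ‖ ^ 2) + (1 / (2 * lam)) * (|h ξ| ^ 2 / ξ)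
              - |h ξ| * ‖G' ξ‖ = (lam * ξ * ‖G' ξ‖ - |h ξ|) ^ 2 / (2 * lam * ξ) := by
            field_simp; ring
          have h3 : 0 ≤ (lam * ξ * ‖G' ξ‖ - |h ξ|) ^ 2 / (2 * lam * ξ) := by positivity
          linarith
      · exact ContinuousOn.intervalIntegrable (by rw [hu]; fun_prop (disch := assumption))
    refine h1.trans ?_
    rw [intervalIntegral.integral_add, intervalIntegral.integral_add,
      intervalIntegral.integral_const_mul, intervalIntegral.integral_const_mul,
      intervalIntegral.integral_const_mul]
    · have e1 := mul_le_mul_of_nonneg_left hvar hK0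
      have e2 := mul_le_mul_of_nonneg_left hE (by positivity : 0 ≤ lam / 2)
      have e3 := mul_le_mul_of_nonneg_left hQ (by positivity : 0 ≤ 1 / (2 * lam))
      have e4 : (lam * K + Q / lam) / 2 = lam / 2 * K + 1 / (2 * lam) * Q := by field_simp
      rw [e4]; linarith
    all_goals exact ContinuousOn.intervalIntegrable (by rw [hu]; fun_prop (disch := assumption))
  have hb : ∀ ξ ∈ Icc a b, ‖E ξ * (h ξ * G ξ)‖ ≤ K * |h ξ| := fun ξ hξ => by
    rw [norm_mul, hEn, one_mul, norm_mul, Complex.norm_real, mul_comm, norm_eq_abs]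
    exact mul_le_mul_of_nonneg_right (hK ξ hξ) (abs_nonneg _)
  calc _ = ‖Complex.I * ∫ ξ in a..b, E ξ * ((h ξ * q ξ : ℝ) : ℂ) * G ξ‖ := by
        rw [norm_mul, Complex.norm_I, one_mul]
    _ ≤ K * |h b| + K * |h a| + (K * (|h a| + |h b|) + (lam * K + Q / lam) / 2) := by
        rw [hmain]
        exact (norm_sub_le _ _).trans (add_le_add ((norm_sub_le _ _).trans
          (add_le_add (hb b ⟨hab, le_rfl⟩) (hb a ⟨le_rfl, hab⟩))) hrest)
    _ = _ := by ring

/-- A `C¹` function on the half-line `(0, ∞)` that is bounded by `K` and whose derivative has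
scale-invariant weighted energy at most `K`. -/
structure HalfLineBound (K : ℝ) (G G' : ℝ → ℂ) : Prop where
  hasDerivAt : ∀ ξ, HasDerivAt G (G' ξ) ξ
  continuous_deriv : Continuous G'
  norm_le : ∀ ξ, 0 < ξ → ‖G ξ‖ ≤ K
  energy_le : ∀ a b, 0 < a → a ≤ b → ∫ ξ in a..b, ξ * ‖G' ξ‖ ^ 2 ≤ K

/-- The Airy integrand with phase `ξ³ + 3 * e * ξ` and amplitude `ξᵏ G(ξ)`. -/
def airyIntegrand (e : ℝ) (k : ℕ) (G : ℝ → ℂ) (ξ : ℝ) : ℂ :=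
  Complex.exp (Complex.I * ((ξ ^ 3 + 3 * e * ξ : ℝ) : ℂ)) * ((ξ ^ k : ℝ) : ℂ) * G ξ

namespace HalfLineBound

variable {K e : ℝ} {G G' : ℝ → ℂ}

theorem nonneg (hG : HalfLineBound K G G') : 0 ≤ K :=
  (norm_nonneg _).trans (hG.norm_le 1 one_pos)

theorem continuous (hG : HalfLineBound K G G') : Continuous G :=
  continuous_iff_continuousAt.2 fun ξ => (hG.hasDerivAt ξ).continuousAt

theorem continuous_airyIntegrand (hG : HalfLineBound K G G') (e : ℝ) (k : ℕ) :
    Continuous (airyIntegrand e k G) := by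
  have := hG.continuous
  unfold airyIntegrand
  fun_prop

theorem intervalIntegrable (hG : HalfLineBound K G G') (e : ℝ) (k : ℕ) (a b : ℝ) :
    IntervalIntegrable (airyIntegrand e k G) volume a b :=
  (hG.continuous_airyIntegrand e k).intervalIntegrable a b

theorem norm_integral_trivial_le (hG : HalfLineBound K G G') (e : ℝ) (k : ℕ) {a b : ℝ}
    (ha : 0 ≤ a) (hab : a ≤ b) :
    ‖∫ ξ in a..b, airyIntegrand e k G ξ‖ ≤ K * b ^ k * (b - a) := by
  have := intervalIntegral.norm_integral_le_of_norm_le_const (a := a) (b := b)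
    (f := airyIntegrand e k G) (C := K * b ^ k) ?_
  · rwa [abs_of_nonneg (sub_nonneg.2 hab)] at this
  · intro ξ hξ
    rw [uIoc_of_le hab] at hξ
    have hξ0 : 0 < ξ := ha.trans_lt hξ.1
    rw [airyIntegrand, norm_mul, norm_mul, mul_comm Complex.I, Complex.norm_exp_ofReal_mul_I,
      one_mul, Complex.norm_real, norm_of_nonneg (by positivity), mul_comm]
    exact mul_le_mul (hG.norm_le ξ hξ0) (pow_le_pow_left₀ hξ0.le hξ.2 k) (by positivity) hG.nonneg

theorem hasDerivAt_airyPhase (e ξ : ℝ) :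
    HasDerivAt (fun ξ : ℝ => ξ ^ 3 + 3 * e * ξ) (3 * (ξ ^ 2 + e)) ξ := by
  have := (hasDerivAt_pow 3 ξ).add ((hasDerivAt_id ξ).const_mul (3 * e))
  convert! this using 1
  norm_num; ring

theorem norm_integral_zero_le (hG : HalfLineBound K G G') {a b lam Q : ℝ} (ha : 0 < a)
    (hab : a ≤ b) (hlam : 0 < lam) (hne : ∀ ξ ∈ Icc a b, ξ ^ 2 + e ≠ 0)
    (hQ : ∫ ξ in a..b, (1 / (3 * (ξ ^ 2 + e))) ^ 2 / ξ ≤ Q) :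
    ‖∫ ξ in a..b, airyIntegrand e 0 G ξ‖ ≤
      2 * K * (|1 / (3 * (a ^ 2 + e))| + |1 / (3 * (b ^ 2 + e))|) + (lam * K + Q / lam) / 2 := by
  have key := norm_integral_osc_le (θ := fun ξ => ξ ^ 3 + 3 * e * ξ)
    (q := fun ξ => 3 * (ξ ^ 2 + e)) (h := fun ξ => 1 / (3 * (ξ ^ 2 + e)))
    (h' := fun ξ => -(2 * ξ) / (3 * (ξ ^ 2 + e) ^ 2)) (G := G) (G' := G') (K := K) ha hab hlam
    (fun ξ _ => hasDerivAt_airyPhase e ξ) (by fun_prop) (fun ξ hξ => ?_) ?_ (Or.inr fun ξ hξ => ?_)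
    (fun ξ _ => hG.hasDerivAt ξ) hG.continuous_deriv.continuousOn
    (fun ξ hξ => hG.norm_le ξ (ha.trans_le hξ.1)) (hG.energy_le a b ha hab) hQ
  · refine le_of_eq_of_le ?_ key
    congr 1
    refine intervalIntegral.integral_congr fun ξ hξ => ?_
    rw [uIcc_of_le hab] at hξ
    have := hne ξ hξ
    have h2 : 1 / (3 * (ξ ^ 2 + e)) * (3 * (ξ ^ 2 + e)) = 1 := by field_simp
    simp only [airyIntegrand, h2, pow_zero]
  · have hn := hne ξ hξ
    have h1 : HasDerivAt (fun ξ : ℝ => 3 * (ξ ^ 2 + e)) (3 * (2 * ξ)) ξ := by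
      have := (((hasDerivAt_pow 2 ξ).add_const e).const_mul 3)
      convert! this using 1; norm_num
    have := h1.inv (by simpa using hn)
    simp only [one_div]
    convert! this using 1
    field_simp
  · have h2 : ∀ ξ ∈ Icc a b, 3 * (ξ ^ 2 + e) ^ 2 ≠ 0 := fun ξ hξ => by
      have := hne ξ hξ; positivity
    fun_prop (disch := assumption)
  · have : 0 < ξ := ha.trans_le hξ.1
    rw [neg_div]
    exact neg_nonpos.2 (by positivity)

theorem integral_div_sq_le {a b : ℝ} (hab : a ≤ b) (hne : ∀ ξ ∈ Icc a b, ξ ^ 2 + e ≠ 0) :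
    ∫ ξ in a..b, ξ / (9 * (ξ ^ 2 + e) ^ 2) = (1 / (a ^ 2 + e) - 1 / (b ^ 2 + e)) / 18 := by
  have h2 : ∀ ξ ∈ Icc a b, 9 * (ξ ^ 2 + e) ^ 2 ≠ 0 := fun ξ hξ => by
    have := hne ξ hξ; positivity
  rw [intervalIntegral.integral_eq_sub_of_hasDerivAt (f := fun ξ => -(1 / (ξ ^ 2 + e)) / 18)]
  · ring
  · intro ξ hξ
    rw [uIcc_of_le hab] at hξ
    have hn := hne ξ hξ
    have h1 : HasDerivAt (fun ξ : ℝ => ξ ^ 2 + e) (2 * ξ) ξ := by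
      have := ((hasDerivAt_pow 2 ξ).add_const e)
      convert! this using 1; norm_num
    have := ((h1.inv hn).neg).div_const 18
    simp only [one_div]
    convert! this using 1
    field_simp
    ring
  · refine ContinuousOn.intervalIntegrable ?_
    rw [uIcc_of_le hab]
    fun_prop (disch := assumption)

theorem norm_integral_one_le (hG : HalfLineBound K G G') {a b lam : ℝ} (ha : 0 < a)
    (hab : a ≤ b) (hlam : 0 < lam) (hne : ∀ ξ ∈ Icc a b, ξ ^ 2 + e ≠ 0)
    (hs : (∀ ξ ∈ Icc a b, ξ ^ 2 ≤ e) ∨ (∀ ξ ∈ Icc a b, e ≤ ξ ^ 2)) :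
    ‖∫ ξ in a..b, airyIntegrand e 1 G ξ‖ ≤
      2 * K * (|a / (3 * (a ^ 2 + e))| + |b / (3 * (b ^ 2 + e))|)
        + (lam * K + (1 / (a ^ 2 + e) - 1 / (b ^ 2 + e)) / 18 / lam) / 2 := by
  have key := norm_integral_osc_le (θ := fun ξ => ξ ^ 3 + 3 * e * ξ)
    (q := fun ξ => 3 * (ξ ^ 2 + e)) (h := fun ξ => ξ / (3 * (ξ ^ 2 + e)))
    (h' := fun ξ => (e - ξ ^ 2) / (3 * (ξ ^ 2 + e) ^ 2)) (G := G) (G' := G') (K := K)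
    (Q := (1 / (a ^ 2 + e) - 1 / (b ^ 2 + e)) / 18) ha hab hlam
    (fun ξ _ => hasDerivAt_airyPhase e ξ) (by fun_prop) (fun ξ hξ => ?_) ?_
    (hs.imp (fun h ξ hξ => ?_) (fun h ξ hξ => ?_))
    (fun ξ _ => hG.hasDerivAt ξ) hG.continuous_deriv.continuousOn
    (fun ξ hξ => hG.norm_le ξ (ha.trans_le hξ.1)) (hG.energy_le a b ha hab) ?_
  · refine le_of_eq_of_le ?_ key
    congr 1
    refine intervalIntegral.integral_congr fun ξ hξ => ?_
    rw [uIcc_of_le hab] at hξ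
    have := hne ξ hξ
    have h2 : ξ / (3 * (ξ ^ 2 + e)) * (3 * (ξ ^ 2 + e)) = ξ := by field_simp
    simp only [airyIntegrand, h2, pow_one]
  · have hn := hne ξ hξ
    have h1 : HasDerivAt (fun ξ : ℝ => 3 * (ξ ^ 2 + e)) (3 * (2 * ξ)) ξ := by
      have := (((hasDerivAt_pow 2 ξ).add_const e).const_mul 3)
      convert! this using 1; norm_num
    have := (hasDerivAt_id ξ).div h1 (by simpa using hn)
    convert! this using 1
    simp only [id]
    field_simp
    ring
  · have h2 : ∀ ξ ∈ Icc a b, 3 * (ξ ^ 2 + e) ^ 2 ≠ 0 := fun ξ hξ => by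
      have := hne ξ hξ; positivity
    fun_prop (disch := assumption)
  · exact div_nonneg (sub_nonneg.2 (h ξ hξ)) (by positivity)
  · exact div_nonpos_of_nonpos_of_nonneg (sub_nonpos.2 (h ξ hξ)) (by positivity)
  · rw [← integral_div_sq_le hab hne]
    refine (intervalIntegral.integral_congr fun ξ hξ => ?_).le
    rw [uIcc_of_le hab] at hξ
    have := hne ξ hξ
    have h0 : ξ ≠ 0 := (ha.trans_le hξ.1).ne'
    field_simp
    norm_num

/-- Comparison of the error integral for `k = 0` with the explicit one for `k = 1`. -/
theorem integral_inv_sq_div_le {a b : ℝ} (ha : 0 < a) (hab : a ≤ b)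
    (hne : ∀ ξ ∈ Icc a b, ξ ^ 2 + e ≠ 0) :
    ∫ ξ in a..b, (1 / (3 * (ξ ^ 2 + e))) ^ 2 / ξ ≤
      (1 / a ^ 2) * ((1 / (a ^ 2 + e) - 1 / (b ^ 2 + e)) / 18) := by
  rw [← integral_div_sq_le hab hne, ← intervalIntegral.integral_const_mul]
  have h2 : ∀ ξ ∈ Icc a b, 9 * (ξ ^ 2 + e) ^ 2 ≠ 0 := fun ξ hξ => by
    have := hne ξ hξ; positivity
  have h3 : ∀ ξ ∈ Icc a b, 3 * (ξ ^ 2 + e) ≠ 0 := fun ξ hξ => by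
    have := hne ξ hξ; positivity
  have h4 : ∀ ξ ∈ Icc a b, ξ ≠ 0 := fun ξ hξ => (ha.trans_le hξ.1).ne'
  refine intervalIntegral.integral_mono_on hab ?_ ?_ fun ξ hξ => ?_
  · refine ContinuousOn.intervalIntegrable ?_
    rw [uIcc_of_le hab]
    fun_prop (disch := assumption)
  · refine ContinuousOn.intervalIntegrable ?_
    rw [uIcc_of_le hab]
    fun_prop (disch := assumption)
  · have h5 := hne ξ hξ
    have h6 : 0 < ξ := ha.trans_le hξ.1
    have : (1 / (3 * (ξ ^ 2 + e))) ^ 2 / ξ = (1 / ξ ^ 2) * (ξ / (9 * (ξ ^ 2 + e) ^ 2)) := by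
      field_simp; norm_num
    rw [this]
    gcongr
    exact hξ.1

theorem norm_integral_split_le (hG : HalfLineBound K G G') (e : ℝ) (k : ℕ) (a b c : ℝ) :
    ‖∫ ξ in a..c, airyIntegrand e k G ξ‖ ≤
      ‖∫ ξ in a..b, airyIntegrand e k G ξ‖ + ‖∫ ξ in b..c, airyIntegrand e k G ξ‖ := by
  rw [← intervalIntegral.integral_add_adjacent_intervals (hG.intervalIntegrable e k a b)
    (hG.intervalIntegrable e k b c)]
  exact norm_add_le _ _

theorem abs_div_three_mul_le {w d W s : ℝ} (hs : 0 < s) (hw : |w| ≤ W * s) (hd : s ≤ |d|) :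
    |w / (3 * d)| ≤ W / 3 * 1 := by
  have hd0 : 0 < |d| := hs.trans_le hd
  have hW : 0 ≤ W := by
    by_contra! h
    nlinarith [abs_nonneg w]
  rw [abs_div, abs_mul, abs_of_pos (by norm_num : (0:ℝ) < 3), div_le_iff₀ (by positivity)]
  nlinarith

theorem mid_bound {s ξ : ℝ} (hs : 0 < s) (h0 : 0 ≤ ξ) (hξ : ξ ≤ s ^ 2 - 1 / s) :
    s ≤ s ^ 4 - ξ ^ 2 := by
  have h1 : 1 / s * s ^ 2 = s := by field_simp
  have h2 : 0 < 1 / s := by positivity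
  have : 1 / s * s ^ 2 ≤ (s ^ 2 - ξ) * (s ^ 2 + ξ) :=
    mul_le_mul (by linarith) (by linarith) (by positivity) (by linarith)
  nlinarith

theorem far_bound {s ξ : ℝ} (hs : 0 < s) (hξ : s ^ 2 + 1 / s ≤ ξ) :
    s ≤ ξ ^ 2 - s ^ 4 ∧ ξ ≤ s * (ξ ^ 2 - s ^ 4) := by
  have h1 : 1 / s * s ^ 2 = s := by field_simp
  have h2 : 0 < 1 / s := by positivity
  have h3 : 1 / s * s = 1 := by field_simp
  have h5 : 0 < s ^ 2 := by positivity
  have : 1 / s * ξ ≤ (ξ - s ^ 2) * (ξ + s ^ 2) :=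
    mul_le_mul (by linarith) (by linarith) (by linarith) (by linarith)
  constructor
  · nlinarith
  · have := mul_le_mul_of_nonneg_left this hs.le
    have h4 : s * (1 / s * ξ) = ξ := by field_simp
    nlinarith

theorem norm_integral_mid_zero_le (hG : HalfLineBound K G G') {s : ℝ} (hs : 0 < s)
    (hab : 1 / s ≤ s ^ 2 - 1 / s) :
    ‖∫ ξ in (1 / s)..(s ^ 2 - 1 / s), airyIntegrand (-s ^ 4) 0 G ξ‖ ≤ 2 * (K + 1) / s := by
  have ha : 0 < 1 / s := by positivity
  have hmid : ∀ ξ ∈ Icc (1 / s) (s ^ 2 - 1 / s), s ≤ |ξ ^ 2 + -s ^ 4| := fun ξ hξ => by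
    have := mid_bound hs (ha.le.trans hξ.1) hξ.2
    rw [abs_of_nonpos (by linarith)]; linarith
  have hne : ∀ ξ ∈ Icc (1 / s) (s ^ 2 - 1 / s), ξ ^ 2 + -s ^ 4 ≠ 0 := fun ξ hξ =>
    abs_pos.1 (hs.trans_le (hmid ξ hξ))
  have hQ : ∫ ξ in (1 / s)..(s ^ 2 - 1 / s), (1 / (3 * (ξ ^ 2 + -s ^ 4))) ^ 2 / ξ
      ≤ 1 / (9 * s ^ 2) := by
    have h2 : ∀ ξ ∈ Icc (1 / s) (s ^ 2 - 1 / s), 3 * (ξ ^ 2 + -s ^ 4) ≠ 0 := fun ξ hξ => by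
      have := hne ξ hξ; positivity
    have h4 : ∀ ξ ∈ Icc (1 / s) (s ^ 2 - 1 / s), ξ ≠ 0 := fun ξ hξ => (ha.trans_le hξ.1).ne'
    have h3 : ∀ ξ ∈ Icc (1 / s) (s ^ 2 - 1 / s), 0 < s ^ 2 - ξ := fun ξ hξ => by
      have := hξ.2; linarith
    have hd : ∀ ξ ∈ Icc (1 / s) (s ^ 2 - 1 / s), HasDerivAt
        (fun ξ => 1 / (9 * s ^ 3) * (s ^ 2 - ξ)⁻¹) (1 / (9 * s ^ 3) * (1 / (s ^ 2 - ξ) ^ 2)) ξ :=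
      fun ξ hξ => by
        have h5 := h3 ξ hξ
        have := (((hasDerivAt_id ξ).const_sub (s ^ 2)).inv h5.ne').const_mul (1 / (9 * s ^ 3))
        convert! this using 1
        simp
    refine (intervalIntegral.integral_le_sub_of_hasDeriv_right_of_le hab
      (fun ξ hξ => (hd ξ hξ).continuousAt.continuousWithinAt)
      (fun ξ hξ => (hd ξ (Ioo_subset_Icc_self hξ)).hasDerivWithinAt) ?_ fun ξ hξ => ?_).trans ?_
    · refine ContinuousOn.integrableOn_Icc ?_
      fun_prop (disch := assumption)
    · have hξ' := Ioo_subset_Icc_self hξ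
      have h5 := h3 ξ hξ'
      have h6 : 0 < ξ := ha.trans hξ.1
      have h7 : (1 / (3 * (ξ ^ 2 + -s ^ 4))) ^ 2 / ξ
          = (1 / ((s ^ 2 + ξ) ^ 2 * ξ * 9)) * (1 / (s ^ 2 - ξ) ^ 2) := by
        have e1 : ξ ^ 2 + -s ^ 4 = -((s ^ 2 - ξ) * (s ^ 2 + ξ)) := by ring
        rw [e1]
        field_simp
        norm_num
      rw [h7]
      refine mul_le_mul_of_nonneg_right (one_div_le_one_div_of_le (by positivity) ?_)
        (by positivity)
      have : (s ^ 2) ^ 2 * (1 / s) ≤ (s ^ 2 + ξ) ^ 2 * ξ := by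
        gcongr
        · linarith
        · exact hξ'.1
      have e2 : (s ^ 2) ^ 2 * (1 / s) = s ^ 3 := by field_simp
      linarith
    · have h5 := h3 _ ⟨le_rfl, hab⟩
      have : 0 ≤ 1 / (9 * s ^ 3) * (s ^ 2 - 1 / s)⁻¹ := by positivity
      have e1 : 1 / (9 * s ^ 3) * (s ^ 2 - (s ^ 2 - 1 / s))⁻¹ = 1 / (9 * s ^ 2) := by
        rw [sub_sub_cancel]; field_simp
      linarith
  have key := hG.norm_integral_zero_le (e := -s ^ 4) (lam := 1 / s) ha hab (by positivity) hne hQ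
  have hb1 := abs_div_three_mul_le (w := 1) (W := 1 / s) hs (by simp [hs.ne'])
    (hmid _ ⟨le_rfl, hab⟩)
  have hb2 := abs_div_three_mul_le (w := 1) (W := 1 / s) hs (by simp [hs.ne'])
    (hmid _ ⟨hab, le_rfl⟩)
  have hK := hG.nonneg
  refine key.trans ?_
  calc _ ≤ 2 * K * (1 / s / 3 * 1 + 1 / s / 3 * 1)
        + (1 / s * K + 1 / (9 * s ^ 2) / (1 / s)) / 2 := by gcongr
    _ = (33 * K + 1) / 18 / s := by field_simp; ring
    _ ≤ _ := by gcongr; linarith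

theorem norm_integral_far_zero_le (hG : HalfLineBound K G G') {s b : ℝ} (hs : 1 ≤ s)
    (hab : s ^ 2 + 1 / s ≤ b) :
    ‖∫ ξ in (s ^ 2 + 1 / s)..b, airyIntegrand (-s ^ 4) 0 G ξ‖ ≤ 2 * (K + 1) / s := by
  have hs0 : 0 < s := by linarith
  have ha : 0 < s ^ 2 + 1 / s := by positivity
  have hfar : ∀ ξ ∈ Icc (s ^ 2 + 1 / s) b, s ≤ ξ ^ 2 + -s ^ 4 := fun ξ hξ => by
    linarith [(far_bound hs0 hξ.1).1]
  have hfar' : ∀ ξ ∈ Icc (s ^ 2 + 1 / s) b, s ≤ |ξ ^ 2 + -s ^ 4| := fun ξ hξ =>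
    (hfar ξ hξ).trans (le_abs_self _)
  have hne : ∀ ξ ∈ Icc (s ^ 2 + 1 / s) b, ξ ^ 2 + -s ^ 4 ≠ 0 := fun ξ hξ =>
    (hs0.trans_le (hfar ξ hξ)).ne'
  have hQ := integral_inv_sq_div_le ha hab hne
  have key := hG.norm_integral_zero_le (e := -s ^ 4) (lam := 1 / s) ha hab (by positivity) hne hQ
  have hb1 := abs_div_three_mul_le (w := 1) (W := 1 / s) hs0 (by simp [hs0.ne'])
    (hfar' _ ⟨le_rfl, hab⟩)
  have hb2 := abs_div_three_mul_le (w := 1) (W := 1 / s) hs0 (by simp [hs0.ne'])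
    (hfar' _ ⟨hab, le_rfl⟩)
  have hK := hG.nonneg
  have h3 : 1 / (s ^ 2 + 1 / s) ^ 2 * ((1 / ((s ^ 2 + 1 / s) ^ 2 + -s ^ 4)
      - 1 / (b ^ 2 + -s ^ 4)) / 18) ≤ 1 / s * (1 / s / 18) := by
    have p1 : 0 ≤ 1 / (b ^ 2 + -s ^ 4) :=
      one_div_nonneg.2 (hs0.le.trans (hfar b ⟨hab, le_rfl⟩))
    have p2 : 1 / ((s ^ 2 + 1 / s) ^ 2 + -s ^ 4) ≤ 1 / s :=
      one_div_le_one_div_of_le hs0 (hfar _ ⟨le_rfl, hab⟩)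
    have p3 : 1 / (s ^ 2 + 1 / s) ^ 2 ≤ 1 / s := by
      apply one_div_le_one_div_of_le hs0
      have : 0 < 1 / s := by positivity
      have : s ≤ s ^ 2 + 1 / s := by nlinarith
      nlinarith
    calc _ ≤ 1 / (s ^ 2 + 1 / s) ^ 2 * (1 / s / 18) := by gcongr; linarith
      _ ≤ _ := by gcongr
  refine key.trans ?_
  calc _ ≤ 2 * K * (1 / s / 3 * 1 + 1 / s / 3 * 1)
        + (1 / s * K + 1 / s * (1 / s / 18) / (1 / s)) / 2 := by gcongr
    _ = (66 * K + 1) / 36 / s := by field_simp; ring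
    _ ≤ _ := by gcongr; linarith

/-- Oscillatory regime with a stationary point at `ξ = s²`, for the function itself. -/
theorem norm_integral_zero_le_of_neg (hG : HalfLineBound K G G') {s b : ℝ} (hs : 0 < s)
    (hs2 : 2 ≤ s ^ 2) (hb : s ^ 2 + 1 / s ≤ b) :
    ‖∫ ξ in 0..b, airyIntegrand (-s ^ 4) 0 G ξ‖ ≤ 10 * (K + 1) / s := by
  have hs1 : 1 ≤ s := by nlinarith
  have hsi : 1 / s ≤ 1 := by rw [div_le_one hs]; exact hs1
  have ha : 0 < 1 / s := by positivity
  have h1 := hG.norm_integral_trivial_le (-s ^ 4) 0 le_rfl ha.le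
  have h2 := hG.norm_integral_mid_zero_le hs (by linarith)
  have h3 := hG.norm_integral_trivial_le (-s ^ 4) 0 (a := s ^ 2 - 1 / s) (b := s ^ 2 + 1 / s)
    (by linarith) (by linarith)
  have h4 := hG.norm_integral_far_zero_le hs1 hb
  have e1 := hG.norm_integral_split_le (-s ^ 4) 0 0 (s ^ 2 + 1 / s) b
  have e2 := hG.norm_integral_split_le (-s ^ 4) 0 0 (s ^ 2 - 1 / s) (s ^ 2 + 1 / s)
  have e3 := hG.norm_integral_split_le (-s ^ 4) 0 0 (1 / s) (s ^ 2 - 1 / s)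
  have hK := hG.nonneg
  have : 10 * (K + 1) / s = K * (1 / s) + 2 * (K + 1) / s + K * (2 * (1 / s)) + 2 * (K + 1) / s
    + (3 * K + 6) / s := by field_simp; ring
  have : 0 ≤ (3 * K + 6) / s := by positivity
  simp only [pow_zero, mul_one] at h1 h3
  linarith

/-- Oscillatory regime with a stationary point at `ξ = s²`, for the derivative. -/
theorem norm_integral_one_le_of_neg (hG : HalfLineBound K G G') {s b : ℝ} (hs : 0 < s)
    (hs2 : 2 ≤ s ^ 2) (hb : s ^ 2 + 1 / s ≤ b) :
    ‖∫ ξ in 0..b, airyIntegrand (-s ^ 4) 1 G ξ‖ ≤ 20 * (K + 1) * s := by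
  have hs1 : 1 ≤ s := by nlinarith
  have hsi : 1 / s ≤ 1 := by rw [div_le_one hs]; exact hs1
  have ha : 0 < 1 / s := by positivity
  have hK := hG.nonneg
  have hmid0 : 1 / s ≤ s ^ 2 - 1 / s := by linarith
  have hmid : ∀ ξ ∈ Icc (1 / s) (s ^ 2 - 1 / s), s ≤ -(ξ ^ 2 + -s ^ 4) := fun ξ hξ => by
    linarith [mid_bound hs (ha.le.trans hξ.1) hξ.2]
  have hmid' : ∀ ξ ∈ Icc (1 / s) (s ^ 2 - 1 / s), s ≤ |ξ ^ 2 + -s ^ 4| := fun ξ hξ =>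
    (hmid ξ hξ).trans (neg_le_abs _)
  have hfar : ∀ ξ ∈ Icc (s ^ 2 + 1 / s) b, s ≤ ξ ^ 2 + -s ^ 4 := fun ξ hξ => by
    linarith [(far_bound hs hξ.1).1]
  have hs4 : ∀ ξ : ℝ, -s ^ 4 ≤ ξ ^ 2 := fun ξ => by
    have : 0 ≤ s ^ 4 := by positivity
    nlinarith [sq_nonneg ξ]
  have k2 := hG.norm_integral_one_le (e := -s ^ 4) (lam := s) ha hmid0 hs
    (fun ξ hξ => abs_pos.1 (hs.trans_le (hmid' ξ hξ))) (Or.inr fun ξ _ => hs4 ξ)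
  have ha4 : 0 < s ^ 2 + 1 / s := by positivity
  have k4 := hG.norm_integral_one_le (e := -s ^ 4) (lam := s) ha4 hb hs
    (fun ξ hξ => (hs.trans_le (hfar ξ hξ)).ne') (Or.inr fun ξ _ => hs4 ξ)
  have hs2' : s ≤ s ^ 2 := by nlinarith
  have c1 : ∀ ξ ∈ Icc (1 / s) (s ^ 2 - 1 / s), |ξ / (3 * (ξ ^ 2 + -s ^ 4))| ≤ s / 3 * 1 :=
    fun ξ hξ => abs_div_three_mul_le (W := s) hs
      (by rw [abs_of_nonneg (ha.le.trans hξ.1)]; nlinarith [hξ.2]) (hmid' ξ hξ)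
  have c2 : ∀ ξ ∈ Icc (s ^ 2 + 1 / s) b, |ξ / (3 * (ξ ^ 2 + -s ^ 4))| ≤ s / 3 * 1 :=
    fun ξ hξ => by
      have hp := hs.trans_le (hfar ξ hξ)
      refine abs_div_three_mul_le (W := s) (s := ξ ^ 2 + -s ^ 4) hp ?_ (le_abs_self _)
      rw [abs_of_nonneg (ha4.le.trans hξ.1)]
      linarith [(far_bound hs hξ.1).2]
  have inv1 : ∀ d : ℝ, s ≤ d → 0 ≤ 1 / d ∧ 1 / d ≤ 1 := fun d hd =>
    ⟨one_div_nonneg.2 (hs.le.trans hd), by rw [div_le_one (hs.trans_le hd)]; linarith⟩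
  have q2 : (1 / ((1 / s) ^ 2 + -s ^ 4) - 1 / ((s ^ 2 - 1 / s) ^ 2 + -s ^ 4)) ≤ 1 := by
    have p1 := (inv1 _ (hmid _ ⟨le_rfl, hmid0⟩)).1
    have p2 := (inv1 _ (hmid _ ⟨hmid0, le_rfl⟩)).2
    rw [div_neg] at p1 p2
    linarith
  have q4 : (1 / ((s ^ 2 + 1 / s) ^ 2 + -s ^ 4) - 1 / (b ^ 2 + -s ^ 4)) ≤ 1 := by
    linarith [(inv1 _ (hfar _ ⟨le_rfl, hb⟩)).2, (inv1 _ (hfar _ ⟨hb, le_rfl⟩)).1]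
  have r : ∀ {x y q : ℝ}, x ≤ s / 3 * 1 → y ≤ s / 3 * 1 → q ≤ 1 →
      2 * K * (x + y) + (s * K + q / 18 / s) / 2 ≤ 2 * (K + 1) * s := fun hx hy hq => by
    calc _ ≤ 2 * K * (s / 3 * 1 + s / 3 * 1) + (s * K + 1 / 18 / s) / 2 := by gcongr
      _ = 11 / 6 * K * s + (1 / s) / 36 := by ring
      _ ≤ _ := by nlinarith
  have h2 := k2.trans (r (c1 _ ⟨le_rfl, hmid0⟩) (c1 _ ⟨hmid0, le_rfl⟩) q2)
  have h4 := k4.trans (r (c2 _ ⟨le_rfl, hb⟩) (c2 _ ⟨hb, le_rfl⟩) q4)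
  have h1 := hG.norm_integral_trivial_le (-s ^ 4) 1 le_rfl ha.le
  have h3 := hG.norm_integral_trivial_le (-s ^ 4) 1 (a := s ^ 2 - 1 / s) (b := s ^ 2 + 1 / s)
    (by linarith) (by linarith)
  have e1 := hG.norm_integral_split_le (-s ^ 4) 1 0 (s ^ 2 + 1 / s) b
  have e2 := hG.norm_integral_split_le (-s ^ 4) 1 0 (s ^ 2 - 1 / s) (s ^ 2 + 1 / s)
  have e3 := hG.norm_integral_split_le (-s ^ 4) 1 0 (1 / s) (s ^ 2 - 1 / s)
  have b1 : K * (1 / s) ^ 1 * (1 / s - 0) ≤ K * s := by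
    rw [pow_one, sub_zero, mul_assoc]
    refine mul_le_mul_of_nonneg_left ?_ hK
    nlinarith
  have b3 : K * (s ^ 2 + 1 / s) ^ 1 * (s ^ 2 + 1 / s - (s ^ 2 - 1 / s)) ≤ 4 * K * s := by
    have : (s ^ 2 + 1 / s) * (1 / s) ≤ 2 * s := by
      have : s ^ 2 * (1 / s) = s := by field_simp
      nlinarith
    nlinarith
  nlinarith

/-- The bounded regime `|e| ≤ 4`. -/
theorem norm_integral_le_of_abs_le (hG : HalfLineBound K G G') (he : |e| ≤ 4) {k : ℕ}
    (hk : k ≤ 1) {b : ℝ} (hb : 4 ≤ b) :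
    ‖∫ ξ in 0..b, airyIntegrand e k G ξ‖ ≤ 20 * (K + 1) := by
  obtain ⟨he1, he2⟩ := abs_le.1 he
  have hK := hG.nonneg
  have hlow : ∀ ξ ∈ Icc 4 b, 1 ≤ ξ ^ 2 + e := fun ξ hξ => by nlinarith [hξ.1]
  have hlow' : ∀ ξ ∈ Icc 4 b, 1 ≤ |ξ ^ 2 + e| := fun ξ hξ => (hlow ξ hξ).trans (le_abs_self _)
  have hne : ∀ ξ ∈ Icc 4 b, ξ ^ 2 + e ≠ 0 := fun ξ hξ => (one_pos.trans_le (hlow ξ hξ)).ne'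
  have q : 1 / ((4:ℝ) ^ 2 + e) - 1 / (b ^ 2 + e) ≤ 1 := by
    have p1 := hlow _ ⟨le_rfl, hb⟩
    have p2 := hlow _ ⟨hb, le_rfl⟩
    have : 1 / ((4:ℝ) ^ 2 + e) ≤ 1 := by rw [div_le_one (by linarith)]; exact p1
    have : 0 ≤ 1 / (b ^ 2 + e) := one_div_nonneg.2 (by linarith)
    linarith
  have h1 := hG.norm_integral_trivial_le e k (a := 0) (b := 4) le_rfl (by norm_num)
  have e1 := hG.norm_integral_split_le e k 0 4 b
  have r : ∀ {x y z : ℝ}, x ≤ 1 / 3 * 1 → y ≤ 1 / 3 * 1 → z ≤ 1 / 18 →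
      2 * K * (x + y) + (1 * K + z / 1) / 2 ≤ 4 * (K + 1) := fun hx hy hz => by
    calc _ ≤ 2 * K * (1 / 3 * 1 + 1 / 3 * 1) + (1 * K + 1 / 18 / 1) / 2 := by gcongr
      _ ≤ _ := by linarith
  interval_cases k
  · have k2 := hG.norm_integral_zero_le (e := e) (lam := 1) (by norm_num) hb one_pos hne
      (integral_inv_sq_div_le (by norm_num) hb hne)
    have hb1 := fun ξ hξ => abs_div_three_mul_le (w := 1) (W := 1) one_pos (by simp) (hlow' ξ hξ)
    have h2 := k2.trans (r (hb1 _ ⟨le_rfl, hb⟩) (hb1 _ ⟨hb, le_rfl⟩) (by linarith))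
    linarith
  · have k2 := hG.norm_integral_one_le (e := e) (lam := 1) (by norm_num) hb one_pos hne
      (Or.inr fun ξ hξ => by linarith [hlow ξ hξ, hξ.1, show (4:ℝ) * 4 ≤ ξ ^ 2 by nlinarith [hξ.1]])
    have hb1 : ∀ ξ ∈ Icc 4 b, |ξ / (3 * (ξ ^ 2 + e))| ≤ 1 / 3 * 1 := fun ξ hξ =>
      abs_div_three_mul_le (w := ξ) (W := 1) (s := ξ ^ 2 + e) (by linarith [hlow ξ hξ])
        (by rw [abs_of_nonneg (by linarith [hξ.1])]; nlinarith [hξ.1]) (le_abs_self _)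
    have h2 := k2.trans (r (hb1 _ ⟨le_rfl, hb⟩) (hb1 _ ⟨hb, le_rfl⟩) (by linarith))
    linarith

/-- Non-stationary regime, for the function itself. -/
theorem norm_integral_zero_le_of_pos (hG : HalfLineBound K G G') {r b : ℝ} (hr : 2 ≤ r)
    (hb : r ≤ b) :
    ‖∫ ξ in 0..b, airyIntegrand (r ^ 2) 0 G ξ‖ ≤ 4 * (K + log r) / r ^ 2 := by
  have hr0 : 0 < r := by linarith
  have hK := hG.nonneg
  have ha : 0 < 1 / r ^ 2 := by positivity
  have ha1 : 1 / r ^ 2 ≤ 1 := by rw [div_le_one (by positivity)]; nlinarith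
  have hab : 1 / r ^ 2 ≤ b := by linarith
  have hlow : ∀ ξ : ℝ, r ^ 2 ≤ |ξ ^ 2 + r ^ 2| := fun ξ => by
    rw [abs_of_nonneg (by positivity)]; nlinarith [sq_nonneg ξ]
  have hne : ∀ ξ : ℝ, ξ ^ 2 + r ^ 2 ≠ 0 := fun ξ => by positivity
  have hlog : 0 ≤ log r := log_nonneg (by linarith)
  have hQ : ∫ ξ in (1 / r ^ 2)..b, (1 / (3 * (ξ ^ 2 + r ^ 2))) ^ 2 / ξ
      ≤ 4 * log r / (9 * r ^ 4) := by
    have h2 : ∀ ξ ∈ Icc (1 / r ^ 2) b, 3 * (ξ ^ 2 + r ^ 2) ≠ 0 := fun ξ _ => by positivity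
    have h4 : ∀ ξ ∈ Icc (1 / r ^ 2) b, ξ ≠ 0 := fun ξ hξ => (ha.trans_le hξ.1).ne'
    have hd : ∀ ξ ∈ Icc (1 / r ^ 2) b, HasDerivAt
        (fun ξ => 1 / (9 * r ^ 4) * (log ξ - log (ξ ^ 2 + r ^ 2) / 2))
        (1 / (9 * r ^ 4) * (1 / ξ - ξ / (ξ ^ 2 + r ^ 2))) ξ := fun ξ hξ => by
      have h1 : HasDerivAt (fun ξ : ℝ => ξ ^ 2 + r ^ 2) (2 * ξ) ξ := by
        have := ((hasDerivAt_pow 2 ξ).add_const (r ^ 2))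
        convert! this using 1; norm_num
      have := ((hasDerivAt_log (h4 ξ hξ)).sub ((h1.log (hne ξ)).div_const 2)).const_mul
        (1 / (9 * r ^ 4))
      convert! this using 1
      rw [one_div ξ]
      congr 2
      ring
    refine (intervalIntegral.integral_le_sub_of_hasDeriv_right_of_le hab
      (fun ξ hξ => (hd ξ hξ).continuousAt.continuousWithinAt)
      (fun ξ hξ => (hd ξ (Ioo_subset_Icc_self hξ)).hasDerivWithinAt) ?_ fun ξ hξ => ?_).trans ?_
    · refine ContinuousOn.integrableOn_Icc ?_
      fun_prop (disch := assumption)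
    · have h6 : 0 < ξ := ha.trans hξ.1
      have h7 : (1 / (3 * (ξ ^ 2 + r ^ 2))) ^ 2 / ξ
          = 1 / (9 * ξ * (ξ ^ 2 + r ^ 2)) * (1 / (ξ ^ 2 + r ^ 2)) := by
        field_simp; norm_num
      have h8 : 1 / (9 * r ^ 4) * (1 / ξ - ξ / (ξ ^ 2 + r ^ 2))
          = 1 / (9 * ξ * (ξ ^ 2 + r ^ 2)) * (1 / r ^ 2) := by
        field_simp; ring
      rw [h7, h8]
      gcongr
      nlinarith [sq_nonneg ξ]
    · have hb0 : 0 < b := by linarith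
      have l1 : log b - log (b ^ 2 + r ^ 2) / 2 ≤ 0 := by
        have : log (b ^ 2) ≤ log (b ^ 2 + r ^ 2) := log_le_log (by positivity) (by nlinarith)
        rw [log_pow] at this
        push_cast at this
        linarith
      have l2 : log (1 / r ^ 2) = -(2 * log r) := by
        rw [one_div, log_inv, log_pow]; push_cast; ring
      have l3 : log ((1 / r ^ 2) ^ 2 + r ^ 2) ≤ 4 * log r := by
        have : log ((1 / r ^ 2) ^ 2 + r ^ 2) ≤ log (r ^ 4) := by
          refine log_le_log (by positivity) ?_
          have : (1 / r ^ 2) ^ 2 ≤ 1 := pow_le_one₀ ha.le ha1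
          have : 4 ≤ r ^ 2 := by nlinarith
          nlinarith
        rw [log_pow] at this
        push_cast at this
        linarith
      have p : 0 ≤ 1 / (9 * r ^ 4) := by positivity
      have : 4 * log r / (9 * r ^ 4) = 1 / (9 * r ^ 4) * (4 * log r) := by ring
      rw [this, ← mul_sub]
      refine mul_le_mul_of_nonneg_left ?_ p
      rw [l2]
      linarith
  have key := hG.norm_integral_zero_le (e := r ^ 2) (lam := 1 / r ^ 2) ha hab (by positivity)
    (fun ξ _ => hne ξ) hQ
  have hb1 := fun ξ => abs_div_three_mul_le (w := 1) (W := 1 / r ^ 2) (by positivity)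
    (by simp [hr0.ne']) (hlow ξ)
  have h1 := hG.norm_integral_trivial_le (r ^ 2) 0 le_rfl ha.le
  have e1 := hG.norm_integral_split_le (r ^ 2) 0 0 (1 / r ^ 2) b
  have h2 := calc ‖∫ ξ in (1 / r ^ 2)..b, airyIntegrand (r ^ 2) 0 G ξ‖ ≤ _ := key
    _ ≤ 2 * K * (1 / r ^ 2 / 3 * 1 + 1 / r ^ 2 / 3 * 1)
        + (1 / r ^ 2 * K + 4 * log r / (9 * r ^ 4) / (1 / r ^ 2)) / 2 := by
      gcongr
      · exact hb1 _
      · exact hb1 _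
    _ = (11 / 6 * K + 2 / 9 * log r) / r ^ 2 := by field_simp; ring
    _ ≤ 3 * (K + log r) / r ^ 2 := by gcongr; linarith
  have : 4 * (K + log r) / r ^ 2 = K * (1 / r ^ 2) + 3 * (K + log r) / r ^ 2 + log r / r ^ 2 := by
    ring
  have : 0 ≤ log r / r ^ 2 := by positivity
  simp only [pow_zero, mul_one, sub_zero] at h1
  linarith

/-- Non-stationary regime, for the derivative. -/
theorem norm_integral_one_le_of_pos (hG : HalfLineBound K G G') {r b : ℝ} (hr : 2 ≤ r)
    (hb : r ≤ b) :
    ‖∫ ξ in 0..b, airyIntegrand (r ^ 2) 1 G ξ‖ ≤ 10 * (K + 1) / r := by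
  have hr0 : 0 < r := by linarith
  have hK := hG.nonneg
  have ha : 0 < 1 / r := by positivity
  have ha1 : 1 / r ≤ 1 := by rw [div_le_one (by positivity)]; linarith
  have hab : 1 / r ≤ r := by linarith
  have hne : ∀ ξ : ℝ, ξ ^ 2 + r ^ 2 ≠ 0 := fun ξ => by positivity
  have k1 := hG.norm_integral_one_le (e := r ^ 2) (lam := 1 / r) ha hab ha (fun ξ _ => hne ξ)
    (Or.inl fun ξ hξ => pow_le_pow_left₀ (ha.le.trans hξ.1) hξ.2 2)
  have k2 := hG.norm_integral_one_le (e := r ^ 2) (lam := 1 / r) hr0 hb ha (fun ξ _ => hne ξ)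
    (Or.inr fun ξ hξ => pow_le_pow_left₀ hr0.le hξ.1 2)
  have c : ∀ ξ : ℝ, |ξ / (3 * (ξ ^ 2 + r ^ 2))| ≤ 1 / r / 3 * 1 := fun ξ => by
    refine abs_div_three_mul_le (W := 1 / r) (s := ξ ^ 2 + r ^ 2) (by positivity) ?_ (le_abs_self _)
    rw [div_mul_eq_mul_div, one_mul, le_div_iff₀ hr0]
    nlinarith [sq_nonneg (|ξ| - r), sq_abs ξ]
  have q : ∀ x y : ℝ, 1 / (x ^ 2 + r ^ 2) - 1 / (y ^ 2 + r ^ 2) ≤ 1 / r ^ 2 := fun x y => by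
    have : 0 ≤ 1 / (y ^ 2 + r ^ 2) := by positivity
    have : 1 / (x ^ 2 + r ^ 2) ≤ 1 / r ^ 2 :=
      one_div_le_one_div_of_le (by positivity) (by nlinarith [sq_nonneg x])
    linarith
  have comb : ∀ x y : ℝ, 2 * K * (|x / (3 * (x ^ 2 + r ^ 2))| + |y / (3 * (y ^ 2 + r ^ 2))|)
        + (1 / r * K + (1 / (x ^ 2 + r ^ 2) - 1 / (y ^ 2 + r ^ 2)) / 18 / (1 / r)) / 2
        ≤ 3 * (K + 1) / r := fun x y => by
    calc _ ≤ 2 * K * (1 / r / 3 * 1 + 1 / r / 3 * 1)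
          + (1 / r * K + 1 / r ^ 2 / 18 / (1 / r)) / 2 := by
          gcongr
          · exact c _
          · exact c _
          · exact q _ _
      _ = (11 / 6 * K + 1 / 36) / r := by field_simp; ring
      _ ≤ _ := by gcongr; linarith
  have h1 := k1.trans (comb _ _)
  have h2 := k2.trans (comb _ _)
  have h0 := hG.norm_integral_trivial_le (r ^ 2) 1 le_rfl ha.le
  have e1 := hG.norm_integral_split_le (r ^ 2) 1 0 r b
  have e2 := hG.norm_integral_split_le (r ^ 2) 1 0 (1 / r) r
  have b0 : K * (1 / r) ^ 1 * (1 / r - 0) ≤ K * (1 / r) := by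
    rw [pow_one, sub_zero, mul_assoc]
    refine mul_le_mul_of_nonneg_left ?_ hK
    nlinarith
  have : 10 * (K + 1) / r = K * (1 / r) + 3 * (K + 1) / r + 3 * (K + 1) / r + (3 * K + 4) / r := by
    ring
  have : 0 ≤ (3 * K + 4) / r := by positivity
  linarith

theorem norm_integral_Ioi_le {k : ℕ} (hi : IntegrableOn (airyIntegrand e k G) (Ioi 0)) {B b₀ : ℝ}
    (h : ∀ b, b₀ ≤ b → ‖∫ ξ in 0..b, airyIntegrand e k G ξ‖ ≤ B) :
    ‖∫ ξ in Ioi 0, airyIntegrand e k G ξ‖ ≤ B :=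
  le_of_tendsto (intervalIntegral_tendsto_integral_Ioi 0 hi Filter.tendsto_id).norm
    (Filter.eventually_atTop.2 ⟨b₀, h⟩)

theorem comp_mul (hG : HalfLineBound K G G') {τ : ℝ} (hτ : 0 < τ) :
    HalfLineBound K (fun ξ => G (τ * ξ)) (fun ξ => τ * G' (τ * ξ)) where
  hasDerivAt ξ := by
    have h := (hG.hasDerivAt (τ * ξ)).scomp ξ ((hasDerivAt_id ξ).const_mul τ)
    convert! h using 1
    simp
  continuous_deriv := by
    have := hG.continuous_deriv
    fun_prop
  norm_le ξ hξ := hG.norm_le _ (mul_pos hτ hξ)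
  energy_le a b ha hab := by
    have h := hG.energy_le (τ * a) (τ * b) (by positivity) (by gcongr)
    have h2 := intervalIntegral.integral_comp_mul_left (a := a) (b := b)
      (fun ξ => ξ * ‖G' ξ‖ ^ 2) hτ.ne'
    refine le_of_eq_of_le ?_ h
    rw [smul_eq_mul, eq_inv_mul_iff_mul_eq₀ hτ.ne'] at h2
    rw [← h2, ← intervalIntegral.integral_const_mul]
    congr 1
    ext ξ
    rw [norm_mul, Complex.norm_real, norm_of_nonneg hτ.le]
    ring

/-- Half-line Airy bounds at unit time. -/
theorem airy_bounds (hG : HalfLineBound K G G') {y w : ℝ} (hw : 0 < w) (hy : w ^ 8 = y ^ 2 + 1)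
    (h0 : IntegrableOn (airyIntegrand (2 * π * y / 3) 0 G) (Ioi 0))
    (h1 : IntegrableOn (airyIntegrand (2 * π * y / 3) 1 G) (Ioi 0)) :
    w * ‖∫ ξ in Ioi 0, airyIntegrand (2 * π * y / 3) 0 G ξ‖ ≤ 40 * (K + 1) ∧
    ‖∫ ξ in Ioi 0, airyIntegrand (2 * π * y / 3) 1 G ξ‖ ≤ 40 * (K + 1) * w ∧
    (2 ≤ y → w ^ 4 * ‖∫ ξ in Ioi 0, airyIntegrand (2 * π * y / 3) 0 G ξ‖
      ≤ 40 * (K + 1) * log (w ^ 4)) ∧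
    (2 ≤ y → w ^ 2 * ‖∫ ξ in Ioi 0, airyIntegrand (2 * π * y / 3) 1 G ξ‖
      ≤ 40 * (K + 1) * log (w ^ 4)) := by
  have hK := hG.nonneg
  obtain ⟨e, he⟩ : ∃ e, e = 2 * π * y / 3 := ⟨_, rfl⟩
  rw [← he] at h0 h1 ⊢
  have hπ := pi_gt_three
  have hπ' := pi_lt_d2
  have hw1 : 1 ≤ w := by
    by_contra! h
    have := pow_lt_one₀ hw.le h (by norm_num : (8:ℕ) ≠ 0)
    nlinarith [sq_nonneg y]
  have hz : (w ^ 4) ^ 2 = y ^ 2 + 1 := by rw [← hy]; ring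
  have hz0 : 0 < w ^ 4 := by positivity
  have hww : w ≤ w ^ 2 := by nlinarith
  set J0 := ‖∫ ξ in Ioi 0, airyIntegrand e 0 G ξ‖
  set J1 := ‖∫ ξ in Ioi 0, airyIntegrand e 1 G ξ‖
  have hJ0 : 0 ≤ J0 := norm_nonneg _
  have hJ1 : 0 ≤ J1 := norm_nonneg _
  rcases le_total e (-4) with hc | hc
  · have hyneg : y < 0 := by
      by_contra! h
      have : 0 ≤ e := by rw [he]; positivity
      linarith
    obtain ⟨s, hs, hs4⟩ : ∃ s : ℝ, 0 < s ∧ s ^ 4 = -e := by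
      refine ⟨√(√(-e)), sqrt_pos.2 (sqrt_pos.2 (by linarith)), ?_⟩
      rw [show (4:ℕ) = 2 * 2 from rfl, pow_mul, sq_sqrt (sqrt_nonneg _), sq_sqrt (by linarith)]
    have hs2 : 2 ≤ s ^ 2 := by
      by_contra! h
      nlinarith [sq_nonneg s]
    have hes : e = -s ^ 4 := by linarith
    have b0 : J0 ≤ 10 * (K + 1) / s := norm_integral_Ioi_le h0 (b₀ := s ^ 2 + 1 / s)
      fun b hb => by rw [hes]; exact hG.norm_integral_zero_le_of_neg hs hs2 hb
    have b1 : J1 ≤ 20 * (K + 1) * s := norm_integral_Ioi_le h1 (b₀ := s ^ 2 + 1 / s)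
      fun b hb => by rw [hes]; exact hG.norm_integral_one_le_of_neg hs hs2 hb
    have hey : 2 * (-y) ≤ -e := by rw [he]; nlinarith
    have hey' : -e ≤ 3 * (-y) := by rw [he]; nlinarith
    have hws : w ≤ s := by
      refine le_of_pow_le_pow_left₀ (n := 4) (by norm_num) hs.le ?_
      rw [hs4]
      refine le_of_pow_le_pow_left₀ two_ne_zero (by linarith) ?_
      nlinarith
    have hsw : s ≤ 2 * w := by
      refine le_of_pow_le_pow_left₀ (n := 4) (by norm_num) (by positivity) ?_
      rw [hs4, mul_pow]
      have : -y ≤ w ^ 4 := by nlinarith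
      linarith
    refine ⟨?_, ?_, fun h => by linarith, fun h => by linarith⟩
    · rw [le_div_iff₀ hs] at b0
      nlinarith
    · nlinarith
  rcases le_total e 4 with hc' | hc'
  · have b0 : J0 ≤ 20 * (K + 1) := norm_integral_Ioi_le h0 (b₀ := 4)
      fun b hb => hG.norm_integral_le_of_abs_le (abs_le.2 ⟨hc, hc'⟩) zero_le_one hb
    have b1 : J1 ≤ 20 * (K + 1) := norm_integral_Ioi_le h1 (b₀ := 4)
      fun b hb => hG.norm_integral_le_of_abs_le (abs_le.2 ⟨hc, hc'⟩) le_rfl hb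
    have hy2 : |y| ≤ 2 := by
      rw [abs_le]
      constructor
      · by_contra! h
        have : e < -4 := by rw [he]; nlinarith
        linarith
      · by_contra! h
        have : 4 < e := by rw [he]; nlinarith
        linarith
    have hw2 : w ≤ 2 := by
      refine le_of_pow_le_pow_left₀ (n := 8) (by norm_num) (by norm_num) ?_
      nlinarith [sq_abs y, abs_nonneg y]
    refine ⟨?_, ?_, fun h => ?_, fun h => ?_⟩
    · nlinarith
    · nlinarith
    all_goals
      have : 4 < e := by rw [he]; nlinarith
      linarith
  · have hy0 : 0 < y := by
      by_contra! h
      have : e ≤ 0 := by rw [he]; nlinarith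
      linarith
    obtain ⟨r, hr, hre⟩ : ∃ r : ℝ, 2 ≤ r ∧ e = r ^ 2 := by
      refine ⟨√e, ?_, (sq_sqrt (by linarith)).symm⟩
      rw [le_sqrt (by norm_num) (by linarith)]
      linarith
    have hr0 : 0 < r := by linarith
    have b0 : J0 ≤ 4 * (K + log r) / r ^ 2 := norm_integral_Ioi_le h0 (b₀ := r)
      fun b hb => by rw [hre]; exact hG.norm_integral_zero_le_of_pos hr hb
    have b1 : J1 ≤ 10 * (K + 1) / r := norm_integral_Ioi_le h1 (b₀ := r)
      fun b hb => by rw [hre]; exact hG.norm_integral_one_le_of_pos hr hb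
    have hey : 2 * y ≤ e := by rw [he]; nlinarith
    have hey' : e ≤ 2.1 * y := by rw [he]; nlinarith
    have hwe : w ^ 4 ≤ r ^ 2 := by
      rw [← hre]
      refine le_of_pow_le_pow_left₀ two_ne_zero (by linarith) ?_
      nlinarith
    have hwr : w ^ 2 ≤ r := by
      refine le_of_pow_le_pow_left₀ two_ne_zero hr0.le ?_
      linarith [show (w ^ 2) ^ 2 = w ^ 4 by ring]
    have hyz : y ≤ w ^ 4 := by
      refine le_of_pow_le_pow_left₀ two_ne_zero hz0.le ?_
      linarith
    have hL : 0.4 ≤ log (w ^ 4) := by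
      have h2 := one_sub_inv_le_log_of_pos hz0
      have : (w ^ 4)⁻¹ ≤ 0.6 := by
        rw [inv_le_comm₀ hz0 (by norm_num)]
        norm_num
        norm_num at hey'
        linarith
      linarith
    have hlr : log r ≤ 3 * log (w ^ 4) := by
      have h2 : log (r ^ 2) ≤ log (4 * w ^ 4) := by
        refine log_le_log (by positivity) ?_
        rw [← hre]
        norm_num at hey'
        linarith
      have h4 : log 4 ≤ 1.4 := by
        rw [show (4:ℝ) = 2 ^ 2 by norm_num, log_pow]
        have := log_two_lt_d9
        push_cast
        linarith
      rw [log_pow, log_mul (by norm_num) hz0.ne'] at h2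
      push_cast at h2
      linarith
    have hlr' : log r ≤ r := (log_le_sub_one_of_pos hr0).trans (by linarith)
    have hlr0 : 0 ≤ log r := log_nonneg (by linarith)
    have c0 := b0
    rw [le_div_iff₀ (by positivity)] at c0
    rw [le_div_iff₀ hr0] at b1
    have hKL : K * 0.4 ≤ K * log (w ^ 4) := mul_le_mul_of_nonneg_left hL hK
    have hKr : K * 1 ≤ K * r := mul_le_mul_of_nonneg_left (by linarith) hK
    have hKw : (K + 1) * 1 ≤ (K + 1) * w := mul_le_mul_of_nonneg_left hw1 (by linarith)
    refine ⟨?_, ?_, fun _ => ?_, fun _ => ?_⟩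
    · have h2 : r * J0 ≤ 4 * (K + 1) := by
        refine le_of_mul_le_mul_right ?_ hr0
        linarith
      have h3 := mul_le_mul_of_nonneg_right (hww.trans hwr) hJ0
      linarith
    · have h3 := mul_le_mul_of_nonneg_left (show 1 ≤ r by linarith) hJ1
      linarith
    · have h3 := mul_le_mul_of_nonneg_right hwe hJ0
      linarith
    · have h3 := mul_le_mul_of_nonneg_right hwr hJ1
      linarith

end HalfLineBound

section SupBound

variable {f f' : ℝ → ℂ}

/-- Local control of a function on `(0, ∞)` by its dyadic `L²` mass and the weighted energy of its
derivative. -/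
theorem norm_le_of_dyadic_of_energy (hf : ∀ ξ, HasDerivAt f (f' ξ) ξ) (hf' : Continuous f')
    (hE : ∀ a b, 0 < a → a ≤ b → ∫ ξ in a..b, ξ * ‖f' ξ‖ ^ 2 ≤ 40)
    (hB : ∀ j : ℤ, ∫ ξ in ((2:ℝ) ^ j)..((2:ℝ) ^ (j + 1)), ‖f ξ‖ ^ 2 ≤ (2:ℝ) ^ j)
    {ξ : ℝ} (hξ : 0 < ξ) : ‖f ξ‖ ≤ 40 := by
  have hfc : Continuous f := continuous_iff_continuousAt.2 fun ξ => (hf ξ).continuousAt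
  obtain ⟨j, hj⟩ := exists_mem_Ico_zpow hξ (one_lt_two (α := ℝ))
  set a : ℝ := (2:ℝ) ^ j with ha_def
  have hb_def : (2:ℝ) ^ (j + 1) = 2 * a := by rw [zpow_add_one₀ (by norm_num), mul_comm]
  have hBj := hB j
  rw [hb_def] at hj hBj
  rw [← ha_def] at hBj
  have ha : 0 < a := by positivity
  have hab : a ≤ 2 * a := by linarith
  have hξI : ξ ∈ Icc a (2 * a) := Ico_subset_Icc_self hj
  have h4 : ∀ ζ ∈ Icc a (2 * a), ζ ≠ 0 := fun ζ hζ => (ha.trans_le hζ.1).ne'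
  have hinv : IntervalIntegrable (fun ζ : ℝ => ζ⁻¹) volume a (2 * a) := by
    refine ContinuousOn.intervalIntegrable ?_
    rw [uIcc_of_le hab]
    fun_prop (disch := assumption)
  have hEi : IntervalIntegrable (fun ζ => ζ * ‖f' ζ‖ ^ 2) volume a (2 * a) :=
    (by fun_prop : Continuous fun ζ => ζ * ‖f' ζ‖ ^ 2).intervalIntegrable _ _
  have hL1 : ∫ ζ in a..(2 * a), ‖f' ζ‖ ≤ 21 := by
    have h1 : ∫ ζ in a..(2 * a), ‖f' ζ‖ ≤
        ∫ ζ in a..(2 * a), ((1 / 2) * (ζ * ‖f' ζ‖ ^ 2) + (1 / 2) * ζ⁻¹) := by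
      refine intervalIntegral.integral_mono_on hab (hf'.norm.intervalIntegrable _ _)
        ((hEi.const_mul _).add (hinv.const_mul _)) fun ζ hζ => ?_
      have hζ0 : 0 < ζ := ha.trans_le hζ.1
      have : (1 / 2) * (ζ * ‖f' ζ‖ ^ 2) + (1 / 2) * ζ⁻¹ - ‖f' ζ‖
          = (ζ * ‖f' ζ‖ - 1) ^ 2 / (2 * ζ) := by field_simp; ring
      have h3 : 0 ≤ (ζ * ‖f' ζ‖ - 1) ^ 2 / (2 * ζ) := by positivity
      linarith
    rw [intervalIntegral.integral_add (hEi.const_mul _) (hinv.const_mul _),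
      intervalIntegral.integral_const_mul, intervalIntegral.integral_const_mul,
      integral_inv_of_pos ha (by positivity)] at h1
    have h2 := hE a (2 * a) ha hab
    have h3 : log (2 * a / a) ≤ 1 := by
      rw [mul_div_cancel_right₀ _ ha.ne']
      linarith [log_two_lt_d9]
    linarith
  have hdiff : ∀ η ∈ Icc a (2 * a), ‖f ξ‖ ≤ ‖f η‖ + 21 := fun η hη => by
    have h1 : ∫ ζ in η..ξ, f' ζ = f ξ - f η :=
      intervalIntegral.integral_eq_sub_of_hasDerivAt (fun ζ _ => hf ζ)
        (hf'.intervalIntegrable _ _)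
    have h2 : ‖f ξ - f η‖ ≤ 21 := by
      rw [← h1]
      refine (intervalIntegral.norm_integral_le_abs_integral_norm).trans (le_trans ?_ hL1)
      rw [← abs_of_nonneg (intervalIntegral.integral_nonneg hab fun ζ _ => norm_nonneg (f' ζ))]
      refine intervalIntegral.abs_integral_mono_interval ?_
        (Filter.Eventually.of_forall fun ζ => norm_nonneg _) (hf'.norm.intervalIntegrable _ _)
      rw [uIoc_of_le hab, uIoc]
      exact Ioc_subset_Ioc (le_min hη.1 hξI.1) (max_le hη.2 hξI.2)
    calc ‖f ξ‖ = ‖f η + (f ξ - f η)‖ := by rw [add_sub_cancel]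
      _ ≤ _ := (norm_add_le _ _).trans (by linarith)
  have hsq : a * ‖f ξ‖ ^ 2 ≤ 2 * a + 882 * a := by
    have hi : IntervalIntegrable (fun η => ‖f η‖ ^ 2) volume a (2 * a) :=
      (hfc.norm.pow 2).intervalIntegrable _ _
    have h1 : ∫ _ in a..(2 * a), ‖f ξ‖ ^ 2 ≤ ∫ η in a..(2 * a), (2 * ‖f η‖ ^ 2 + 882) := by
      refine intervalIntegral.integral_mono_on hab (by simp)
        ((hi.const_mul 2).add (by simp)) fun η hη => ?_
      have := pow_le_pow_left₀ (norm_nonneg _) (hdiff η hη) 2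
      nlinarith [sq_nonneg (‖f η‖ - 21)]
    rw [intervalIntegral.integral_add (hi.const_mul 2) (by simp),
      intervalIntegral.integral_const_mul, intervalIntegral.integral_const,
      intervalIntegral.integral_const, smul_eq_mul, smul_eq_mul] at h1
    linarith
  have : ‖f ξ‖ ^ 2 ≤ 884 := by
    refine le_of_mul_le_mul_left ?_ ha
    linarith
  nlinarith [norm_nonneg (f ξ)]

end SupBound

section Fourier

theorem FT_eq_fourier (u₀ : 𝓢(ℝ, ℝ)) :
    FT u₀ = ⇑(𝓕 (u₀.postcompCLM Complex.ofRealCLM : 𝓢(ℝ, ℂ)) : 𝓢(ℝ, ℂ)) := by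
  rw [SchwartzMap.fourier_coe]
  rfl

theorem FT_neg (u : ℝ → ℝ) (ξ : ℝ) : FT u (-ξ) = (starRingEnd ℂ) (FT u ξ) := by
  simp only [FT, Real.fourier_real_eq_integral_exp_smul]
  rw [← integral_conj]
  congr 1
  ext x
  simp only [smul_eq_mul, map_mul, ← Complex.exp_conj, Complex.conj_ofReal, Complex.conj_I]
  congr 2
  push_cast
  ring

theorem hasDerivAt_FT (u₀ : 𝓢(ℝ, ℝ)) (ξ : ℝ) :
    HasDerivAt (FT u₀) (-2 * π * Complex.I * FT (fun x => x * u₀ x) ξ) ξ := by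
  set U : 𝓢(ℝ, ℂ) := u₀.postcompCLM Complex.ofRealCLM
  have hi : Integrable (fun x : ℝ => x • U x) := by
    have h := U.integrable_pow_mul volume 1
    refine h.mono' (by fun_prop) (Filter.Eventually.of_forall fun x => ?_)
    rw [norm_smul, pow_one]
  have h := Real.hasDerivAt_fourier U.integrable hi ξ
  have e1 : FT u₀ = 𝓕 (U : ℝ → ℂ) := rfl
  rw [e1]
  convert! h using 1
  simp only [FT, Real.fourier_real_eq_integral_exp_smul]
  rw [← integral_const_mul]
  congr 1
  ext x
  have : U x = (u₀ x : ℂ) := rfl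
  rw [this]
  simp only [smul_eq_mul]
  push_cast
  ring

end Fourier

section DataBounds

theorem bddAbove_besov (F : 𝓢(ℝ, ℂ)) :
    BddAbove (range fun j : ℤ => (2:ℝ) ^ (-(j:ℝ)/2) *
      (∫ ξ in {ξ : ℝ | (2:ℝ)^j ≤ |ξ| ∧ |ξ| < (2:ℝ)^(j+1)}, ‖F ξ‖^2) ^ (1/2:ℝ)) := by
  obtain ⟨M, hM⟩ := F.decay 0 0
  have hM' : ∀ ξ, ‖F ξ‖ ≤ M := fun ξ => by simpa using hM.2 ξ
  have hM0 : 0 < M := hM.1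
  refine ⟨2 * M, ?_⟩
  rintro _ ⟨j, rfl⟩
  set A : Set ℝ := {ξ : ℝ | (2:ℝ)^j ≤ |ξ| ∧ |ξ| < (2:ℝ)^(j+1)}
  have h2 : (2:ℝ) ^ (j + 1) = 2 * 2 ^ j := by rw [zpow_add_one₀ (by norm_num), mul_comm]
  have hsub : A ⊆ Icc (-(2:ℝ) ^ (j + 1)) ((2:ℝ) ^ (j + 1)) := fun ξ hξ => abs_le.1 hξ.2.le
  have hval : ∫ ξ in A, ‖F ξ‖ ^ 2 ≤ (2 * M) ^ 2 * 2 ^ j := by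
    calc ∫ ξ in A, ‖F ξ‖ ^ 2 ≤ ∫ ξ in Icc (-(2:ℝ) ^ (j + 1)) ((2:ℝ) ^ (j + 1)), ‖F ξ‖ ^ 2 := by
          refine setIntegral_mono_set ?_ (Filter.Eventually.of_forall fun ξ => by positivity)
            hsub.eventuallyLE
          exact (by fun_prop : Continuous fun ξ => ‖F ξ‖ ^ 2).continuousOn.integrableOn_Icc
      _ ≤ ∫ _ in Icc (-(2:ℝ) ^ (j + 1)) ((2:ℝ) ^ (j + 1)), M ^ 2 := by
          refine setIntegral_mono_on ?_ (by simp) measurableSet_Icc fun ξ _ => ?_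
          · exact (by fun_prop : Continuous fun ξ => ‖F ξ‖ ^ 2).continuousOn.integrableOn_Icc
          · exact pow_le_pow_left₀ (norm_nonneg _) (hM' ξ) 2
      _ = (2 * M) ^ 2 * 2 ^ j := by
          have : (0:ℝ) ≤ 2 ^ (j + 1) - -2 ^ (j + 1) := by
            have : (0:ℝ) < 2 ^ (j + 1) := by positivity
            linarith
          simp only [integral_const, MeasurableSet.univ, measureReal_restrict_apply, univ_inter,
            Real.volume_real_Icc, smul_eq_mul, max_eq_left this]
          rw [h2]; ring
  have h0 : 0 ≤ ∫ ξ in A, ‖F ξ‖ ^ 2 := integral_nonneg fun ξ => by positivity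
  calc (2:ℝ) ^ (-(j:ℝ)/2) * (∫ ξ in A, ‖F ξ‖^2) ^ (1/2:ℝ)
      ≤ (2:ℝ) ^ (-(j:ℝ)/2) * ((2 * M) ^ 2 * 2 ^ j) ^ (1/2:ℝ) := by gcongr
    _ = 2 * M := by
        rw [mul_rpow (by positivity) (by positivity), ← rpow_natCast (2 * M), ← rpow_mul
          (by positivity), ← rpow_intCast, ← rpow_mul (by norm_num), mul_left_comm,
          ← rpow_add (by norm_num)]
        rw [show -(j:ℝ) / 2 + j * (1 / 2) = 0 by ring]
        norm_num

theorem integral_dyadic_FT_le (u₀ : 𝓢(ℝ, ℝ)) (hB : BesovNorm u₀ ≤ 1) (j : ℤ) :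
    ∫ ξ in ((2:ℝ) ^ j)..((2:ℝ) ^ (j + 1)), ‖FT u₀ ξ‖ ^ 2 ≤ (2:ℝ) ^ j := by
  obtain ⟨F, hF⟩ : ∃ F : 𝓢(ℝ, ℂ), FT u₀ = F := ⟨_, FT_eq_fourier u₀⟩
  have hbdd := bddAbove_besov F
  rw [← hF] at hbdd
  have h1 := (le_ciSup hbdd j).trans hB
  set A : Set ℝ := {ξ : ℝ | (2:ℝ)^j ≤ |ξ| ∧ |ξ| < (2:ℝ)^(j+1)} with hA
  have h2 : (2:ℝ) ^ j ≤ (2:ℝ) ^ (j + 1) := zpow_le_zpow_right₀ (by norm_num) (by lia)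
  have h0 : 0 ≤ ∫ ξ in A, ‖FT u₀ ξ‖ ^ 2 := integral_nonneg fun ξ => by positivity
  have hcont : Continuous fun ξ => ‖FT u₀ ξ‖ ^ 2 := by rw [hF]; fun_prop
  have hle : ∫ ξ in ((2:ℝ) ^ j)..((2:ℝ) ^ (j + 1)), ‖FT u₀ ξ‖ ^ 2 ≤ ∫ ξ in A, ‖FT u₀ ξ‖ ^ 2 := by
    rw [intervalIntegral.integral_of_le h2, integral_Ioc_eq_integral_Ioo]
    refine setIntegral_mono_set ?_ (Filter.Eventually.of_forall fun ξ => by positivity)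
      (LE.le.eventuallyLE fun ξ hξ => ?_)
    · refine IntegrableOn.mono_set (t := Icc (-(2:ℝ) ^ (j + 1)) ((2:ℝ) ^ (j + 1)))
        hcont.continuousOn.integrableOn_Icc fun ξ hξ => abs_le.1 hξ.2.le
    · have : 0 < ξ := lt_trans (by positivity) hξ.1
      rw [hA, mem_ofPred_eq, abs_of_pos this]
      exact ⟨hξ.1.le, hξ.2⟩
  refine hle.trans ?_
  set X := ∫ ξ in A, ‖FT u₀ ξ‖ ^ 2
  have h3 := pow_le_pow_left₀ (by positivity) h1 2
  rw [mul_pow, ← rpow_natCast (X ^ (1/2:ℝ)), ← rpow_mul h0, ← rpow_natCast ((2:ℝ) ^ (-(j:ℝ)/2)),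
    ← rpow_mul (by norm_num)] at h3
  norm_num at h3
  rwa [rpow_neg (by norm_num), rpow_intCast, inv_mul_le_iff₀ (by positivity), mul_one] at h3

theorem norm_deriv_FT (u₀ : 𝓢(ℝ, ℝ)) (ξ : ℝ) :
    ‖deriv (FT u₀) ξ‖ = 2 * π * ‖FT (fun x => x * u₀ x) ξ‖ := by
  rw [(hasDerivAt_FT u₀ ξ).deriv]
  simp [abs_of_pos pi_pos]

theorem integral_energy_FT_le (u₀ : 𝓢(ℝ, ℝ)) (hH : HsNorm (1 / 2) (fun x => x * u₀ x) ≤ 1)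
    {a b : ℝ} (ha : 0 < a) (hab : a ≤ b) :
    ∫ ξ in a..b, ξ * ‖deriv (FT u₀) ξ‖ ^ 2 ≤ 40 := by
  obtain ⟨F, hF⟩ : ∃ F : 𝓢(ℝ, ℂ), FT u₀ = F := ⟨_, FT_eq_fourier u₀⟩
  obtain ⟨D, hD⟩ : ∃ D : 𝓢(ℝ, ℂ), ∀ ξ, deriv (FT u₀) ξ = D ξ :=
    ⟨SchwartzMap.derivCLM ℂ ℂ F, fun ξ => by rw [hF, SchwartzMap.derivCLM_apply]⟩
  obtain ⟨M, hM⟩ := D.decay 0 0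
  have hM' : ∀ ξ, ‖D ξ‖ ≤ M := fun ξ => by simpa using hM.2 ξ
  have hi : Integrable fun ξ : ℝ => |ξ| * ‖D ξ‖ ^ 2 := by
    refine ((D.integrable_pow_mul volume 1).const_mul M).mono' (by fun_prop)
      (Filter.Eventually.of_forall fun ξ => ?_)
    rw [norm_of_nonneg (by positivity), pow_one, norm_eq_abs, sq]
    nlinarith [hM' ξ, mul_nonneg (abs_nonneg ξ) (norm_nonneg (D ξ))]
  have hval : ∫ ξ : ℝ, |ξ| * ‖D ξ‖ ^ 2 ≤ 40 := by
    have e1 : ∀ ξ : ℝ, |ξ| * ‖D ξ‖ ^ 2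
        = (2 * π) ^ 2 * (|ξ| ^ (2 * (1 / 2 : ℝ)) * ‖FT (fun x => x * u₀ x) ξ‖ ^ 2) := fun ξ => by
      rw [← hD, norm_deriv_FT]
      norm_num
      ring
    simp_rw [e1]
    rw [integral_const_mul]
    rw [HsNorm] at hH
    have h0 : 0 ≤ ∫ ξ : ℝ, |ξ| ^ (2 * (1 / 2 : ℝ)) * ‖FT (fun x => x * u₀ x) ξ‖ ^ 2 :=
      integral_nonneg fun ξ => by positivity
    have h1 : ∫ ξ : ℝ, |ξ| ^ (2 * (1 / 2 : ℝ)) * ‖FT (fun x => x * u₀ x) ξ‖ ^ 2 ≤ 1 := by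
      by_contra! h
      exact absurd hH (not_le.2 (one_lt_rpow h (by norm_num)))
    have := pi_lt_d2
    have := pi_pos
    nlinarith
  refine le_trans ?_ hval
  rw [intervalIntegral.integral_of_le hab]
  calc ∫ ξ in Ioc a b, ξ * ‖deriv (FT u₀) ξ‖ ^ 2 = ∫ ξ in Ioc a b, |ξ| * ‖D ξ‖ ^ 2 :=
        setIntegral_congr_fun measurableSet_Ioc fun ξ hξ => by
          simp only [hD, abs_of_pos (ha.trans hξ.1)]
    _ ≤ _ := setIntegral_le_integral hi (Filter.Eventually.of_forall fun ξ => by positivity)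

theorem halfLineBound_FT (u₀ : 𝓢(ℝ, ℝ))
    (h : BesovNorm u₀ + HsNorm (1 / 2) (fun x => x * u₀ x) ≤ 1) :
    HalfLineBound 40 (FT u₀) (deriv (FT u₀)) := by
  have hB0 : 0 ≤ BesovNorm u₀ := Real.iSup_nonneg fun j => mul_nonneg (by positivity)
    (rpow_nonneg (integral_nonneg fun ξ => by positivity) _)
  have hH0 : 0 ≤ HsNorm (1 / 2) (fun x => x * u₀ x) :=
    rpow_nonneg (integral_nonneg fun ξ => by positivity) _
  have hE : ∀ a b, 0 < a → a ≤ b → ∫ ξ in a..b, ξ * ‖deriv (FT u₀) ξ‖ ^ 2 ≤ 40 :=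
    fun a b ha hab => integral_energy_FT_le u₀ (by linarith) ha hab
  have hd : ∀ ξ, HasDerivAt (FT u₀) (deriv (FT u₀) ξ) ξ := fun ξ =>
    (hasDerivAt_FT u₀ ξ).differentiableAt.hasDerivAt
  have hc : Continuous (deriv (FT u₀)) := by
    rw [FT_eq_fourier]
    exact (SchwartzMap.derivCLM ℂ ℂ _).continuous
  exact ⟨hd, hc, fun ξ hξ => norm_le_of_dyadic_of_energy hd hc hE
    (integral_dyadic_FT_le u₀ (by linarith)) hξ, hE⟩

end DataBounds

section Airy

/-- The integrand of the `k`-th frequency moment of the Airy evolution with Fourier data `f`. -/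
def evolutionIntegrand (t x : ℝ) (k : ℕ) (f : ℝ → ℂ) (ξ : ℝ) : ℂ :=
  Complex.exp (Complex.I * ((t * ξ ^ 3 + 2 * π * x * ξ : ℝ) : ℂ)) * ((ξ ^ k : ℝ) : ℂ) * f ξ

theorem integrable_evolutionIntegrand (F : 𝓢(ℝ, ℂ)) (t x : ℝ) (k : ℕ) :
    Integrable (evolutionIntegrand t x k F) := by
  refine (F.integrable_pow_mul volume k).mono'
    (by unfold evolutionIntegrand; fun_prop) (Filter.Eventually.of_forall fun ξ => ?_)
  rw [evolutionIntegrand, norm_mul, norm_mul, Complex.norm_exp_I_mul_ofReal, one_mul,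
    Complex.norm_real, norm_pow]

theorem airy_eq_fourier_neg (u₀ : 𝓢(ℝ, ℝ)) (t x : ℝ) :
    airy u₀ t x = 𝓕 (evolutionIntegrand t 0 0 (FT u₀)) (-x) := by
  rw [airy, Real.fourierInv_eq_fourier_neg]
  refine congrArg (fun g : ℝ → ℂ => (𝓕 g : ℝ → ℂ) (-x)) (funext fun ξ => ?_)
  simp [evolutionIntegrand, mul_assoc]

theorem fourier_evolutionIntegrand (f : ℝ → ℂ) (t x : ℝ) (k : ℕ) :
    𝓕 (evolutionIntegrand t 0 k f) (-x) = ∫ ξ, evolutionIntegrand t x k f ξ := by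
  rw [Real.fourier_real_eq_integral_exp_smul]
  congr 1
  ext ξ
  simp only [evolutionIntegrand, smul_eq_mul, ← mul_assoc, ← Complex.exp_add]
  congr 3
  push_cast
  ring

theorem airy_eq_integral (u₀ : 𝓢(ℝ, ℝ)) (t x : ℝ) :
    airy u₀ t x = ∫ ξ, evolutionIntegrand t x 0 (FT u₀) ξ := by
  rw [airy_eq_fourier_neg, fourier_evolutionIntegrand]

theorem deriv_airy_eq_integral (u₀ : 𝓢(ℝ, ℝ)) (t x : ℝ) :
    deriv (airy u₀ t) x =
      2 * π * Complex.I * ∫ ξ, evolutionIntegrand t x 1 (FT u₀) ξ := by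
  obtain ⟨F, hF⟩ : ∃ F : 𝓢(ℝ, ℂ), FT u₀ = F := ⟨_, FT_eq_fourier u₀⟩
  have e1 : airy u₀ t = fun x => 𝓕 (evolutionIntegrand t 0 0 F) (-x) := by
    ext x
    rw [airy_eq_fourier_neg, hF]
  have hi : Integrable fun ξ : ℝ => ξ • evolutionIntegrand t 0 0 F ξ := by
    convert integrable_evolutionIntegrand F t 0 1 using 2 with ξ
    simp only [evolutionIntegrand, Complex.real_smul]
    push_cast
    ring
  have h := (Real.hasDerivAt_fourier (integrable_evolutionIntegrand F t 0 0) hi (-x)).scomp x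
    (hasDerivAt_neg x)
  rw [e1, hF]
  refine h.deriv.trans ?_
  rw [← fourier_evolutionIntegrand, Real.fourier_real_eq_integral_exp_smul,
    Real.fourier_real_eq_integral_exp_smul, ← integral_const_mul, ← integral_smul]
  congr 1
  ext ξ
  simp only [evolutionIntegrand, smul_eq_mul, Complex.real_smul]
  push_cast
  ring

theorem norm_integral_evolutionIntegrand_le (u₀ : 𝓢(ℝ, ℝ)) (t x : ℝ) (k : ℕ) :
    ‖∫ ξ, evolutionIntegrand t x k (FT u₀) ξ‖
      ≤ 2 * ‖∫ ξ in Ioi 0, evolutionIntegrand t x k (FT u₀) ξ‖ := by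
  have hi : Integrable (evolutionIntegrand t x k (FT u₀)) := by
    rw [FT_eq_fourier]
    exact integrable_evolutionIntegrand _ t x k
  have hneg : ∀ ξ, evolutionIntegrand t x k (FT u₀) (-ξ)
      = (-1) ^ k * (starRingEnd ℂ) (evolutionIntegrand t x k (FT u₀) ξ) := fun ξ => by
    simp only [evolutionIntegrand, FT_neg, map_mul, ← Complex.exp_conj, Complex.conj_ofReal,
      Complex.conj_I]
    have e1 : (((-ξ) ^ k : ℝ) : ℂ) = (-1) ^ k * ((ξ ^ k : ℝ) : ℂ) := by
      rw [neg_pow]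
      push_cast
      ring
    have e2 : Complex.I * ((t * (-ξ) ^ 3 + 2 * π * x * (-ξ) : ℝ) : ℂ)
        = -Complex.I * ((t * ξ ^ 3 + 2 * π * x * ξ : ℝ) : ℂ) := by
      push_cast
      ring
    rw [e1, e2]
    ring
  have h1 : ∫ ξ in Iic 0, evolutionIntegrand t x k (FT u₀) ξ
      = (-1) ^ k * (starRingEnd ℂ) (∫ ξ in Ioi 0, evolutionIntegrand t x k (FT u₀) ξ) := by
    have h2 := integral_comp_neg_Ioi 0 (evolutionIntegrand t x k (FT u₀))
    rw [neg_zero] at h2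
    rw [← h2, ← integral_conj, ← integral_const_mul]
    simp_rw [hneg]
  rw [← intervalIntegral.integral_Iic_add_Ioi hi.integrableOn hi.integrableOn (b := 0), h1]
  refine (norm_add_le _ _).trans (le_of_eq ?_)
  rw [norm_mul, norm_pow, norm_neg, norm_one, one_pow, one_mul, RCLike.norm_conj]
  ring

theorem airyIntegrand_comp_mul {t τ : ℝ} (hτ : t * τ ^ 3 = 1) (x : ℝ) (k : ℕ) (f : ℝ → ℂ)
    (ξ : ℝ) :
    evolutionIntegrand t x k f (τ * ξ)
      = ((τ ^ k : ℝ) : ℂ) * airyIntegrand (2 * π * (x * τ) / 3) k (fun ξ => f (τ * ξ)) ξ := by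
  have e1 : t * (τ * ξ) ^ 3 + 2 * π * x * (τ * ξ) = ξ ^ 3 + 3 * (2 * π * (x * τ) / 3) * ξ := by
    linear_combination ξ ^ 3 * hτ
  rw [evolutionIntegrand, airyIntegrand, e1, mul_pow]
  push_cast
  ring

theorem integrable_airyIntegrand_comp_mul (u₀ : 𝓢(ℝ, ℝ)) {t τ : ℝ} (h0 : 0 < τ)
    (hτ : t * τ ^ 3 = 1) (x : ℝ) (k : ℕ) :
    Integrable (airyIntegrand (2 * π * (x * τ) / 3) k (fun ξ => FT u₀ (τ * ξ))) := by
  have hi : Integrable (evolutionIntegrand t x k (FT u₀)) := by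
    rw [FT_eq_fourier]
    exact integrable_evolutionIntegrand _ t x k
  have h1 := (hi.comp_mul_left' h0.ne').const_mul (((τ ^ k : ℝ) : ℂ)⁻¹)
  refine h1.congr (Filter.Eventually.of_forall fun ξ => ?_)
  have : ((τ ^ k : ℝ) : ℂ) ≠ 0 := by
    rw [Complex.ofReal_ne_zero]
    positivity
  simp only
  rw [airyIntegrand_comp_mul hτ, inv_mul_cancel_left₀ this]

theorem norm_integral_Ioi_evolutionIntegrand (f : ℝ → ℂ) {t τ : ℝ} (h0 : 0 < τ)
    (hτ : t * τ ^ 3 = 1) (x : ℝ) (k : ℕ) :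
    ‖∫ ξ in Ioi 0, evolutionIntegrand t x k f ξ‖ = τ ^ (k + 1) *
      ‖∫ ξ in Ioi 0, airyIntegrand (2 * π * (x * τ) / 3) k (fun ξ => f (τ * ξ)) ξ‖ := by
  have h1 := integral_comp_mul_left_Ioi (evolutionIntegrand t x k f) 0 h0
  simp_rw [airyIntegrand_comp_mul hτ, mul_zero] at h1
  rw [integral_const_mul, Complex.real_smul, eq_comm, Complex.ofReal_inv,
    inv_mul_eq_iff_eq_mul₀ (Complex.ofReal_ne_zero.2 h0.ne')] at h1
  rw [h1, norm_mul, norm_mul, Complex.norm_real, Complex.norm_real, norm_of_nonneg h0.le,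
    norm_of_nonneg (by positivity), pow_succ]
  ring

theorem norm_airy_le (u₀ : 𝓢(ℝ, ℝ)) {t τ : ℝ} (h0 : 0 < τ) (hτ : t * τ ^ 3 = 1) (x : ℝ) :
    ‖airy u₀ t x‖ ≤ 2 * τ *
      ‖∫ ξ in Ioi 0, airyIntegrand (2 * π * (x * τ) / 3) 0 (fun ξ => FT u₀ (τ * ξ)) ξ‖ := by
  have h := norm_integral_evolutionIntegrand_le u₀ t x 0
  rw [norm_integral_Ioi_evolutionIntegrand _ h0 hτ, zero_add, pow_one] at h
  rw [airy_eq_integral]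
  linarith

theorem norm_deriv_airy_le (u₀ : 𝓢(ℝ, ℝ)) {t τ : ℝ} (h0 : 0 < τ) (hτ : t * τ ^ 3 = 1) (x : ℝ) :
    ‖deriv (airy u₀ t) x‖ ≤ 13 * τ ^ 2 *
      ‖∫ ξ in Ioi 0, airyIntegrand (2 * π * (x * τ) / 3) 1 (fun ξ => FT u₀ (τ * ξ)) ξ‖ := by
  have h := norm_integral_evolutionIntegrand_le u₀ t x 1
  rw [norm_integral_Ioi_evolutionIntegrand _ h0 hτ] at h
  rw [deriv_airy_eq_integral, norm_mul, norm_mul, norm_mul, Complex.norm_I, mul_one,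
    Complex.norm_real, norm_of_nonneg pi_pos.le, Complex.norm_ofNat]
  set J := ‖∫ ξ in Ioi 0, airyIntegrand (2 * π * (x * τ) / 3) 1 (fun ξ => FT u₀ (τ * ξ)) ξ‖
  calc _ ≤ 2 * π * (2 * (τ ^ (1 + 1) * J)) := mul_le_mul_of_nonneg_left h (by positivity)
    _ = 2 * π * 2 * (τ ^ 2 * J) := by ring
    _ ≤ 13 * (τ ^ 2 * J) := by
        gcongr
        linarith [pi_lt_d2]
    _ = _ := by ring

end Airy
/-- Dispersive decay for the Airy (linear KdV) evolution with Besov/weighted data. -/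
theorem airy_dispersive_decay_besov :
    ∃ C : ℝ, 0 < C ∧ ∀ u₀ : 𝓢(ℝ, ℝ),
      BesovNorm ⇑u₀ + HsNorm ((1:ℝ)/2) (fun x => x * u₀ x) ≤ 1 →
      ∀ t : ℝ, 0 < t →
        (∀ x : ℝ,
          t ^ ((1:ℝ)/4) * jb t x ^ ((1:ℝ)/4) * ‖airy (⇑u₀) t x‖
            + t ^ ((3:ℝ)/4) * jb t x ^ (-(1:ℝ)/4) * ‖deriv (airy (⇑u₀) t) x‖ ≤ C) ∧
        (∀ x : ℝ, 2 * t ^ ((1:ℝ)/3) ≤ x →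
          jb t x * ‖airy (⇑u₀) t x‖
            + t ^ ((1:ℝ)/2) * jb t x ^ ((1:ℝ)/2) * ‖deriv (airy (⇑u₀) t) x‖
            ≤ C * Real.log (t ^ (-(1:ℝ)/3) * jb t x)) := by
  refine ⟨30000, by norm_num, fun u₀ h t ht => ?_⟩
  have hG := halfLineBound_FT u₀ h
  obtain ⟨σ, hσ, rfl⟩ : ∃ σ : ℝ, 0 < σ ∧ σ ^ 12 = t :=
    ⟨t ^ (1 / 12 : ℝ), by positivity, by rw [← rpow_natCast, ← rpow_mul ht.le]; norm_num⟩
  have hpow : ∀ (r : ℝ) (n : ℕ), 12 * r = n → (σ ^ 12) ^ r = σ ^ n := fun r n hr => by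
    rw [← rpow_natCast σ 12, ← rpow_mul hσ.le, ← rpow_natCast σ n, ← hr]
    norm_num
  have key : ∀ x : ℝ, ∃ W > 0, jb (σ ^ 12) x = W ^ 4 ∧ W ^ 8 = x ^ 2 + σ ^ 8 := fun x => by
    have h8 : 0 < x ^ 2 + σ ^ 8 := by positivity
    refine ⟨(x ^ 2 + σ ^ 8) ^ (1 / 8 : ℝ), by positivity, ?_, ?_⟩
    · rw [jb, hpow _ 8 (by norm_num), ← rpow_natCast _ 4, ← rpow_mul h8.le]
      norm_num
    · rw [← rpow_natCast _ 8, ← rpow_mul h8.le]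
      norm_num
  have hτ : (σ ^ 12) * ((σ ^ 4)⁻¹) ^ 3 = 1 := by field_simp
  have hτ0 : 0 < (σ ^ 4)⁻¹ := by positivity
  have bounds : ∀ x W : ℝ, 0 < W → W ^ 8 = x ^ 2 + σ ^ 8 → _ := fun x W hW hx =>
    (hG.comp_mul hτ0).airy_bounds (y := x * (σ ^ 4)⁻¹) (w := W / σ) (by positivity)
      (by rw [div_pow, hx]; field_simp)
      (integrable_airyIntegrand_comp_mul u₀ hτ0 hτ x 0).integrableOn
      (integrable_airyIntegrand_comp_mul u₀ hτ0 hτ x 1).integrableOn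
  constructor
  · intro x
    obtain ⟨W, hW, hjb, hx⟩ := key x
    obtain ⟨h1, h2, -, -⟩ := bounds x W hW hx
    have hu := norm_airy_le u₀ hτ0 hτ x
    have hv := norm_deriv_airy_le u₀ hτ0 hτ x
    rw [hjb, hpow _ 3 (by norm_num), hpow _ 9 (by norm_num), ← rpow_natCast W 4,
      ← rpow_mul hW.le, ← rpow_mul hW.le]
    norm_num only [rpow_one, rpow_neg_one]
    set J₀ := ‖∫ ξ in Ioi 0, airyIntegrand (2 * π * (x * (σ ^ 4)⁻¹) / 3) 0
      (fun ξ => FT u₀ ((σ ^ 4)⁻¹ * ξ)) ξ‖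
    set J₁ := ‖∫ ξ in Ioi 0, airyIntegrand (2 * π * (x * (σ ^ 4)⁻¹) / 3) 1
      (fun ξ => FT u₀ ((σ ^ 4)⁻¹ * ξ)) ξ‖
    calc _ ≤ σ ^ 3 * W * (2 * (σ ^ 4)⁻¹ * J₀) + σ ^ 9 * W⁻¹ * (13 * ((σ ^ 4)⁻¹) ^ 2 * J₁) := by
          gcongr
      _ = 2 * (W / σ * J₀) + 13 * (J₁ / (W / σ)) := by field_simp
      _ ≤ 2 * (40 * (40 + 1)) + 13 * (40 * (40 + 1)) := by
          gcongr
          rwa [div_le_iff₀ (by positivity)]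
      _ ≤ 30000 := by norm_num
  · intro x hx2
    obtain ⟨W, hW, hjb, hx⟩ := key x
    rw [hpow _ 4 (by norm_num)] at hx2
    have hy : 2 ≤ x * (σ ^ 4)⁻¹ := by
      rwa [← div_eq_mul_inv, le_div_iff₀ (by positivity)]
    obtain ⟨-, -, h1, h2⟩ := bounds x W hW hx
    have hu := norm_airy_le u₀ hτ0 hτ x
    have hv := norm_deriv_airy_le u₀ hτ0 hτ x
    have hneg : (σ ^ 12) ^ (-(1:ℝ) / 3) = (σ ^ 4)⁻¹ := by
      rw [neg_div, rpow_neg (by positivity), hpow _ 4 (by norm_num)]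
    have hL : (σ ^ 4)⁻¹ * W ^ 4 = (W / σ) ^ 4 := by field_simp
    have hW2 : (W ^ 4) ^ ((1:ℝ) / 2) = W ^ 2 := by
      rw [← rpow_natCast W 4, ← rpow_mul hW.le, ← rpow_natCast W 2]
      norm_num
    have hlog : 0 ≤ log ((W / σ) ^ 4) := by
      refine log_nonneg (one_le_pow₀ ?_)
      rw [one_le_div hσ]
      refine le_of_pow_le_pow_left₀ (n := 8) (by norm_num) hW.le ?_
      rw [hx]
      nlinarith [sq_nonneg x]
    rw [hneg, hjb, hL, hW2, hpow _ 6 (by norm_num)]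
    specialize h1 hy
    specialize h2 hy
    set J₀ := ‖∫ ξ in Ioi 0, airyIntegrand (2 * π * (x * (σ ^ 4)⁻¹) / 3) 0
      (fun ξ => FT u₀ ((σ ^ 4)⁻¹ * ξ)) ξ‖
    set J₁ := ‖∫ ξ in Ioi 0, airyIntegrand (2 * π * (x * (σ ^ 4)⁻¹) / 3) 1
      (fun ξ => FT u₀ ((σ ^ 4)⁻¹ * ξ)) ξ‖
    calc _ ≤ W ^ 4 * (2 * (σ ^ 4)⁻¹ * J₀) + σ ^ 6 * W ^ 2 * (13 * ((σ ^ 4)⁻¹) ^ 2 * J₁) := by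
          gcongr
      _ = 2 * ((W / σ) ^ 4 * J₀) + 13 * ((W / σ) ^ 2 * J₁) := by field_simp
      _ ≤ 2 * (40 * (40 + 1) * log ((W / σ) ^ 4))
          + 13 * (40 * (40 + 1) * log ((W / σ) ^ 4)) := by gcongr
      _ ≤ 30000 * log ((W / σ) ^ 4) := by linarith
end
end
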